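/- Let α ∈ ℝ ∖ ℚ be exponentially Liouville. Then every subcritical analytic cocycle (α, A), with A : ℝ/ℤ → SL(2,ℝ) analytic, is almost reducible. -/

import Mathlib

open Complex Real Filter

noncomputable section

attribute [local instance] Matrix.normedAddCommGroup Matrix.normedSpace

/-- 2×2 complex matrices (holomorphic extensions of real matrix maps). -/
abbrev M2 : Type := Matrix (Fin 2) (Fin 2) ℂ

/-- The horizontal strip of half-width `ε` around the real axis. -/
def Strip (ε : ℝ) : Set ℂ := {z : ℂ | |z.im| < ε}

/-- Iterates of the cocycle: `cocycleIter α A k z = A(z+(k-1)α) ⋯ A(z)`, with value `1` for `k=0`. -/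
def cocycleIter (α : ℝ) (A : ℂ → M2) : ℕ → ℂ → M2
  | 0 => fun _ => 1
  | k + 1 => fun z => A (z + (k : ℂ) * (α : ℂ)) * cocycleIter α A k z

/-- `A ∈ C^ω_ε(ℝ/ℤ, SL(2,ℝ))`: a 1-periodic holomorphic map on the strip of half-width `ε`,
real-valued on `ℝ`, with determinant 1. -/
def IsSL2Strip (ε : ℝ) (A : ℂ → M2) : Prop :=
  DifferentiableOn ℂ A (Strip ε) ∧ (∀ z : ℂ, A (z + 1) = A z) ∧
  (∀ x : ℝ, ∀ i j, (A (x : ℝ) i j).im = 0) ∧ (∀ z ∈ Strip ε, (A z).det = 1)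

/-- `B ∈ C^ω_ε(ℝ/ℤ, PSL(2,ℝ))`: a holomorphic map on the strip of half-width `ε`,
real-valued on `ℝ`, with determinant 1, which is 1-periodic up to sign. -/
def IsPSL2Strip (ε : ℝ) (B : ℂ → M2) : Prop :=
  DifferentiableOn ℂ B (Strip ε) ∧
  (∃ s : ℂ, (s = 1 ∨ s = -1) ∧ ∀ z : ℂ, B (z + 1) = s • B z) ∧
  (∀ x : ℝ, ∀ i j, (B (x : ℝ) i j).im = 0) ∧ (∀ z ∈ Strip ε, (B z).det = 1)

/-- The rotation matrix `R_θ` (with holomorphic dependence on `θ`). -/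
def Rot (θ : ℂ) : M2 :=
  !![Complex.cos (2 * π * θ), -Complex.sin (2 * π * θ);
     Complex.sin (2 * π * θ), Complex.cos (2 * π * θ)]

/-- `α` is exponentially Liouville: `limsup (ln q_{n+1})/q_n > 0` for the continued fraction
denominators `q_n` of `α`. -/
def ExpLiouville (α : ℝ) : Prop :=
  0 < Filter.limsup
      (fun n => Real.log ((GenContFract.of α).dens (n + 1)) / (GenContFract.of α).dens n)
      Filter.atTop

/-- `(α, A)` is almost reducible, where `A` is given holomorphically on the strip of
half-width `εA`: there are a strip and a sequence of analytic `PSL(2,ℝ)`-valued maps `B n`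
on it conjugating `A` uniformly to a constant. -/
def AlmostReducible (α εA : ℝ) (A : ℂ → M2) : Prop :=
  ∃ ε : ℝ, 0 < ε ∧ ε ≤ εA ∧ ∃ B : ℕ → ℂ → M2, (∀ n, IsPSL2Strip ε (B n)) ∧
    ∃ A₀ : M2, ∀ δ : ℝ, 0 < δ → ∃ N : ℕ, ∀ n : ℕ, N ≤ n → ∀ z ∈ Strip ε,
      ‖B n (z + (α : ℂ)) * A z * (B n z)⁻¹ - A₀‖ ≤ δ

/-! ### Entrywise sup norm on `2 × 2` matrices -/

lemma M2.norm_le {X : M2} {r : ℝ} (hr : 0 ≤ r) (h : ∀ i j, ‖X i j‖ ≤ r) : ‖X‖ ≤ r :=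
  (Matrix.norm_le_iff hr).2 h

lemma M2.entry_le (X : M2) (i j : Fin 2) : ‖X i j‖ ≤ ‖X‖ :=
  Matrix.norm_entry_le_entrywise_sup_norm X

lemma M2.norm_one : ‖(1 : M2)‖ = 1 := by
  apply le_antisymm
  · refine M2.norm_le zero_le_one fun i j => ?_
    fin_cases i <;> fin_cases j <;> simp
  · have h := M2.entry_le 1 0 0
    rwa [Matrix.one_apply_eq, NormOneClass.norm_one] at h

lemma M2.norm_mul (X Y : M2) : ‖X * Y‖ ≤ 2 * ‖X‖ * ‖Y‖ := by
  refine M2.norm_le (by positivity) fun i j => ?_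
  rw [Matrix.mul_apply, Fin.sum_univ_two]
  refine (norm_add_le _ _).trans ?_
  rw [_root_.norm_mul, _root_.norm_mul]
  have := M2.entry_le X i 0
  have := M2.entry_le X i 1
  have := M2.entry_le Y 0 j
  have := M2.entry_le Y 1 j
  have h1 : ‖X i 0‖ * ‖Y 0 j‖ ≤ ‖X‖ * ‖Y‖ := by gcongr
  have h2 : ‖X i 1‖ * ‖Y 1 j‖ ≤ ‖X‖ * ‖Y‖ := by gcongr
  linarith

lemma M2.norm_mul_of_le {X Y : M2} {x y : ℝ} (hX : ‖X‖ ≤ x) (hY : ‖Y‖ ≤ y) :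
    ‖X * Y‖ ≤ 2 * x * y := by
  have hx : 0 ≤ x := (norm_nonneg _).trans hX
  refine (M2.norm_mul X Y).trans ?_
  gcongr

lemma M2.norm_mul₃_of_le {X Y Z : M2} {x y z : ℝ} (hX : ‖X‖ ≤ x) (hY : ‖Y‖ ≤ y) (hZ : ‖Z‖ ≤ z) :
    ‖X * Y * Z‖ ≤ 4 * x * y * z := by
  refine (M2.norm_mul_of_le (M2.norm_mul_of_le hX hY) hZ).trans (le_of_eq ?_)
  ring

lemma M2.norm_adjugate (X : M2) : ‖X.adjugate‖ = ‖X‖ := by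
  have key : ∀ Y : M2, ‖Y.adjugate‖ ≤ ‖Y‖ := by
    intro Y
    refine M2.norm_le (norm_nonneg _) fun i j => ?_
    rw [Matrix.adjugate_fin_two]
    have := M2.entry_le Y
    fin_cases i <;> fin_cases j <;> simp [this]
  refine le_antisymm (key X) ?_
  have := key X.adjugate
  rw [Matrix.adjugate_adjugate X (by simp)] at this
  simpa using this

lemma M2.inv_eq_adjugate {X : M2} (h : X.det = 1) : X⁻¹ = X.adjugate := by
  rw [Matrix.inv_def, h]; simp

lemma M2.norm_trace_le (X : M2) : ‖X.trace‖ ≤ 2 * ‖X‖ := by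
  rw [Matrix.trace_fin_two]
  refine (norm_add_le _ _).trans ?_
  linarith [M2.entry_le X 0 0, M2.entry_le X 1 1]

lemma M2.norm_det_le (X : M2) : ‖X.det‖ ≤ 2 * ‖X‖ ^ 2 := by
  rw [Matrix.det_fin_two]
  refine (norm_sub_le _ _).trans ?_
  rw [_root_.norm_mul, _root_.norm_mul]
  have h1 : ‖X 0 0‖ * ‖X 1 1‖ ≤ ‖X‖ * ‖X‖ := by gcongr <;> exact M2.entry_le ..
  have h2 : ‖X 0 1‖ * ‖X 1 0‖ ≤ ‖X‖ * ‖X‖ := by gcongr <;> exact M2.entry_le ..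
  linarith

lemma M2.sq_eq {X : M2} (h : X.det = 1) : X * X = X.trace • X - 1 := by
  rw [Matrix.det_fin_two] at h
  ext i j
  fin_cases i <;> fin_cases j <;>
    simp [Matrix.mul_apply, Fin.sum_univ_two, Matrix.trace_fin_two] <;> grind

lemma M2.differentiableOn {X : ℂ → M2} {s : Set ℂ} :
    DifferentiableOn ℂ X s ↔ ∀ i j, DifferentiableOn ℂ (fun z => X z i j) s := by
  refine (differentiableOn_pi (F' := fun _ => Fin 2 → ℂ) (Φ := X)).trans ?_
  exact forall_congr' fun i => differentiableOn_pi

lemma M2.differentiableOn_mul {X Y : ℂ → M2} {s : Set ℂ} (hX : DifferentiableOn ℂ X s)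
    (hY : DifferentiableOn ℂ Y s) : DifferentiableOn ℂ (fun z => X z * Y z) s := by
  rw [M2.differentiableOn] at *
  intro i j
  simp only [Matrix.mul_apply, Fin.sum_univ_two]
  exact ((hX i 0).mul (hY 0 j)).add ((hX i 1).mul (hY 1 j))

lemma M2.differentiableOn_trace {X : ℂ → M2} {s : Set ℂ} (hX : DifferentiableOn ℂ X s) :
    DifferentiableOn ℂ (fun z => (X z).trace) s := by
  rw [M2.differentiableOn] at *
  simp only [Matrix.trace_fin_two]
  exact (hX 0 0).add (hX 1 1)

lemma M2.differentiableOn_det {X : ℂ → M2} {s : Set ℂ} (hX : DifferentiableOn ℂ X s) :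
    DifferentiableOn ℂ (fun z => (X z).det) s := by
  rw [M2.differentiableOn] at *
  simp only [Matrix.det_fin_two]
  exact ((hX 0 0).mul (hX 1 1)).sub ((hX 0 1).mul (hX 1 0))

/-- Matrices with real entries. -/
def M2.IsReal (X : M2) : Prop := ∀ i j, (X i j).im = 0

lemma M2.IsReal.mul {X Y : M2} (hX : X.IsReal) (hY : Y.IsReal) : M2.IsReal (X * Y) := by
  intro i j
  simp [Matrix.mul_apply, Fin.sum_univ_two, hX i 0, hX i 1, hY 0 j, hY 1 j]

lemma M2.IsReal.sub {X Y : M2} (hX : X.IsReal) (hY : Y.IsReal) : M2.IsReal (X - Y) := by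
  intro i j
  simp [hX i j, hY i j]

lemma M2.IsReal.one : M2.IsReal 1 := by
  intro i j
  fin_cases i <;> fin_cases j <;> simp

lemma M2.IsReal.sum {ι : Type*} {s : Finset ι} {X : ι → M2} (h : ∀ i ∈ s, (X i).IsReal) :
    M2.IsReal (∑ i ∈ s, X i) := by
  intro i j
  rw [Matrix.sum_apply, Complex.im_sum]
  exact Finset.sum_eq_zero fun k hk => h k hk i j

lemma M2.IsReal.trace {X : M2} (hX : X.IsReal) : X.trace.im = 0 := by
  simp [Matrix.trace_fin_two, hX 0 0, hX 1 1]

lemma M2.IsReal.det {X : M2} (hX : X.IsReal) : X.det.im = 0 := by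
  simp [Matrix.det_fin_two, hX 0 0, hX 1 1, hX 0 1, hX 1 0]

lemma M2.IsReal.exists_eq {X : M2} (hX : X.IsReal) :
    ∃ a b c d : ℝ, X = !![(a : ℂ), b; c, d] := by
  refine ⟨(X 0 0).re, (X 0 1).re, (X 1 0).re, (X 1 1).re, ?_⟩
  ext i j
  fin_cases i <;> fin_cases j <;> apply Complex.ext <;> simp [hX _ _]

/-! ### Products of matrix sequences -/

/-- `matProd a k = a (k-1) ⋯ a 0`. -/
def matProd (a : ℕ → M2) : ℕ → M2
  | 0 => 1
  | k + 1 => a k * matProd a k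

lemma matProd_add (a : ℕ → M2) (m n : ℕ) :
    matProd a (n + m) = matProd (fun i => a (n + i)) m * matProd a n := by
  induction m with
  | zero => simp [matProd]
  | succ m ih => rw [← add_assoc, matProd, ih, matProd, Matrix.mul_assoc]

lemma matProd_sub (a b : ℕ → M2) (k : ℕ) :
    matProd b k - matProd a k = ∑ j ∈ Finset.range k,
      matProd (fun i => a (j + 1 + i)) (k - 1 - j) * (b j - a j) * matProd b j := by
  induction k with
  | zero => simp [matProd]
  | succ k ih =>
    have h : ∀ j ∈ Finset.range k,
        matProd (fun i => a (j + 1 + i)) (k + 1 - 1 - j) * (b j - a j) * matProd b j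
        = a k * (matProd (fun i => a (j + 1 + i)) (k - 1 - j) * (b j - a j) * matProd b j) := by
      intro j hj
      have hj' := Finset.mem_range.1 hj
      have : k + 1 - 1 - j = (k - 1 - j) + 1 := by omega
      rw [this, matProd]
      have : j + 1 + (k - 1 - j) = k := by omega
      rw [this]
      simp only [Matrix.mul_assoc]
    rw [Finset.sum_range_succ, Finset.sum_congr rfl h, ← Finset.mul_sum, ← ih]
    simp only [matProd, Nat.add_sub_cancel, Nat.sub_self]
    noncomm_ring

/-- Stability of products with bounded subproducts. -/
lemma norm_matProd_le_of_close {a b : ℕ → M2} {n : ℕ} {K η : ℝ} (hη : 0 ≤ η)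
    (hK : ∀ j k, j + k ≤ n → ‖matProd (fun i => a (j + i)) k‖ ≤ K)
    (hab : ∀ j < n, ‖b j - a j‖ ≤ η) (hs : 8 * K * η * n ≤ 1) :
    ∀ k ≤ n, ‖matProd b k‖ ≤ 2 * K := by
  have hK0 : 0 ≤ K := (norm_nonneg _).trans (hK 0 0 (by omega))
  intro k
  induction k using Nat.strong_induction_on with
  | _ k ih =>
    intro hk
    have h1 : ‖matProd b k - matProd a k‖ ≤ k * (4 * K * η * (2 * K)) := by
      rw [matProd_sub]
      refine (norm_sum_le_of_le (f := _) _ (fun j hj => ?_)).trans (by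
        rw [Finset.sum_const, Finset.card_range, nsmul_eq_mul])
      have hj' := Finset.mem_range.1 hj
      exact M2.norm_mul₃_of_le (hK _ _ (by omega)) (hab j (by omega)) (ih j hj' (by omega))
    have h2 : ‖matProd a k‖ ≤ K := by simpa using hK 0 k (by omega)
    have h3 : ‖matProd b k‖ ≤ ‖matProd b k - matProd a k‖ + ‖matProd a k‖ := by
      simpa using norm_add_le (matProd b k - matProd a k) (matProd a k)
    have h4 : (k : ℝ) * (4 * K * η * (2 * K)) ≤ n * (4 * K * η * (2 * K)) := by gcongr
    nlinarith

lemma norm_matProd_sub_le_of_close {a b : ℕ → M2} {n : ℕ} {K η : ℝ} (hη : 0 ≤ η)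
    (hK : ∀ j k, j + k ≤ n → ‖matProd (fun i => a (j + i)) k‖ ≤ K)
    (hab : ∀ j < n, ‖b j - a j‖ ≤ η) (hs : 8 * K * η * n ≤ 1) :
    ∀ k ≤ n, ‖matProd b k - matProd a k‖ ≤ 8 * K ^ 2 * η * n := by
  have hK0 : 0 ≤ K := (norm_nonneg _).trans (hK 0 0 (by omega))
  intro k hk
  have h1 : ‖matProd b k - matProd a k‖ ≤ k * (4 * K * η * (2 * K)) := by
    rw [matProd_sub]
    refine (norm_sum_le_of_le (f := _) _ (fun j hj => ?_)).trans (by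
      rw [Finset.sum_const, Finset.card_range, nsmul_eq_mul])
    have hj' := Finset.mem_range.1 hj
    exact M2.norm_mul₃_of_le (hK _ _ (by omega)) (hab j (by omega))
      (norm_matProd_le_of_close hη hK hab hs j (by omega))
  refine h1.trans ?_
  have h4 : (k : ℝ) * (4 * K * η * (2 * K)) ≤ n * (4 * K * η * (2 * K)) := by gcongr
  linarith

/-- First order expansion of products with bounded subproducts. -/
lemma norm_matProd_sub_first_order_le {a b : ℕ → M2} {n : ℕ} {K η : ℝ} (hη : 0 ≤ η)
    (hK : ∀ j k, j + k ≤ n → ‖matProd (fun i => a (j + i)) k‖ ≤ K)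
    (hab : ∀ j < n, ‖b j - a j‖ ≤ η) (hs : 8 * K * η * n ≤ 1) :
    ‖matProd b n - matProd a n - ∑ j ∈ Finset.range n,
      matProd (fun i => a (j + 1 + i)) (n - 1 - j) * (b j - a j) * matProd a j‖
      ≤ 32 * K ^ 3 * η ^ 2 * n ^ 2 := by
  have hK0 : 0 ≤ K := (norm_nonneg _).trans (hK 0 0 (by omega))
  rw [matProd_sub, ← Finset.sum_sub_distrib]
  simp only [← Matrix.mul_sub]
  refine (norm_sum_le_of_le (f := _) (n := fun _ => 4 * K * η * (8 * K ^ 2 * η * n)) _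
    (fun j hj => ?_)).trans (by
      rw [Finset.sum_const, Finset.card_range, nsmul_eq_mul]
      exact le_of_eq (by ring))
  have hj' := Finset.mem_range.1 hj
  exact M2.norm_mul₃_of_le (hK _ _ (by omega)) (hab j (by omega))
    (norm_matProd_sub_le_of_close hη hK hab hs j (by omega))

/-! ### Iterates of cocycles -/

lemma cocycleIter_eq_matProd (α : ℝ) (A : ℂ → M2) (k : ℕ) (z : ℂ) :
    cocycleIter α A k z = matProd (fun j => A (z + (j : ℂ) * α)) k := by
  induction k with
  | zero => rfl
  | succ k ih => simp only [cocycleIter, matProd, ih]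

lemma cocycleIter_add (α : ℝ) (A : ℂ → M2) (m n : ℕ) (z : ℂ) :
    cocycleIter α A (n + m) z = cocycleIter α A m (z + (n : ℂ) * α) * cocycleIter α A n z := by
  simp only [cocycleIter_eq_matProd]
  rw [matProd_add]
  congr 2
  ext j : 1
  push_cast
  ring_nf

lemma matProd_shift_eq_cocycleIter (α : ℝ) (A : ℂ → M2) (j k : ℕ) (z : ℂ) :
    matProd (fun i => A (z + ((j + i : ℕ) : ℂ) * α)) k = cocycleIter α A k (z + (j : ℂ) * α) := by
  rw [cocycleIter_eq_matProd]
  congr 1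
  ext i : 1
  push_cast
  ring_nf

lemma mem_strip_add_real {ε : ℝ} {z : ℂ} (hz : z ∈ Strip ε) (x : ℝ) : z + x ∈ Strip ε := by
  simpa [Strip] using hz

lemma mem_strip_add_mul_real {ε : ℝ} {z : ℂ} (hz : z ∈ Strip ε) (n : ℕ) (x : ℝ) :
    z + (n : ℂ) * x ∈ Strip ε := by
  simpa [Strip] using hz

lemma mem_strip_sub_mul_real {ε : ℝ} {z : ℂ} (hz : z ∈ Strip ε) (n : ℕ) (x : ℝ) :
    z - (n : ℂ) * x ∈ Strip ε := by
  simpa [Strip] using hz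

lemma real_mem_strip {ε : ℝ} (hε : 0 < ε) (x : ℝ) : (x : ℂ) ∈ Strip ε := by
  simpa [Strip] using hε

lemma strip_mono {ε ε' : ℝ} (h : ε ≤ ε') : Strip ε ⊆ Strip ε' := fun _ hz => lt_of_lt_of_le hz h

lemma isOpen_strip (ε : ℝ) : IsOpen (Strip ε) :=
  isOpen_lt (by fun_prop) continuous_const

lemma convex_strip (ε : ℝ) : Convex ℝ (Strip ε) := by
  have h : Strip ε = Complex.imLm ⁻¹' Set.Ioo (-ε) ε := by
    ext z; simp [Strip, abs_lt]
  rw [h]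
  exact (convex_Ioo _ _).linear_preimage _

lemma IsSL2Strip.mono {ε ε' : ℝ} {A : ℂ → M2} (h : IsSL2Strip ε A) (hε : ε' ≤ ε) :
    IsSL2Strip ε' A :=
  ⟨h.1.mono (strip_mono hε), h.2.1, h.2.2.1, fun z hz => h.2.2.2 z (strip_mono hε hz)⟩

lemma IsSL2Strip.one (ε : ℝ) : IsSL2Strip ε (fun _ => 1) :=
  ⟨differentiableOn_const _, fun _ => rfl, fun _ => M2.IsReal.one, fun _ _ => by simp⟩

lemma IsSL2Strip.mul {ε : ℝ} {A B : ℂ → M2} (hA : IsSL2Strip ε A) (hB : IsSL2Strip ε B) :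
    IsSL2Strip ε (fun z => A z * B z) :=
  ⟨M2.differentiableOn_mul hA.1 hB.1, fun z => by simp only [hA.2.1, hB.2.1],
    fun x => M2.IsReal.mul (hA.2.2.1 x) (hB.2.2.1 x),
    fun z hz => by rw [Matrix.det_mul, hA.2.2.2 z hz, hB.2.2.2 z hz, one_mul]⟩

lemma IsSL2Strip.shift {ε : ℝ} {A : ℂ → M2} (hA : IsSL2Strip ε A) (x : ℝ) :
    IsSL2Strip ε (fun z => A (z + x)) := by
  refine ⟨hA.1.comp (by fun_prop) fun z hz => mem_strip_add_real hz x, fun z => ?_, fun y => ?_,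
    fun z hz => hA.2.2.2 _ (mem_strip_add_real hz x)⟩
  · simp only [← hA.2.1 (z + x)]; ring_nf
  · simpa using hA.2.2.1 (y + x)

lemma IsSL2Strip.cocycleIter {ε : ℝ} {A : ℂ → M2} (hA : IsSL2Strip ε A) (α : ℝ) (k : ℕ) :
    IsSL2Strip ε (cocycleIter α A k) := by
  induction k with
  | zero => exact IsSL2Strip.one ε
  | succ k ih =>
    have := (hA.shift (k * α)).mul ih
    simpa [_root_.cocycleIter] using this

lemma periodic_int {X : Type*} {f : ℂ → X} (h : ∀ z, f (z + 1) = f z) (n : ℤ) (z : ℂ) :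
    f (z + n) = f z := by
  have : Function.Periodic f 1 := h
  simpa using this.int_mul n z

/-! ### Holomorphic functions on strips -/

lemma closedBall_subset_strip {H R : ℝ} {z : ℂ} (hz : |z.im| + R < H) :
    Metric.closedBall z R ⊆ Strip H := by
  intro w hw
  rw [Metric.mem_closedBall, Complex.dist_eq] at hw
  have h1 : |w.im - z.im| ≤ R := by
    have := Complex.abs_im_le_norm (w - z)
    rw [Complex.sub_im] at this
    exact this.trans hw
  have h2 : |w.im| ≤ |w.im - z.im| + |z.im| := by
    simpa using abs_add_le (w.im - z.im) z.im
  show |w.im| < H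
  linarith

lemma norm_deriv_le_of_strip {H R M : ℝ} {f : ℂ → ℂ} (hf : DifferentiableOn ℂ f (Strip H))
    (hM : ∀ z ∈ Strip H, ‖f z‖ ≤ M) (hR : 0 < R) {z : ℂ} (hz : |z.im| + R < H) (n : ℕ) :
    ‖iteratedDeriv n f z‖ ≤ n.factorial * M / R ^ n := by
  have hsub := closedBall_subset_strip hz
  refine Complex.norm_iteratedDeriv_le_of_forall_mem_sphere_norm_le n hR ?_
    fun w hw => hM w (hsub (Metric.sphere_subset_closedBall hw))
  refine DifferentiableOn.diffContOnCl ?_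
  rw [closure_ball _ hR.ne']
  exact hf.mono hsub

/-- Lipschitz bound on a smaller strip. -/
lemma norm_sub_le_of_strip {H H' M : ℝ} {f : ℂ → ℂ} (hf : DifferentiableOn ℂ f (Strip H))
    (hM : ∀ z ∈ Strip H, ‖f z‖ ≤ M) (hH : H' < H) {z w : ℂ} (hz : z ∈ Strip H')
    (hw : w ∈ Strip H') : ‖f z - f w‖ ≤ 2 * M / (H - H') * ‖z - w‖ := by
  have hd : ∀ x ∈ Strip H', ‖deriv f x‖ ≤ 2 * M / (H - H') := by
    intro x hx
    have hx' : |x.im| < H' := hx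
    have := norm_deriv_le_of_strip hf hM (R := (H - H') / 2) (by linarith) (z := x)
      (by linarith) 1
    simp only [iteratedDeriv_one, Nat.factorial_one, Nat.cast_one, one_mul, pow_one] at this
    refine this.trans (le_of_eq ?_)
    field_simp
  exact (convex_strip H').norm_image_sub_le_of_norm_deriv_le
    (fun x hx => hf.differentiableAt ((isOpen_strip H).mem_nhds (strip_mono hH.le hx))) hd hw hz

lemma norm_le_of_periodic_deriv {ω b : ℝ} (hω : 0 < ω) {G F : ℝ → ℂ}
    (hF : ∀ t, HasDerivAt F (G t) t) (hper : F ω = F 0) {G' : ℝ → ℂ}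
    (hG : ∀ t, HasDerivAt G (G' t) t) (hb : ∀ t, ‖G' t‖ ≤ b) : ‖G 0‖ ≤ ω * b := by
  have hlip : ∀ t ∈ Set.Icc 0 ω, ‖G t - G 0‖ ≤ b * (t - 0) :=
    norm_image_sub_le_of_norm_deriv_le_segment' (fun t _ => (hG t).hasDerivWithinAt)
      fun t _ => hb t
  have hb0 : 0 ≤ b := (norm_nonneg _).trans (hb 0)
  have h1 : ∀ t ∈ Set.Icc 0 ω, ‖(F t - t * G 0) - (F 0 - (0 : ℝ) * G 0)‖ ≤ (ω * b) * (t - 0) := by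
    refine norm_image_sub_le_of_norm_deriv_le_segment' (f' := fun t => G t - G 0)
      (f := fun t : ℝ => F t - t * G 0) (fun t _ => ?_) fun t ht => ?_
    · have := (hF t).fun_sub ((Complex.ofRealCLM.hasDerivAt (x := t)).mul_const (G 0))
      simpa using this.hasDerivWithinAt
    · have ht' := hlip t ⟨ht.1, ht.2.le⟩
      refine ht'.trans ?_
      have := ht.2.le
      nlinarith
  have h2 := h1 ω ⟨hω.le, le_rfl⟩
  rw [hper] at h2
  simp only [Complex.ofReal_zero, zero_mul, sub_zero, sub_sub_cancel_left, norm_neg,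
    Complex.norm_mul, Complex.norm_real, Real.norm_eq_abs, abs_of_pos hω] at h2
  have : ω * ‖G 0‖ ≤ ω * (ω * b) := by linarith
  exact le_of_mul_le_mul_left this hω

lemma iteratedDeriv_hasDerivAt_of_strip {H : ℝ} {f : ℂ → ℂ} (hf : DifferentiableOn ℂ f (Strip H))
    {z : ℂ} (hz : z ∈ Strip H) (n : ℕ) :
    HasDerivAt (iteratedDeriv n f) (iteratedDeriv (n + 1) f z) z := by
  have han : AnalyticAt ℂ f z := hf.analyticAt ((isOpen_strip H).mem_nhds hz)
  have h2 : AnalyticAt ℂ (iteratedDeriv n f) z := by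
    rw [iteratedDeriv_eq_iterate]
    exact han.iterated_deriv n
  rw [iteratedDeriv_succ]
  exact h2.differentiableAt.hasDerivAt

lemma iteratedDeriv_periodic {ω : ℂ} {f : ℂ → ℂ} (hper : ∀ z, f (z + ω) = f z) (n : ℕ) (z : ℂ) :
    iteratedDeriv n f (z + ω) = iteratedDeriv n f z := by
  have := iteratedDeriv_comp_add_const n f ω
  rw [← congrFun this z]
  simp only [hper]

/-- Rapidly periodic holomorphic functions are nearly constant. -/
lemma norm_deriv_le_of_rapid_period {q : ℕ} {H M : ℝ} (hH : 0 < H) (hqH : 9 ≤ H * q)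
    {f : ℂ → ℂ} (hf : DifferentiableOn ℂ f (Strip H)) (hper : ∀ z, f (z + 1 / q) = f z)
    (hM : ∀ z ∈ Strip H, ‖f z‖ ≤ M) {z : ℂ} (hz : z ∈ Strip (H / 2)) :
    ‖deriv f z‖ ≤ 3 * q * M * Real.exp (-(H * q / 9)) := by
  have hq : 0 < (q : ℝ) := by
    rcases Nat.eq_zero_or_pos q with rfl | h
    · norm_num at hqH
    · exact_mod_cast h
  have hM0 : 0 ≤ M := (norm_nonneg _).trans (hM z (strip_mono (by linarith) hz))
  set R := H / 3 with hR
  have hR0 : 0 < R := by positivity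
  have hderiv : ∀ n : ℕ, ∀ m : ℕ, ∀ x ∈ Strip (H / 2), ‖iteratedDeriv (m + 1) f x‖ ≤
      (1 / q : ℝ) ^ n * ((m + 1 + n).factorial * M / R ^ (m + 1 + n)) := by
    intro n
    induction n with
    | zero =>
      intro m x hx
      have hx' : |x.im| < H / 2 := hx
      simpa using norm_deriv_le_of_strip hf hM hR0 (z := x) (by linarith) (m + 1)
    | succ n ih =>
      intro m x hx
      have hxH : ∀ t : ℝ, x + t ∈ Strip H := fun t =>
        strip_mono (by linarith) (mem_strip_add_real hx t)
      have hline : ∀ k : ℕ, ∀ t : ℝ, HasDerivAt (fun t : ℝ => iteratedDeriv k f (x + t))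
          (iteratedDeriv (k + 1) f (x + t)) t := by
        intro k t
        have h1 := iteratedDeriv_hasDerivAt_of_strip hf (hxH t) k
        have h2 : HasDerivAt (fun t : ℝ => x + (t : ℂ)) 1 t := by
          simpa using (Complex.ofRealCLM.hasDerivAt (x := t)).const_add x
        simpa [Function.comp_def] using h1.comp t h2
      have := norm_le_of_periodic_deriv (ω := 1 / q) (by positivity) (hline m) ?_ (hline (m + 1))
        (fun t => ih (m + 1) (x + t) (mem_strip_add_real hx t))
      · refine (by simpa using this : ‖iteratedDeriv (m + 1) f x‖ ≤ _).trans (le_of_eq ?_)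
        rw [show m + 1 + 1 + n = m + 1 + (n + 1) by ring, pow_succ]
        ring
      · simpa using iteratedDeriv_periodic hper m x
  have hfl : (3 : ℝ) ≤ R * q := by rw [hR]; linarith
  set m := ⌊R * q / 3⌋₊ with hm
  have hm1 : 1 ≤ m := Nat.one_le_floor_iff _ |>.2 (by linarith)
  have hmle : (m : ℝ) ≤ R * q / 3 := Nat.floor_le (by positivity)
  have hmlt : R * q / 3 < m + 1 := Nat.lt_floor_add_one _
  have h := hderiv (m - 1) 0 z hz
  rw [show 0 + 1 + (m - 1) = m by omega, zero_add, iteratedDeriv_one] at h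
  refine h.trans ?_
  have hfac : (m.factorial : ℝ) ≤ (m : ℝ) ^ m := by exact_mod_cast Nat.factorial_le_pow m
  have e1 : (1 / q : ℝ) ^ (m - 1) = q * (1 / q : ℝ) ^ m := by
    obtain ⟨k, hk⟩ := Nat.exists_eq_add_of_le hm1
    rw [hk, Nat.add_sub_cancel_left, pow_add]
    field_simp
  rw [e1]
  have e2 : (q : ℝ) * (1 / q : ℝ) ^ m * (m.factorial * M / R ^ m)
      ≤ q * M * (m / (R * q)) ^ m := by
    have : (q : ℝ) * (1 / q : ℝ) ^ m * (m.factorial * M / R ^ m)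
      = q * M * (m.factorial / (R * q) ^ m) := by
        rw [mul_pow, one_div, inv_pow]; field_simp
    rw [this, div_pow]
    gcongr
  refine e2.trans ?_
  have e3 : ((m : ℝ) / (R * q)) ^ m ≤ (1 / 3) ^ m := by
    refine pow_le_pow_left₀ (by positivity) ?_ m
    rw [div_le_iff₀ (by positivity)]
    linarith
  have e4 : (1 / 3 : ℝ) ^ m ≤ Real.exp (-m) := by
    rw [show -(m : ℝ) = m * (-1) by ring, Real.exp_nat_mul]
    gcongr
    rw [Real.exp_neg, one_div]
    gcongr
    exact Real.exp_one_lt_three.le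
  have e5 : Real.exp (-m) ≤ 3 * Real.exp (-(H * q / 9)) := by
    have : Real.exp (-m) ≤ Real.exp (1 + -(H * q / 9)) := by
      gcongr
      have : R * q / 3 = H * q / 9 := by rw [hR]; ring
      linarith
    rw [Real.exp_add] at this
    refine this.trans ?_
    gcongr
    exact Real.exp_one_lt_three.le
  calc q * M * (m / (R * q)) ^ m ≤ q * M * (3 * Real.exp (-(H * q / 9))) := by
        gcongr; exact e3.trans (e4.trans e5)
    _ = _ := by ring

lemma norm_sub_le_of_rapid_period {q : ℕ} {H M : ℝ} (hH : 0 < H) (hqH : 9 ≤ H * q)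
    {f : ℂ → ℂ} (hf : DifferentiableOn ℂ f (Strip H)) (hper : ∀ z, f (z + 1 / q) = f z)
    (hM : ∀ z ∈ Strip H, ‖f z‖ ≤ M) {z w : ℂ} (hz : z ∈ Strip (H / 2))
    (hw : w ∈ Strip (H / 2)) :
    ‖f z - f w‖ ≤ M * (3 * q * (1 + H) * Real.exp (-(H * q / 9))) := by
  have hq : 0 < (q : ℝ) := by
    rcases Nat.eq_zero_or_pos q with rfl | h
    · norm_num at hqH
    · exact_mod_cast h
  have hM0 : 0 ≤ M := (norm_nonneg _).trans (hM z (strip_mono (by linarith) hz))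
  have hper1 : ∀ x, f (x + 1) = f x := by
    have hp : Function.Periodic f (1 / q : ℂ) := hper
    have := hp.nat_mul q
    have e : (q : ℂ) * (1 / q) = 1 := by
      field_simp
      exact div_self (by exact_mod_cast hq.ne')
    rw [e] at this
    exact this
  set k : ℤ := ⌊(z - w).re⌋
  have hk : f (w + k) = f w := periodic_int hper1 k w
  have hwk : w + (k : ℂ) ∈ Strip (H / 2) := by simpa using mem_strip_add_real hw (k : ℝ)
  have h1 := (convex_strip (H / 2)).norm_image_sub_le_of_norm_deriv_le (f := f)
    (fun x hx => hf.differentiableAt ((isOpen_strip H).mem_nhds (strip_mono (by linarith) hx)))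
    (fun x hx => norm_deriv_le_of_rapid_period hH hqH hf hper hM hx) hwk hz
  rw [hk] at h1
  have h2 : ‖z - (w + k)‖ ≤ 1 + H := by
    refine (Complex.norm_le_abs_re_add_abs_im _).trans ?_
    have hz' : |z.im| < H / 2 := hz
    have hw' : |w.im| < H / 2 := hw
    gcongr
    · have e : (z - (w + k)).re = Int.fract ((z - w).re) := by
        rw [← Int.self_sub_floor]
        simp only [k, Complex.sub_re, Complex.add_re, Complex.intCast_re]
        ring
      rw [e, abs_of_nonneg (Int.fract_nonneg _)]
      exact (Int.fract_lt_one _).le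
    · have e : (z - (w + k)).im = z.im - w.im := by simp
      rw [e]
      exact (abs_sub _ _).trans (by linarith)
  calc _ ≤ _ := h1
    _ ≤ 3 * q * M * Real.exp (-(H * q / 9)) * (1 + H) := by gcongr
    _ = _ := by ring

/-- Three lines theorem for a function that is small on the real line. -/
lemma norm_le_of_three_lines {E : Type*} [NormedAddCommGroup E] [NormedSpace ℂ E] {H a b : ℝ}
    (hH : 0 < H) {f : ℂ → E} (hf : DifferentiableOn ℂ f (Strip H)) (ha : ∀ x : ℝ, ‖f x‖ ≤ a)
    (hb : ∀ z ∈ Strip H, ‖f z‖ ≤ b) {z : ℂ} (hz : z ∈ Strip (H / 2)) :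
    ‖f z‖ ≤ a ^ (1 - |z.im| / (H / 2)) * b ^ (|z.im| / (H / 2)) := by
  obtain ⟨σ, hσ, hσz⟩ : ∃ σ : ℝ, |σ| = 1 ∧ |z.im| = σ * z.im := by
    rcases le_total 0 z.im with h | h
    · exact ⟨1, by simp, by rw [abs_of_nonneg h, one_mul]⟩
    · exact ⟨-1, by simp, by rw [abs_of_nonpos h]; ring⟩
  have hσ2 : σ * σ = 1 := by rw [← abs_mul_abs_self, hσ, one_mul]
  have him : ∀ w : ℂ, ((σ * (H / 2) : ℝ) * Complex.I * w).im = σ * (H / 2) * w.re := by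
    intro w; simp
  have hmem : ∀ w : ℂ, |w.re| ≤ 1 → (σ * (H / 2) : ℝ) * Complex.I * w ∈ Strip H := by
    intro w hw
    show |_| < H
    rw [him, abs_mul, abs_mul, hσ, abs_of_pos (by positivity : 0 < H / 2)]
    nlinarith
  have hd : DifferentiableOn ℂ (fun w => f ((σ * (H / 2) : ℝ) * Complex.I * w))
      (Complex.HadamardThreeLines.verticalClosedStrip 0 1) := by
    refine hf.comp (by fun_prop) fun w hw => hmem w ?_
    rw [abs_of_nonneg hw.1]
    exact hw.2
  have hz' : |z.im| < H / 2 := hz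
  have hre : (-((σ / (H / 2) : ℝ) : ℂ) * Complex.I * z).re = |z.im| / (H / 2) := by
    have : ∀ s : ℝ, (-(s : ℂ) * Complex.I * z).re = s * z.im := by intro s; simp
    rw [hσz, this]; ring
  have key := Complex.HadamardThreeLines.norm_le_interp_of_mem_verticalClosedStrip₀₁'
    (fun w => f ((σ * (H / 2) : ℝ) * Complex.I * w))
    (z := -(σ / (H / 2) : ℝ) * Complex.I * z) (a := a) (b := b) ?_ ?_ ?_ ?_ ?_
  · have e2 : ((σ * (H / 2) : ℝ) : ℂ) * Complex.I * (-((σ / (H / 2) : ℝ) : ℂ) * Complex.I * z)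
        = z := by
      have h1 : (σ : ℂ) * σ = 1 := by exact_mod_cast hσ2
      have h2 : (H : ℂ) ≠ 0 := by exact_mod_cast hH.ne'
      push_cast
      field_simp
      linear_combination (-(σ : ℂ) ^ 2 * z) * Complex.I_sq + z * h1
    simpa only [hre, e2] using key
  · refine ⟨?_, ?_⟩
    · rw [hre]; positivity
    · rw [hre, div_le_one (by positivity)]; exact hz'.le
  · refine DifferentiableOn.diffContOnCl (hd.mono ?_)
    rw [Complex.HadamardThreeLines.verticalClosedStrip, ← closure_Ioo zero_ne_one,
      ← Complex.closure_preimage_re]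
    rfl
  · refine ⟨b, ?_⟩
    rintro _ ⟨w, hw, rfl⟩
    refine hb _ (hmem w ?_)
    rw [abs_of_nonneg hw.1]
    exact hw.2
  · intro w hw
    have hw' : w.re = 0 := hw
    have : ((σ * (H / 2) : ℝ) : ℂ) * Complex.I * w = ((-(σ * (H / 2) * w.im) : ℝ) : ℂ) := by
      apply Complex.ext <;> simp [hw']
    simp only [this]
    exact ha _
  · intro w hw
    have hw' : w.re = 1 := hw
    exact hb _ (hmem w (by rw [hw']; simp))

/-! ### Rational approximation of exponentially Liouville numbers -/

lemma exists_int_contsAux (v : ℝ) (n : ℕ) :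
    ∃ a b : ℤ, (GenContFract.of v).contsAux n = ⟨(a : ℝ), (b : ℝ)⟩ := by
  induction n using Nat.strong_induction_on with
  | _ n ih =>
    match n with
    | 0 => exact ⟨1, 0, by simp [GenContFract.contsAux]⟩
    | 1 => exact ⟨⌊v⌋, 1, by simp [GenContFract.contsAux, GenContFract.of_h_eq_floor]⟩
    | n + 2 =>
      obtain ⟨a, b, hab⟩ := ih n (by omega)
      obtain ⟨c, d, hcd⟩ := ih (n + 1) (by omega)
      rw [GenContFract.contsAux]
      cases hs : (GenContFract.of v).s.get? n with
      | none => exact ⟨c, d, hcd⟩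
      | some gp =>
        obtain ⟨h1, z, hz⟩ := GenContFract.of_partNum_eq_one_and_exists_int_partDen_eq hs
        refine ⟨z * c + a, z * d + b, ?_⟩
        simp only [GenContFract.nextConts, GenContFract.nextNum, GenContFract.nextDen, hab, hcd,
          h1, hz, one_mul]
        push_cast
        rfl

lemma nat_le_dens {α : ℝ} (hirr : Irrational α) (n : ℕ) :
    (n : ℝ) ≤ (GenContFract.of α).dens n ∧ 1 ≤ (GenContFract.of α).dens n := by
  have hterm : ∀ n, ¬(GenContFract.of α).TerminatedAt n := fun n h => by
    obtain ⟨r, hr⟩ := (GenContFract.terminates_iff_rat α).1 ⟨n, h⟩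
    exact hirr ⟨r, hr.symm⟩
  have h : (Nat.fib (n + 1) : ℝ) ≤ (GenContFract.of α).dens n :=
    GenContFract.succ_nth_fib_le_of_nth_den (Or.inr (hterm _))
  have h1 : n ≤ Nat.fib (n + 1) := by
    have := Nat.le_fib_add_one (n + 1)
    omega
  have h2 : 1 ≤ Nat.fib (n + 1) := Nat.fib_pos.2 (by omega)
  exact ⟨le_trans (by exact_mod_cast h1) h, le_trans (by exact_mod_cast h2) h⟩

lemma exists_rat_near_of_dens {α : ℝ} (hirr : Irrational α) (n : ℕ) :
    ∃ r : ℚ, (r.den : ℝ) ≤ (GenContFract.of α).dens n ∧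
      |α - r| ≤ 1 / (GenContFract.of α).dens (n + 1) := by
  have hterm : ¬(GenContFract.of α).TerminatedAt n := fun h => by
    obtain ⟨r, hr⟩ := (GenContFract.terminates_iff_rat α).1 ⟨n, h⟩
    exact hirr ⟨r, hr.symm⟩
  obtain ⟨a, b, hab⟩ := exists_int_contsAux α (n + 1)
  have hd : (GenContFract.of α).dens n = b := congrArg GenContFract.Pair.b hab
  have hn : (GenContFract.of α).nums n = a := congrArg GenContFract.Pair.a hab
  have hb : 1 ≤ b := by
    have := (nat_le_dens hirr n).2
    rw [hd] at this
    exact_mod_cast this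
  refine ⟨(a : ℚ) / b, ?_, ?_⟩
  · rw [hd]
    have h1 := Rat.den_dvd a b
    rw [Rat.divInt_eq_div] at h1
    exact_mod_cast Int.le_of_dvd (by omega) h1
  · have h1 := GenContFract.abs_sub_convs_le hterm
    rw [GenContFract.conv_eq_num_div_den, hn] at h1
    have h2 := (nat_le_dens hirr n).2
    have h3 := (nat_le_dens hirr (n + 1)).2
    push_cast
    rw [← hd]
    refine h1.trans ?_
    gcongr
    nlinarith

lemma ExpLiouville.exists_frequently {α : ℝ} (hirr : Irrational α) (h : ExpLiouville α) :
    ∃ β : ℝ, 0 < β ∧ ∃ᶠ n in atTop,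
      ∃ r : ℚ, (r.den : ℝ) ≤ (GenContFract.of α).dens n ∧
        |α - r| ≤ Real.exp (-(β * (GenContFract.of α).dens n)) := by
  obtain ⟨β, hβ0, hβ⟩ := exists_between h
  refine ⟨β, hβ0, (frequently_lt_of_lt_limsup ?_ hβ).mono fun n hn => ?_⟩
  · refine IsBoundedUnder.isCoboundedUnder_le (isBoundedUnder_of ⟨0, fun n => ?_⟩)
    exact div_nonneg (Real.log_nonneg (nat_le_dens hirr _).2)
      (zero_le_one.trans (nat_le_dens hirr n).2)
  · obtain ⟨r, hr1, hr2⟩ := exists_rat_near_of_dens hirr n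
    refine ⟨r, hr1, hr2.trans ?_⟩
    have h1 := (nat_le_dens hirr n).2
    have h2 := (nat_le_dens hirr (n + 1)).2
    rw [lt_div_iff₀ (by linarith)] at hn
    rw [Real.exp_neg, one_div]
    gcongr
    exact ((Real.lt_log_iff_exp_lt (by linarith)).1 hn).le

lemma exists_forall_le_abs_sub_rat {α : ℝ} (hirr : Irrational α) (N : ℕ) :
    ∃ d : ℝ, 0 < d ∧ ∀ r : ℚ, r.den < N → d ≤ |α - r| := by
  have hN : (0 : ℝ) < N.factorial := by exact_mod_cast N.factorial_pos
  have hirr' : Irrational (N.factorial * α) := hirr.natCast_mul N.factorial_ne_zero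
  refine ⟨|N.factorial * α - round (N.factorial * α)| / N.factorial, ?_, fun r hr => ?_⟩
  · have : N.factorial * α - round (N.factorial * α) ≠ 0 :=
      sub_ne_zero.2 (hirr'.ne_int _)
    positivity
  · rw [div_le_iff₀ hN]
    obtain ⟨k, hk⟩ : r.den ∣ N.factorial := Nat.dvd_factorial r.den_pos hr.le
    have h1 := round_le (N.factorial * α) (k * r.num)
    refine h1.trans (le_of_eq ?_)
    have hr' : (r : ℝ) * r.den = r.num := by exact_mod_cast Rat.mul_den_eq_num r
    have h2 : (N.factorial : ℝ) = r.den * k := by exact_mod_cast hk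
    rw [← abs_of_pos hN, ← abs_mul, abs_of_pos hN]
    congr 1
    push_cast
    rw [← hr', sub_mul, h2]
    ring

/-- Exponentially Liouville numbers have exponentially good approximations by reduced fractions. -/
lemma ExpLiouville.exists_approx {α : ℝ} (hirr : Irrational α) (h : ExpLiouville α) :
    ∃ β : ℝ, 0 < β ∧ ∀ N : ℕ, ∃ (p : ℤ) (q : ℕ), N ≤ q ∧ 0 < q ∧ IsCoprime p q ∧
      |α - p / q| ≤ Real.exp (-(β * q)) := by
  obtain ⟨β, hβ, hfreq⟩ := h.exists_frequently hirr
  refine ⟨β, hβ, fun N => ?_⟩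
  obtain ⟨d, hd, hdr⟩ := exists_forall_le_abs_sub_rat hirr N
  have hlim : Tendsto (fun n : ℕ => Real.exp (-(β * n))) atTop (nhds 0) :=
    Real.tendsto_exp_neg_atTop_nhds_zero.comp
      (tendsto_natCast_atTop_atTop.const_mul_atTop hβ)
  obtain ⟨n, ⟨r, hr1, hr2⟩, hn⟩ := (hfreq.and_eventually (hlim.eventually_lt_const hd)).exists
  refine ⟨r.num, r.den, ?_, r.den_pos, Rat.isCoprime_num_den r, ?_⟩
  · by_contra! hlt
    refine absurd (hdr r hlt) (not_le.2 (hr2.trans_lt (lt_of_le_of_lt ?_ hn)))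
    gcongr
    exact (nat_le_dens hirr n).1
  · rw [← Rat.cast_def]
    refine hr2.trans ?_
    gcongr

/-! ### Subexponential growth forces almost elliptic traces -/

/-- Slowly varying products of uniformly hyperbolic matrices grow exponentially. -/
lemma pow_le_norm_matProd {M : ℕ → M2} {g : ℝ} (hg : 0 ≤ g) (hdet : ∀ n, (M n).det = 1)
    (htr : ∀ n, 2 + 2 * g ≤ ‖(M n).trace‖) (hM : ∀ n, 2 * ‖M (n + 1) - M n‖ ≤ g) (n : ℕ) :
    (1 + g) ^ n ≤ ‖matProd M (n + 1)‖ := by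
  have hrec : ∀ n, (2 + g) * ‖matProd M (n + 1)‖ ≤ ‖matProd M (n + 2)‖ + ‖matProd M n‖ := by
    intro n
    have h1 : (M n).trace • matProd M (n + 1)
        = matProd M (n + 2) + matProd M n - (M (n + 1) - M n) * matProd M (n + 1) := by
      have h2 : M n * matProd M (n + 1) = (M n).trace • matProd M (n + 1) - matProd M n := by
        rw [matProd, ← Matrix.mul_assoc, M2.sq_eq (hdet n), Matrix.sub_mul, Matrix.smul_mul,
          Matrix.one_mul]
      rw [Matrix.sub_mul, h2, show matProd M (n + 2) = M (n + 1) * matProd M (n + 1) from rfl]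
      abel
    have h3 : ‖(M n).trace‖ * ‖matProd M (n + 1)‖
        ≤ ‖matProd M (n + 2)‖ + ‖matProd M n‖ + g * ‖matProd M (n + 1)‖ := by
      rw [← norm_smul, h1]
      refine (norm_sub_le _ _).trans (add_le_add (norm_add_le _ _) ?_)
      refine (M2.norm_mul _ _).trans ?_
      gcongr
      exact hM n
    nlinarith [htr n, norm_nonneg (matProd M (n + 1))]
  have hmono : ∀ n, ‖matProd M n‖ ≤ ‖matProd M (n + 1)‖ := by
    intro n
    induction n with
    | zero =>
      have h1 : ‖(M 0).trace‖ ≤ 2 * ‖M 0‖ := M2.norm_trace_le _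
      have h2 : ‖matProd M 0‖ = 1 := M2.norm_one
      have h3 : matProd M (0 + 1) = M 0 := by simp [matProd]
      rw [h2, h3]
      linarith [htr 0]
    | succ n ih => nlinarith [hrec n, norm_nonneg (matProd M (n + 1))]
  induction n with
  | zero =>
    have h2 : ‖matProd M 0‖ = 1 := M2.norm_one
    simpa [h2] using hmono 0
  | succ n ih =>
    rw [pow_succ]
    nlinarith [hrec n, hmono n]

lemma matProd_cocycleIter (α : ℝ) (A : ℂ → M2) (q n : ℕ) (z : ℂ) :
    matProd (fun j => cocycleIter α A q (z + ((j * q : ℕ) : ℂ) * α)) n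
      = cocycleIter α A (n * q) z := by
  induction n with
  | zero => simp [matProd, cocycleIter]
  | succ n ih => rw [matProd, ih, Nat.succ_mul, cocycleIter_add]

lemma exists_trace_lt_of_subexponential {α ε g : ℝ} {A : ℂ → M2} {p : ℤ} {q : ℕ} (hq : 0 < q)
    (hε : 0 < ε) (hg : 0 < g) (hA : IsSL2Strip ε A)
    (hsub : ∀ δ : ℝ, 0 < δ → ∃ N : ℕ, ∀ n : ℕ, N ≤ n → ∀ z ∈ Strip ε,
      ‖cocycleIter α A n z‖ ≤ Real.exp (δ * n))
    (hclose : ∀ x : ℝ, 2 * ‖cocycleIter α A q ((x + (q * α - p) : ℝ) : ℂ)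
      - cocycleIter α A q x‖ ≤ g) :
    ∃ x : ℝ, ‖(cocycleIter α A q x).trace‖ < 2 + 2 * g := by
  by_contra! hcon
  have hS := hA.cocycleIter α q
  set M : ℕ → M2 := fun j => cocycleIter α A q (0 + ((j * q : ℕ) : ℂ) * α) with hMdef
  have hMreal : ∀ j, M j = cocycleIter α A q ((j * q * α : ℝ) : ℂ) := by
    intro j; simp [hMdef]
  have hgrow := pow_le_norm_matProd (M := M) hg.le
    (fun n => by rw [hMreal]; exact hS.2.2.2 _ (real_mem_strip hε _))
    (fun n => by rw [hMreal]; exact hcon _) (fun n => by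
      have h1 := hclose (n * q * α)
      have h2 : cocycleIter α A q (((n * q * α + (q * α - p) : ℝ)) : ℂ) = M (n + 1) := by
        rw [hMreal, ← periodic_int hS.2.1 p]
        congr 1
        push_cast
        ring
      rwa [h2, ← hMreal] at h1)
  have hq' : (0 : ℝ) < q := by exact_mod_cast hq
  set δ := Real.log (1 + g) / (2 * q)
  have hlog : 0 < Real.log (1 + g) := Real.log_pos (by linarith)
  obtain ⟨N, hN⟩ := hsub δ (by positivity)
  have h1 := hgrow (N + 2)
  have h2 := hN ((N + 3) * q) (by nlinarith) 0 (by simpa using real_mem_strip hε 0)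
  rw [matProd_cocycleIter] at h1
  have h3 := h1.trans h2
  rw [← Real.exp_log (by linarith : 0 < 1 + g), ← Real.exp_nat_mul, Real.exp_le_exp] at h3
  have h4 : δ * ((N + 3) * q : ℕ) = (N + 3) / 2 * Real.log (1 + g) := by
    simp only [δ]; push_cast; field_simp
  rw [h4] at h3
  push_cast at h3
  have : (N : ℝ) + 2 ≤ (N + 3) / 2 := le_of_mul_le_mul_right h3 hlog
  have : (0 : ℝ) ≤ N := Nat.cast_nonneg N
  linarith

/-! ### Near constancy of functions with a rational period -/

lemma periodic_div_of_coprime {X : Type*} {f : ℂ → X} {p : ℤ} {q : ℕ} (hq : 0 < q)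
    (hpq : IsCoprime p q) (h1 : ∀ z, f (z + 1) = f z)
    (hω : ∀ z, f (z + ((p / q : ℝ) : ℂ)) = f z) (z : ℂ) : f (z + 1 / q) = f z := by
  obtain ⟨u, v, huv⟩ := hpq
  have hP : Function.Periodic f ((p / q : ℝ) : ℂ) := hω
  have h2 := (hP.int_mul u) (z + (v : ℂ))
  rw [periodic_int h1] at h2
  rw [← h2]
  congr 1
  have hq' : (q : ℂ) ≠ 0 := by exact_mod_cast hq.ne'
  have huv' : (u : ℂ) * p + v * q = 1 := by exact_mod_cast huv
  push_cast
  field_simp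
  linear_combination -huv'

lemma norm_sub_le_of_rational_period {p : ℤ} {q : ℕ} (hpq : IsCoprime p q) {H M κ : ℝ}
    (hH : 0 < H) (hqH : 9 ≤ H * q) (hκ : 3 * q * (1 + H) * Real.exp (-(H * q / 9)) ≤ κ)
    {f : ℂ → ℂ} (hf : DifferentiableOn ℂ f (Strip H)) (h1 : ∀ z ∈ Strip H, f (z + 1) = f z)
    (hω : ∀ z ∈ Strip H, f (z + ((p / q : ℝ) : ℂ)) = f z)
    (hM : ∀ z ∈ Strip H, ‖f z‖ ≤ M) {z w : ℂ} (hz : z ∈ Strip (H / 2))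
    (hw : w ∈ Strip (H / 2)) : ‖f z - f w‖ ≤ M * κ := by
  classical
  have hq : 0 < q := Nat.pos_of_ne_zero fun h => by norm_num [h] at hqH
  have hM0 : 0 ≤ M := (norm_nonneg _).trans (hM z (strip_mono (by linarith) hz))
  have hshift : ∀ (x : ℝ) (z : ℂ), z + x ∈ Strip H ↔ z ∈ Strip H := by simp [Strip]
  have hindp : ∀ x : ℝ, (∀ z ∈ Strip H, f (z + x) = f z) →
      ∀ z, (Strip H).indicator f (z + x) = (Strip H).indicator f z := by
    intro x hx z
    simp only [Set.indicator, hshift]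
    split_ifs with h
    exacts [hx z h, rfl]
  have hin : ∀ z ∈ Strip H, (Strip H).indicator f z = f z := fun z hz =>
    Set.indicator_of_mem hz f
  have key := norm_sub_le_of_rapid_period (f := (Strip H).indicator f) hH hqH (hf.congr hin)
    (periodic_div_of_coprime hq hpq (by simpa using hindp 1 (by simpa using h1)) (hindp _ hω))
    (M := M) (fun z hz => by rw [hin z hz]; exact hM z hz) hz hw
  rw [hin z (strip_mono (by linarith) hz), hin w (strip_mono (by linarith) hw)] at key
  refine key.trans ?_
  gcongr

/-! ### Rotations in terms of the multiplier -/

/-- The rotation matrix by `φ` (clockwise) as a function of `μ = exp (i φ)`. -/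
def rotMul (μ : ℂ) : M2 :=
  !![(μ + μ⁻¹) / 2, (μ - μ⁻¹) / (2 * Complex.I); -((μ - μ⁻¹) / (2 * Complex.I)), (μ + μ⁻¹) / 2]

lemma rotMul_one : rotMul 1 = 1 := by
  ext i j
  fin_cases i <;> fin_cases j <;> simp [rotMul]

lemma rotMul_mul {μ ν : ℂ} (hμ : μ ≠ 0) (hν : ν ≠ 0) :
    rotMul (μ * ν) = rotMul μ * rotMul ν := by
  have hI := Complex.I_sq
  ext i j
  fin_cases i <;> fin_cases j <;>
    simp [rotMul, Matrix.mul_apply, Fin.sum_univ_two] <;> field_simp <;>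
    grind

lemma rotMul_det {μ : ℂ} (hμ : μ ≠ 0) : (rotMul μ).det = 1 := by
  rw [rotMul, Matrix.det_fin_two_of]
  have hI := Complex.I_sq
  field_simp
  grind

lemma norm_div_two_I (x : ℂ) : ‖x / (2 * Complex.I)‖ = ‖x‖ / 2 := by
  simp

lemma norm_rotMul_le {μ : ℂ} {r : ℝ} (h1 : ‖μ‖ ≤ r) (h2 : ‖μ⁻¹‖ ≤ r) : ‖rotMul μ‖ ≤ r := by
  have hr : 0 ≤ r := (norm_nonneg _).trans h1
  have hs : ‖(μ + μ⁻¹) / 2‖ ≤ r := by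
    rw [norm_div, Complex.norm_ofNat]
    linarith [norm_add_le μ μ⁻¹]
  have hd : ‖(μ - μ⁻¹) / (2 * Complex.I)‖ ≤ r := by
    rw [norm_div_two_I]
    linarith [norm_sub_le μ μ⁻¹]
  refine M2.norm_le hr fun i j => ?_
  fin_cases i <;> fin_cases j
  · exact hs
  · exact hd
  · simpa [rotMul] using hd
  · exact hs

lemma norm_rotMul_sub_le {μ ν : ℂ} {r : ℝ} (h1 : ‖μ - ν‖ ≤ r) (h2 : ‖μ⁻¹ - ν⁻¹‖ ≤ r) :
    ‖rotMul μ - rotMul ν‖ ≤ r := by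
  have hr : 0 ≤ r := (norm_nonneg _).trans h1
  have hs : ‖(μ + μ⁻¹) / 2 - (ν + ν⁻¹) / 2‖ ≤ r := by
    rw [← sub_div, norm_div, Complex.norm_ofNat, add_sub_add_comm]
    linarith [norm_add_le (μ - ν) (μ⁻¹ - ν⁻¹)]
  have hd : ‖(μ - μ⁻¹) / (2 * Complex.I) - (ν - ν⁻¹) / (2 * Complex.I)‖ ≤ r := by
    rw [← sub_div, norm_div_two_I, sub_sub_sub_comm]
    linarith [norm_sub_le (μ - ν) (μ⁻¹ - ν⁻¹)]
  refine M2.norm_le hr fun i j => ?_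
  fin_cases i <;> fin_cases j
  · exact hs
  · exact hd
  · have e : (rotMul μ - rotMul ν) 1 0
      = -((μ - μ⁻¹) / (2 * Complex.I) - (ν - ν⁻¹) / (2 * Complex.I)) := by
      simp only [rotMul, Matrix.sub_apply, Matrix.of_apply, Matrix.cons_val', Matrix.cons_val_zero,
        Matrix.cons_val_one, Matrix.cons_val_fin_one]
      ring
    show ‖(rotMul μ - rotMul ν) 1 0‖ ≤ r
    rw [e, norm_neg]
    exact hd
  · exact hs

lemma norm_rotMul_sub_le_of_unimodular {μ ν : ℂ} (hμ : ‖μ‖ = 1) (hν : ‖ν‖ = 1) :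
    ‖rotMul μ - rotMul ν‖ ≤ ‖μ - ν‖ := by
  refine norm_rotMul_sub_le le_rfl (le_of_eq ?_)
  rw [Complex.inv_eq_conj hμ, Complex.inv_eq_conj hν, ← map_sub, Complex.norm_conj]

lemma isReal_rotMul {μ : ℂ} (hμ : ‖μ‖ = 1) : (rotMul μ).IsReal := by
  have h1 : ((μ + μ⁻¹) / 2).im = 0 := by
    rw [Complex.inv_eq_conj hμ, Complex.add_conj]
    simp
  have h2 : ((μ - μ⁻¹) / (2 * Complex.I)).im = 0 := by
    rw [Complex.inv_eq_conj hμ, Complex.sub_conj]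
    have : ((2 * μ.im : ℝ) : ℂ) * Complex.I / (2 * Complex.I) = ((μ.im : ℝ) : ℂ) := by
      push_cast
      field_simp
    rw [this, Complex.ofReal_im]
  intro i j
  fin_cases i <;> fin_cases j
  · exact h1
  · exact h2
  · simpa [rotMul] using h2
  · exact h1

lemma differentiableOn_rotMul {μ : ℂ → ℂ} {s : Set ℂ} (h : DifferentiableOn ℂ μ s)
    (h0 : ∀ z ∈ s, μ z ≠ 0) : DifferentiableOn ℂ (fun z => rotMul (μ z)) s := by
  have hinv := h.inv h0
  have h1 : DifferentiableOn ℂ (fun z => (μ z + (μ z)⁻¹) / 2) s := (h.add hinv).div_const 2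
  have h2 : DifferentiableOn ℂ (fun z => (μ z - (μ z)⁻¹) / (2 * Complex.I)) s :=
    (h.sub hinv).div_const _
  rw [M2.differentiableOn]
  intro i j
  fin_cases i <;> fin_cases j
  exacts [h1, h2, h2.neg, h1]

lemma rotMul_sq {μ : ℂ} (hμ : μ ≠ 0) :
    rotMul μ * rotMul μ = (μ + μ⁻¹) • rotMul μ - 1 := by
  have := M2.sq_eq (rotMul_det hμ)
  rw [this]
  congr 2
  rw [rotMul, Matrix.trace_fin_two_of]
  ring

/-! ### Monodromy of a cocycle over a rational rotation -/

lemma cocycleIter_one (α : ℝ) (A : ℂ → M2) (z : ℂ) : cocycleIter α A 1 z = A z := by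
  simp [cocycleIter]

lemma monodromy_conj {p : ℤ} {q : ℕ} (hq : 0 < q) {A : ℂ → M2} (h1 : ∀ z, A (z + 1) = A z)
    (z : ℂ) : cocycleIter (p / q) A q (z + ((p / q : ℝ) : ℂ)) * A z
      = A z * cocycleIter (p / q) A q z := by
  have e1 := cocycleIter_add (p / q) A q 1 z
  have e2 := cocycleIter_add (p / q) A 1 q z
  have hq' : (q : ℂ) ≠ 0 := by exact_mod_cast hq.ne'
  rw [cocycleIter_one] at e1
  rw [cocycleIter_one, add_comm q 1, e1] at e2
  have e3 : z + (q : ℂ) * ((p / q : ℝ) : ℂ) = z + (p : ℂ) := by push_cast; field_simp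
  rw [e3, periodic_int h1] at e2
  simpa using e2

/-! ### Multipliers of elliptic matrices -/

/-- The square root of `1 - t ^ 2 / 4`, the sine of the rotation angle of an elliptic matrix of
trace `t`. -/
def sqrtDisc (t : ℂ) : ℂ := (1 - t ^ 2 / 4) ^ (1 / 2 : ℂ)

/-- The multiplier of an elliptic matrix of trace `t` with orientation `σ`. -/
def multiplier (σ : ℝ) (t : ℂ) : ℂ := t / 2 + Complex.I * (σ * sqrtDisc t)

lemma sqrtDisc_sq (t : ℂ) : sqrtDisc t ^ 2 = 1 - t ^ 2 / 4 := by
  rw [sqrtDisc, one_div]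
  exact Complex.cpow_ofNat_inv_pow _ 2

lemma multiplier_mul {σ : ℝ} (hσ : σ ^ 2 = 1) (t : ℂ) :
    multiplier σ t * (t / 2 - Complex.I * (σ * sqrtDisc t)) = 1 := by
  have h1 := sqrtDisc_sq t
  have h2 : (σ : ℂ) ^ 2 = 1 := by exact_mod_cast hσ
  have h3 := Complex.I_sq
  rw [multiplier]
  linear_combination (-(σ : ℂ) ^ 2 * sqrtDisc t ^ 2) * h3 + sqrtDisc t ^ 2 * h2 + h1

lemma multiplier_ne_zero {σ : ℝ} (hσ : σ ^ 2 = 1) (t : ℂ) : multiplier σ t ≠ 0 :=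
  left_ne_zero_of_mul_eq_one (multiplier_mul hσ t)

lemma multiplier_inv {σ : ℝ} (hσ : σ ^ 2 = 1) (t : ℂ) :
    (multiplier σ t)⁻¹ = t / 2 - Complex.I * (σ * sqrtDisc t) :=
  inv_eq_of_mul_eq_one_right (multiplier_mul hσ t)

lemma multiplier_add_inv {σ : ℝ} (hσ : σ ^ 2 = 1) (t : ℂ) :
    multiplier σ t + (multiplier σ t)⁻¹ = t := by
  rw [multiplier_inv hσ, multiplier]
  ring

lemma rotMul_multiplier {σ : ℝ} (hσ : σ ^ 2 = 1) (t : ℂ) :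
    rotMul (multiplier σ t) = !![t / 2, σ * sqrtDisc t; -(σ * sqrtDisc t), t / 2] := by
  have h : (multiplier σ t - (multiplier σ t)⁻¹) / (2 * Complex.I) = σ * sqrtDisc t := by
    rw [multiplier_inv hσ, multiplier]
    field_simp
    ring
  rw [rotMul, h, multiplier_add_inv hσ]

section NearReal

variable {s : ℝ} {t₀ t : ℂ}

lemma disc_re_ge (hs : 0 < s) (ht₀ : t₀.im = 0) (hd : s ≤ 1 - t₀.re ^ 2 / 4)
    (ht : ‖t - t₀‖ ≤ s / 4) : s / 2 ≤ (1 - t ^ 2 / 4).re ∧ ‖1 - t ^ 2 / 4‖ ≤ 4 := by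
  have h0 : t₀ = (t₀.re : ℂ) := Complex.ext (by simp) (by simp [ht₀])
  have hn : ‖t₀‖ ≤ 2 := by
    rw [h0, Complex.norm_real, Real.norm_eq_abs]
    exact abs_le_of_sq_le_sq (by nlinarith) (by norm_num)
  have hs1 : s ≤ 1 := by nlinarith [sq_nonneg t₀.re]
  have hdiff : ‖(1 - t ^ 2 / 4) - (1 - t₀ ^ 2 / 4)‖ ≤ s / 2 := by
    have e : (1 - t ^ 2 / 4) - (1 - t₀ ^ 2 / 4) = -((t - t₀) * ((t - t₀) + 2 * t₀)) / 4 := by ring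
    rw [e, norm_div, norm_neg, norm_mul, Complex.norm_ofNat, div_le_iff₀ (by norm_num)]
    have h3 : ‖(t - t₀) + 2 * t₀‖ ≤ s / 4 + 4 := by
      refine (norm_add_le _ _).trans ?_
      rw [norm_mul, Complex.norm_ofNat]
      linarith
    nlinarith [norm_nonneg (t - t₀), norm_nonneg ((t - t₀) + 2 * t₀)]
  have hre : (1 - t₀ ^ 2 / 4).re = 1 - t₀.re ^ 2 / 4 := by
    rw [h0, show (1 - (t₀.re : ℂ) ^ 2 / 4) = ((1 - t₀.re ^ 2 / 4 : ℝ) : ℂ) by push_cast; ring,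
      Complex.ofReal_re, Complex.ofReal_re]
  constructor
  · have := (Complex.abs_re_le_norm _).trans hdiff
    rw [Complex.sub_re, hre] at this
    linarith [(abs_le.1 this).1]
  · have h1 : ‖1 - t₀ ^ 2 / 4‖ ≤ 2 := by
      refine (norm_sub_le _ _).trans ?_
      rw [norm_div, norm_pow, Complex.norm_ofNat, NormOneClass.norm_one]
      nlinarith [norm_nonneg t₀]
    have h2 := norm_add_le ((1 - t ^ 2 / 4) - (1 - t₀ ^ 2 / 4)) (1 - t₀ ^ 2 / 4)
    rw [sub_add_cancel] at h2
    linarith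

lemma sqrtDisc_re_ge (hs : 0 < s) (ht₀ : t₀.im = 0) (hd : s ≤ 1 - t₀.re ^ 2 / 4)
    (ht : ‖t - t₀‖ ≤ s / 4) : s / 2 ≤ (sqrtDisc t).re := by
  have h1 := (disc_re_ge hs ht₀ hd ht).1
  have hs1 : s ≤ 1 := by nlinarith [sq_nonneg t₀.re]
  have h0 : 0 ≤ (sqrtDisc t).re := by
    rw [sqrtDisc, one_div, Complex.cpow_inv_two_re]
    positivity
  rw [← sqrtDisc_sq, sq, Complex.mul_re] at h1
  nlinarith [mul_self_nonneg (sqrtDisc t).im]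

lemma norm_sqrtDisc_le (hs : 0 < s) (ht₀ : t₀.im = 0) (hd : s ≤ 1 - t₀.re ^ 2 / 4)
    (ht : ‖t - t₀‖ ≤ s / 4) : ‖sqrtDisc t‖ ≤ 2 := by
  have h1 := (disc_re_ge hs ht₀ hd ht).2
  rw [← sqrtDisc_sq, norm_pow] at h1
  nlinarith [norm_nonneg (sqrtDisc t)]

lemma norm_half_le (hs : 0 < s) (ht₀ : t₀.im = 0) (hd : s ≤ 1 - t₀.re ^ 2 / 4)
    (ht : ‖t - t₀‖ ≤ s / 4) : ‖t / 2‖ ≤ 2 := by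
  have h1 := (disc_re_ge hs ht₀ hd ht).2
  have h2 : ‖t ^ 2 / 4‖ ≤ 5 := by
    rw [show t ^ 2 / 4 = 1 - (1 - t ^ 2 / 4) by ring]
    refine (norm_sub_le _ _).trans ?_
    rw [NormOneClass.norm_one]
    linarith
  have h0 : t₀ = (t₀.re : ℂ) := Complex.ext (by simp) (by simp [ht₀])
  have hn : ‖t₀‖ ≤ 2 := by
    rw [h0, Complex.norm_real, Real.norm_eq_abs]
    exact abs_le_of_sq_le_sq (by nlinarith) (by norm_num)
  have hs1 : s ≤ 1 := by nlinarith [sq_nonneg t₀.re]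
  have h3 := norm_add_le (t - t₀) t₀
  rw [sub_add_cancel] at h3
  rw [norm_div, Complex.norm_ofNat]
  linarith

variable {σ : ℝ}

lemma norm_multiplier_le (hσ : σ ^ 2 = 1) (hs : 0 < s) (ht₀ : t₀.im = 0)
    (hd : s ≤ 1 - t₀.re ^ 2 / 4) (ht : ‖t - t₀‖ ≤ s / 4) :
    ‖multiplier σ t‖ ≤ 4 ∧ ‖(multiplier σ t)⁻¹‖ ≤ 4 := by
  have h1 := norm_half_le hs ht₀ hd ht
  have h2 := norm_sqrtDisc_le hs ht₀ hd ht
  have hσ1 : |σ| = 1 := by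
    rw [← abs_one, ← sq_eq_sq_iff_abs_eq_abs, hσ, one_pow]
  have h3 : ‖Complex.I * (σ * sqrtDisc t)‖ ≤ 2 := by
    simpa [hσ1] using h2
  constructor
  · rw [multiplier]
    exact (norm_add_le _ _).trans (by linarith)
  · rw [multiplier_inv hσ]
    exact (norm_sub_le _ _).trans (by linarith)

lemma multiplier_mem_slitPlane (hσ : σ ^ 2 = 1) (hs : 0 < s) (ht₀ : t₀.im = 0)
    (hd : s ≤ 1 - t₀.re ^ 2 / 4) (ht : ‖t - t₀‖ ≤ s / 4) :
    multiplier σ t ∈ Complex.slitPlane := by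
  refine Complex.mem_slitPlane_iff.2 (Or.inr fun h => ?_)
  have h1 := sqrtDisc_re_ge hs ht₀ hd ht
  have h2 := (Complex.abs_im_le_norm _).trans ht
  rw [Complex.sub_im, ht₀, sub_zero] at h2
  have h3 : t.im / 2 + σ * (sqrtDisc t).re = 0 := by
    simpa [multiplier] using h
  have h4 : |σ * (sqrtDisc t).re| = (sqrtDisc t).re := by
    rw [abs_mul, abs_of_pos (by linarith : 0 < (sqrtDisc t).re),
      show |σ| = 1 by rw [← abs_one, ← sq_eq_sq_iff_abs_eq_abs, hσ, one_pow], one_mul]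
  have h5 : |σ * (sqrtDisc t).re| = |t.im| / 2 := by
    rw [show σ * (sqrtDisc t).re = -(t.im / 2) by linarith, abs_neg, abs_div]
    norm_num
  linarith

lemma sqrtDisc_ofReal {t : ℂ} (ht : t.im = 0) (hd : 0 ≤ 1 - t.re ^ 2 / 4) :
    sqrtDisc t = (√(1 - t.re ^ 2 / 4) : ℝ) := by
  have h0 : t = (t.re : ℂ) := Complex.ext (by simp) (by simp [ht])
  rw [sqrtDisc, h0, show (1 - (t.re : ℂ) ^ 2 / 4) = ((1 - t.re ^ 2 / 4 : ℝ) : ℂ) by push_cast; ring,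
    Complex.ofReal_re, Real.sqrt_eq_rpow, Complex.ofReal_cpow hd]
  norm_num

lemma norm_multiplier_of_real (hσ : σ ^ 2 = 1) {t : ℂ} (ht : t.im = 0)
    (hd : 0 ≤ 1 - t.re ^ 2 / 4) : ‖multiplier σ t‖ = 1 := by
  have h0 : t = (t.re : ℂ) := Complex.ext (by simp) (by simp [ht])
  have h : (starRingEnd ℂ) (multiplier σ t) = (multiplier σ t)⁻¹ := by
    rw [multiplier_inv hσ, multiplier, sqrtDisc_ofReal ht hd, h0]
    simp [sub_eq_add_neg, Complex.conj_ofNat]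
  have h2 : multiplier σ t * (starRingEnd ℂ) (multiplier σ t) = 1 := by
    rw [h, mul_inv_cancel₀ (multiplier_ne_zero hσ t)]
  rw [Complex.mul_conj, Complex.normSq_eq_norm_sq] at h2
  have h3 : ‖multiplier σ t‖ ^ 2 = 1 := by exact_mod_cast h2
  nlinarith [norm_nonneg (multiplier σ t)]

end NearReal

/-- Roots of the multiplier. -/
def rootMul (σ : ℝ) (q : ℕ) (l : ℕ) (t : ℂ) : ℂ :=
  Complex.exp (Complex.log (multiplier σ t) / q) * Complex.exp (2 * π * Complex.I / q) ^ l

lemma rootMul_ne_zero (σ : ℝ) (q l : ℕ) (t : ℂ) : rootMul σ q l t ≠ 0 :=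
  mul_ne_zero (Complex.exp_ne_zero _) (pow_ne_zero _ (Complex.exp_ne_zero _))

lemma rootMul_pow {σ : ℝ} (hσ : σ ^ 2 = 1) {q : ℕ} (hq : 0 < q) (l : ℕ) (t : ℂ) :
    rootMul σ q l t ^ q = multiplier σ t := by
  have hq' : (q : ℂ) ≠ 0 := by exact_mod_cast hq.ne'
  rw [rootMul, mul_pow, ← Complex.exp_nat_mul, mul_div_cancel₀ _ hq',
    Complex.exp_log (multiplier_ne_zero hσ t), ← pow_mul, mul_comm l q, pow_mul,
    ← Complex.exp_nat_mul, mul_div_cancel₀ _ hq', Complex.exp_two_pi_mul_I, one_pow, mul_one]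

lemma sum_rootMul_zpow {σ : ℝ} {q : ℕ} {t : ℂ} {k : ℤ} (hk0 : k ≠ 0)
    (hk : |k| < q) : ∑ l ∈ Finset.range q, rootMul σ q l t ^ k = 0 := by
  have hq : q ≠ 0 := fun h => by simp [h] at hk; exact (abs_nonneg k).not_gt hk
  set ζ := Complex.exp (2 * π * Complex.I / q) with hζ
  have hprim : IsPrimitiveRoot ζ q := Complex.isPrimitiveRoot_exp q hq
  have h1 : ζ ^ k ≠ 1 := by
    intro h
    rw [hprim.zpow_eq_one_iff_dvd] at h
    exact hk0 (Int.eq_zero_of_abs_lt_dvd h hk)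
  have h2 : (ζ ^ k) ^ q = 1 := by
    rw [← zpow_natCast, ← zpow_mul, mul_comm, zpow_mul, zpow_natCast, hprim.pow_eq_one, one_zpow]
  have h3 : ∑ l ∈ Finset.range q, (ζ ^ k) ^ l = 0 := by
    have := mul_geom_sum (ζ ^ k) q
    rw [h2, sub_self] at this
    exact (mul_eq_zero.1 this).resolve_left (sub_ne_zero.2 h1)
  have h4 : ∀ l, rootMul σ q l t ^ k
      = Complex.exp (Complex.log (multiplier σ t) / q) ^ k * (ζ ^ k) ^ l := by
    intro l
    rw [rootMul, mul_zpow, ← hζ]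
    congr 1
    rw [← zpow_natCast, ← zpow_natCast, ← zpow_mul, ← zpow_mul, mul_comm]
  simp only [h4, ← Finset.mul_sum, h3, mul_zero]

lemma norm_pow_le_of_norm_pow_le {μ : ℂ} {q j : ℕ} {r : ℝ} (hr : 1 ≤ r) (h : ‖μ ^ q‖ ≤ r)
    (hj : j ≤ q) : ‖μ ^ j‖ ≤ r := by
  rw [norm_pow] at *
  rcases le_total 1 ‖μ‖ with h1 | h1
  · exact (pow_le_pow_right₀ h1 hj).trans h
  · exact (pow_le_one₀ (norm_nonneg _) h1).trans hr

lemma norm_rootMul_pow_le {σ : ℝ} (hσ : σ ^ 2 = 1) {q : ℕ} (hq : 0 < q) (l : ℕ) {s : ℝ} {t₀ t : ℂ}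
    (hs : 0 < s) (ht₀ : t₀.im = 0) (hd : s ≤ 1 - t₀.re ^ 2 / 4) (ht : ‖t - t₀‖ ≤ s / 4) {j : ℕ}
    (hj : j ≤ q) : ‖rootMul σ q l t ^ j‖ ≤ 4 ∧ ‖(rootMul σ q l t ^ j)⁻¹‖ ≤ 4 := by
  have h := norm_multiplier_le hσ hs ht₀ hd ht
  rw [← rootMul_pow hσ hq l] at h
  refine ⟨norm_pow_le_of_norm_pow_le (by norm_num) h.1 hj, ?_⟩
  rw [← inv_pow] at *
  exact norm_pow_le_of_norm_pow_le (by norm_num) h.2 hj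

lemma norm_rootMul_of_real {σ : ℝ} (hσ : σ ^ 2 = 1) {q : ℕ} (hq : 0 < q) (l : ℕ) {t : ℂ}
    (ht : t.im = 0) (hd : 0 ≤ 1 - t.re ^ 2 / 4) : ‖rootMul σ q l t‖ = 1 := by
  have h := norm_multiplier_of_real hσ ht hd
  rw [← rootMul_pow hσ hq l, norm_pow] at h
  exact (pow_eq_one_iff_of_nonneg (norm_nonneg _) hq.ne').1 h

lemma differentiableAt_rootMul {σ : ℝ} (hσ : σ ^ 2 = 1) (q l : ℕ) {s : ℝ} {t₀ t : ℂ}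
    (hs : 0 < s) (ht₀ : t₀.im = 0) (hd : s ≤ 1 - t₀.re ^ 2 / 4) (ht : ‖t - t₀‖ ≤ s / 4) :
    DifferentiableAt ℂ (multiplier σ) t ∧ DifferentiableAt ℂ (rootMul σ q l) t := by
  have h1 : (1 - t ^ 2 / 4) ∈ Complex.slitPlane :=
    Complex.mem_slitPlane_iff.2 (Or.inl (by linarith [(disc_re_ge hs ht₀ hd ht).1]))
  have h2 : DifferentiableAt ℂ sqrtDisc t :=
    (by fun_prop : DifferentiableAt ℂ (fun t : ℂ => 1 - t ^ 2 / 4) t).cpow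
      (differentiableAt_const _) h1
  have h3 : DifferentiableAt ℂ (multiplier σ) t :=
    (by fun_prop : DifferentiableAt ℂ (fun t : ℂ => t / 2) t).add
      ((h2.const_mul _).const_mul _)
  refine ⟨h3, ?_⟩
  exact (((h3.clog (multiplier_mem_slitPlane hσ hs ht₀ hd ht)).div_const _).cexp).mul_const _

/-! ### Conjugating an elliptic cocycle over a rational rotation to rotations -/

/-- A cocycle over the rotation by `p / q` whose monodromy is uniformly elliptic with nearly
constant trace. -/
structure IsElliptic (H Y s : ℝ) (p : ℤ) (q : ℕ) (A : ℂ → M2) : Prop where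
  pos_q : 0 < q
  pos_H : 0 < H
  pos_s : 0 < s
  four_le : 4 ≤ Y
  isSL2 : IsSL2Strip H A
  norm_iter_le : ∀ k ≤ q, ∀ z ∈ Strip H, ‖cocycleIter (p / q) A k z‖ ≤ Y
  trace_near : ∀ z ∈ Strip H, ∀ w ∈ Strip H,
    ‖(cocycleIter (p / q) A q z).trace - (cocycleIter (p / q) A q w).trace‖ ≤ s / 4
  disc_ge : ∀ x : ℝ, s ≤ 1 - (cocycleIter (p / q) A q x).trace.re ^ 2 / 4

/-- The matrix of (unnormalized) eigenvectors obtained by averaging along the orbit. -/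
def eigenSum (ω : ℝ) (q : ℕ) (A : ℂ → M2) (σ : ℝ) (l : ℕ) (z : ℂ) : M2 :=
  ∑ j ∈ Finset.range q, cocycleIter ω A j (z - (j : ℂ) * ω) *
    (cocycleIter ω A q (z - (j : ℂ) * ω)
      - rotMul (multiplier σ (cocycleIter ω A q z).trace)⁻¹) *
    rotMul (rootMul σ q l (cocycleIter ω A q z).trace ^ j)⁻¹

lemma sub_mul_rotMul_eq {T : M2} (hT : T.det = 1) {lam : ℂ} (h0 : lam ≠ 0)
    (ht : lam + lam⁻¹ = T.trace) :
    T * (T - rotMul lam⁻¹) * rotMul lam⁻¹ = T - rotMul lam⁻¹ := by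
  have h1 := rotMul_sq (inv_ne_zero h0)
  rw [inv_inv, add_comm, ht] at h1
  have h2 := M2.sq_eq hT
  rw [Matrix.mul_sub, h2, Matrix.sub_mul, Matrix.mul_assoc, h1, Matrix.mul_sub, Matrix.mul_smul,
    Matrix.mul_one, Matrix.sub_mul, Matrix.smul_mul, Matrix.one_mul]
  abel

lemma trace_monodromy_periodic {p : ℤ} {q : ℕ} (hq : 0 < q) {A : ℂ → M2}
    (h1 : ∀ z, A (z + 1) = A z) {z : ℂ} (hdet : (A z).det = 1) :
    (cocycleIter (p / q) A q (z + ((p / q : ℝ) : ℂ))).trace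
      = (cocycleIter (p / q) A q z).trace := by
  have h := monodromy_conj (p := p) hq h1 z
  have h2 : A z * (A z).adjugate = 1 := by rw [Matrix.mul_adjugate, hdet, one_smul]
  have h3 : (A z).adjugate * A z = 1 := by rw [Matrix.adjugate_mul, hdet, one_smul]
  rw [← Matrix.mul_one (cocycleIter _ A q (z + _)), ← h2, ← Matrix.mul_assoc, h,
    Matrix.mul_assoc, Matrix.trace_mul_comm, Matrix.mul_assoc, h3, Matrix.mul_one]

lemma cocycleIter_periodic {α : ℝ} {A : ℂ → M2} (h1 : ∀ z, A (z + 1) = A z) (k : ℕ) (z : ℂ) :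
    cocycleIter α A k (z + 1) = cocycleIter α A k z := by
  induction k with
  | zero => rfl
  | succ k ih =>
    simp only [cocycleIter, ih]
    rw [show z + 1 + k * α = z + k * α + 1 by ring, h1]

lemma eigenSum_periodic {ω : ℝ} {q : ℕ} {A : ℂ → M2} (h1 : ∀ z, A (z + 1) = A z) (σ : ℝ) (l : ℕ)
    (z : ℂ) : eigenSum ω q A σ l (z + 1) = eigenSum ω q A σ l z := by
  have h2 : ∀ j : ℕ, z + 1 - (j : ℂ) * ω = z - j * ω + 1 := fun j => by ring
  simp only [eigenSum, h2, cocycleIter_periodic h1]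

namespace IsElliptic

variable {H Y s : ℝ} {p : ℤ} {q : ℕ} {A : ℂ → M2} {σ : ℝ}

lemma trace_real (hE : IsElliptic H Y s p q A) (x : ℝ) :
    (cocycleIter (p / q) A q x).trace.im = 0 :=
  M2.IsReal.trace ((hE.isSL2.cocycleIter _ q).2.2.1 x)

lemma trace_real_zero (hE : IsElliptic H Y s p q A) :
    (cocycleIter (p / q) A q 0).trace.im = 0 := by simpa using hE.trace_real 0

lemma disc_ge_zero (hE : IsElliptic H Y s p q A) :
    s ≤ 1 - (cocycleIter (p / q) A q 0).trace.re ^ 2 / 4 := by simpa using hE.disc_ge 0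

lemma disc_nonneg (hE : IsElliptic H Y s p q A) (x : ℝ) :
    0 ≤ 1 - (cocycleIter (p / q) A q x).trace.re ^ 2 / 4 := hE.pos_s.le.trans (hE.disc_ge x)

lemma zero_mem (hE : IsElliptic H Y s p q A) : (0 : ℂ) ∈ Strip H := by
  simpa using real_mem_strip hE.pos_H 0

lemma trace_near_zero (hE : IsElliptic H Y s p q A) {z : ℂ} (hz : z ∈ Strip H) :
    ‖(cocycleIter (p / q) A q z).trace - (cocycleIter (p / q) A q 0).trace‖ ≤ s / 4 :=
  hE.trace_near z hz 0 hE.zero_mem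

lemma trace_periodic (hE : IsElliptic H Y s p q A) {z : ℂ} (hz : z ∈ Strip H) :
    (cocycleIter (p / q) A q (z + ((p / q : ℝ) : ℂ))).trace
      = (cocycleIter (p / q) A q z).trace :=
  trace_monodromy_periodic hE.pos_q hE.isSL2.2.1 (hE.isSL2.2.2.2 z hz)

lemma mul_eigenSum (hE : IsElliptic H Y s p q A) (hσ : σ ^ 2 = 1) (l : ℕ) {z : ℂ}
    (hz : z ∈ Strip H) :
    A z * eigenSum (p / q) q A σ l z = eigenSum (p / q) q A σ l (z + ((p / q : ℝ) : ℂ)) *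
      rotMul (rootMul σ q l (cocycleIter (p / q) A q z).trace) := by
  set ω : ℝ := p / q with hω
  set t := (cocycleIter ω A q z).trace with ht
  set μ := rootMul σ q l t
  have hμ0 : μ ≠ 0 := rootMul_ne_zero σ q l t
  set R := rotMul (multiplier σ t)⁻¹ with hR
  let F : ℕ → M2 := fun j => cocycleIter ω A j (z + ω - (j : ℂ) * ω) *
    (cocycleIter ω A q (z + ω - (j : ℂ) * ω) - R) * rotMul (μ ^ j)⁻¹ * rotMul μ
  have hleft : A z * eigenSum ω q A σ l z = ∑ j ∈ Finset.range q, F (j + 1) := by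
    rw [eigenSum, Finset.mul_sum]
    refine Finset.sum_congr rfl fun j _ => ?_
    have e1 : z + ω - ((j + 1 : ℕ) : ℂ) * ω = z - j * ω := by push_cast; ring
    have e2 : rotMul (μ ^ (j + 1))⁻¹ * rotMul μ = rotMul (μ ^ j)⁻¹ := by
      rw [← rotMul_mul (inv_ne_zero (pow_ne_zero _ hμ0)) hμ0]
      congr 1
      rw [pow_succ, mul_inv, mul_assoc, inv_mul_cancel₀ hμ0, mul_one]
    simp only [F, e1]
    have e4 : cocycleIter ω A (j + 1) (z - j * ω) = A z * cocycleIter ω A j (z - j * ω) := by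
      simp [cocycleIter]
    rw [Matrix.mul_assoc _ (rotMul _) (rotMul μ), e2, e4]
    simp only [Matrix.mul_assoc]
    rfl
  have hright : eigenSum ω q A σ l (z + ω) * rotMul μ = ∑ j ∈ Finset.range q, F j := by
    rw [eigenSum, Finset.sum_mul, hω, hE.trace_periodic hz]
  have hq' : (q : ℂ) ≠ 0 := by exact_mod_cast hE.pos_q.ne'
  have e3 : z + ω - (q : ℂ) * ω = z + ω + ((-p : ℤ) : ℂ) := by
    rw [hω]; push_cast; field_simp; ring
  have hSL := hE.isSL2.cocycleIter ω q
  have hlast : F q = F 0 := by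
    have h1 := sub_mul_rotMul_eq (T := cocycleIter ω A q (z + ω))
      (hSL.2.2.2 _ (mem_strip_add_real hz ω)) (multiplier_ne_zero hσ t)
      (by rw [multiplier_add_inv hσ, hω, hE.trace_periodic hz])
    simp only [F, e3, periodic_int hSL.2.1, rootMul_pow hσ hE.pos_q, μ]
    rw [h1]
    simp [cocycleIter, rotMul_one, hR]
  rw [hleft, hright]
  have := Finset.sum_range_succ' F q
  rw [Finset.sum_range_succ, hlast] at this
  exact (add_right_cancel this).symm

lemma iter_mul_eigenSum (hE : IsElliptic H Y s p q A) (hσ : σ ^ 2 = 1) (l : ℕ) {z : ℂ}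
    (hz : z ∈ Strip H) (k : ℕ) :
    cocycleIter (p / q) A k z * eigenSum (p / q) q A σ l z
      = eigenSum (p / q) q A σ l (z + (k : ℂ) * ((p / q : ℝ) : ℂ)) *
        rotMul (rootMul σ q l (cocycleIter (p / q) A q z).trace ^ k) ∧
    (cocycleIter (p / q) A q (z + (k : ℂ) * ((p / q : ℝ) : ℂ))).trace
      = (cocycleIter (p / q) A q z).trace := by
  induction k with
  | zero => simp [cocycleIter, rotMul_one]
  | succ k ih =>
    have hzk := mem_strip_add_mul_real hz k (p / q)
    have e : z + ((k + 1 : ℕ) : ℂ) * ((p / q : ℝ) : ℂ)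
        = z + k * ((p / q : ℝ) : ℂ) + ((p / q : ℝ) : ℂ) := by push_cast; ring
    have h1 := hE.mul_eigenSum hσ l hzk
    rw [ih.2] at h1
    constructor
    · rw [cocycleIter, Matrix.mul_assoc, ih.1, ← Matrix.mul_assoc, h1, Matrix.mul_assoc,
        ← rotMul_mul (rootMul_ne_zero _ _ _ _) (pow_ne_zero _ (rootMul_ne_zero _ _ _ _)), e,
        pow_succ']
    · rw [e, hE.trace_periodic hzk, ih.2]

lemma monodromy_mul_eigenSum (hE : IsElliptic H Y s p q A) (hσ : σ ^ 2 = 1) (l : ℕ) {z : ℂ}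
    (hz : z ∈ Strip H) :
    cocycleIter (p / q) A q z * eigenSum (p / q) q A σ l z = eigenSum (p / q) q A σ l z *
      rotMul (multiplier σ (cocycleIter (p / q) A q z).trace) := by
  have hq' : (q : ℂ) ≠ 0 := by exact_mod_cast hE.pos_q.ne'
  have e : z + (q : ℂ) * ((p / q : ℝ) : ℂ) = z + (p : ℂ) := by push_cast; field_simp
  rw [(hE.iter_mul_eigenSum hσ l hz q).1, rootMul_pow hσ hE.pos_q, e,
    periodic_int (eigenSum_periodic hE.isSL2.2.1 σ l)]

lemma det_eigenSum_periodic (hE : IsElliptic H Y s p q A) (hσ : σ ^ 2 = 1) (l : ℕ) {z : ℂ}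
    (hz : z ∈ Strip H) :
    (eigenSum (p / q) q A σ l (z + ((p / q : ℝ) : ℂ))).det = (eigenSum (p / q) q A σ l z).det := by
  have h := congrArg Matrix.det (hE.mul_eigenSum hσ l hz)
  rw [Matrix.det_mul, Matrix.det_mul, hE.isSL2.2.2.2 z hz,
    rotMul_det (rootMul_ne_zero _ _ _ _)] at h
  simpa using h.symm

lemma norm_eigenSum_le (hE : IsElliptic H Y s p q A) (hσ : σ ^ 2 = 1) (l : ℕ) {z : ℂ}
    (hz : z ∈ Strip H) : ‖eigenSum (p / q) q A σ l z‖ ≤ 32 * Y ^ 2 * q := by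
  have hm := norm_multiplier_le hσ hE.pos_s hE.trace_real_zero hE.disc_ge_zero
    (hE.trace_near_zero hz)
  have hY := hE.four_le
  rw [eigenSum]
  refine (norm_sum_le_of_le (f := _) (n := fun _ => 4 * Y * (2 * Y) * 4) _ fun j hj => ?_).trans ?_
  · have hj' := Finset.mem_range.1 hj
    have hzj := mem_strip_sub_mul_real hz j (p / q)
    have hr := norm_rootMul_pow_le hσ hE.pos_q l hE.pos_s hE.trace_real_zero hE.disc_ge_zero
      (hE.trace_near_zero hz) hj'.le
    refine M2.norm_mul₃_of_le (hE.norm_iter_le j hj'.le _ hzj) ?_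
      (norm_rotMul_le hr.2 (by rw [inv_inv]; exact hr.1))
    refine (norm_sub_le _ _).trans ?_
    have h1 := hE.norm_iter_le q le_rfl _ hzj
    have h2 := norm_rotMul_le hm.2 (by rw [inv_inv]; exact hm.1)
    linarith
  · rw [Finset.sum_const, Finset.card_range, nsmul_eq_mul]
    exact le_of_eq (by ring)

lemma isReal_eigenSum (hE : IsElliptic H Y s p q A) (hσ : σ ^ 2 = 1) (l : ℕ) (x : ℝ) :
    (eigenSum (p / q) q A σ l x).IsReal := by
  have hm := norm_multiplier_of_real hσ (hE.trace_real x) (hE.disc_nonneg x)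
  have hr := norm_rootMul_of_real hσ hE.pos_q l (hE.trace_real x) (hE.disc_nonneg x)
  refine M2.IsReal.sum fun j _ => ?_
  have e : (x : ℂ) - (j : ℂ) * ((p / q : ℝ) : ℂ) = ((x - j * (p / q) : ℝ) : ℂ) := by
    push_cast; ring
  rw [e]
  refine M2.IsReal.mul (M2.IsReal.mul ((hE.isSL2.cocycleIter _ j).2.2.1 _) (M2.IsReal.sub
    ((hE.isSL2.cocycleIter _ q).2.2.1 _) (isReal_rotMul ?_))) (isReal_rotMul ?_)
  · rw [norm_inv, hm, inv_one]
  · rw [norm_inv, norm_pow, hr, one_pow, inv_one]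

lemma differentiableOn_rootMul (hE : IsElliptic H Y s p q A) (hσ : σ ^ 2 = 1) (l : ℕ) :
    DifferentiableOn ℂ (fun z => multiplier σ (cocycleIter (p / q) A q z).trace) (Strip H) ∧
    DifferentiableOn ℂ (fun z => rootMul σ q l (cocycleIter (p / q) A q z).trace) (Strip H) := by
  have ht := M2.differentiableOn_trace (hE.isSL2.cocycleIter (p / q) q).1
  constructor <;> intro z hz <;>
    have := differentiableAt_rootMul hσ q l hE.pos_s hE.trace_real_zero hE.disc_ge_zero
      (hE.trace_near_zero hz)
  · exact this.1.comp_differentiableWithinAt z (ht z hz)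
  · exact this.2.comp_differentiableWithinAt z (ht z hz)

lemma differentiableOn_eigenSum (hE : IsElliptic H Y s p q A) (hσ : σ ^ 2 = 1) (l : ℕ) :
    DifferentiableOn ℂ (eigenSum (p / q) q A σ l) (Strip H) := by
  have hd := hE.differentiableOn_rootMul hσ l
  have hshift : ∀ j k : ℕ, DifferentiableOn ℂ
      (fun z => cocycleIter (p / q) A k (z - (j : ℂ) * ((p / q : ℝ) : ℂ))) (Strip H) := fun j k =>
    (hE.isSL2.cocycleIter (p / q) k).1.comp (by fun_prop)
      fun z hz => mem_strip_sub_mul_real hz j _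
  unfold eigenSum
  refine DifferentiableOn.fun_sum fun j _ => ?_
  refine M2.differentiableOn_mul (M2.differentiableOn_mul (hshift j j) ((hshift j q).sub ?_)) ?_
  · exact differentiableOn_rotMul (hd.1.inv fun z _ => multiplier_ne_zero hσ _)
      fun z _ => inv_ne_zero (multiplier_ne_zero hσ _)
  · exact differentiableOn_rotMul
      ((hd.2.pow j).inv fun z _ => pow_ne_zero _ (rootMul_ne_zero _ _ _ _))
      fun z _ => inv_ne_zero (pow_ne_zero _ (rootMul_ne_zero _ _ _ _))

end IsElliptic

/-! ### Normalizing the conjugacy -/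

lemma det_mul_of_eigen {T V : M2} {S : ℂ} (hS0 : S ≠ 0)
    (h : T * V = V * !![T.trace / 2, S; -S, T.trace / 2]) :
    T 0 1 * V.det = S * (V 0 0 ^ 2 + V 0 1 ^ 2) ∧
    -T 1 0 * V.det = S * (V 1 0 ^ 2 + V 1 1 ^ 2) := by
  have e00 := congrFun (congrFun h 0) 0
  have e01 := congrFun (congrFun h 0) 1
  have e10 := congrFun (congrFun h 1) 0
  have e11 := congrFun (congrFun h 1) 1
  simp only [Matrix.mul_apply, Fin.sum_univ_two, Matrix.trace_fin_two, Matrix.det_fin_two,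
    Matrix.of_apply, Matrix.cons_val_zero, Matrix.cons_val_one, Matrix.cons_val',
    Matrix.cons_val_fin_one] at *
  constructor <;> apply mul_left_cancel₀ hS0 <;> grind

lemma norm_sq_le_of_isReal_of_eigen {T V : M2} {S : ℂ} (hS0 : S ≠ 0)
    (h : T * V = V * !![T.trace / 2, S; -S, T.trace / 2]) (hV : V.IsReal) :
    ‖S‖ * ‖V‖ ^ 2 ≤ ‖V.det‖ * ‖T - (T.trace / 2) • (1 : M2)‖ := by
  obtain ⟨h1, h2⟩ := det_mul_of_eigen hS0 h
  have hN0 := M2.entry_le (T - (T.trace / 2) • (1 : M2)) 0 1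
  have hN1 := M2.entry_le (T - (T.trace / 2) • (1 : M2)) 1 0
  simp only [Matrix.sub_apply, Matrix.smul_apply, Matrix.one_apply, Fin.isValue, zero_ne_one,
    one_ne_zero, if_false, smul_zero, sub_zero] at hN0 hN1
  set N := ‖T - (T.trace / 2) • (1 : M2)‖
  have key : ∀ i j, ‖S‖ * ‖V i j‖ ^ 2 ≤ ‖V.det‖ * N := by
    obtain ⟨a, b, c, d, rfl⟩ := hV.exists_eq
    replace h1 := congrArg norm h1
    replace h2 := congrArg norm h2
    rw [norm_mul, norm_mul] at h1 h2
    rw [norm_neg] at h2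
    have n1 : ‖(a : ℂ) ^ 2 + (b : ℂ) ^ 2‖ = a ^ 2 + b ^ 2 := by
      rw [show (a : ℂ) ^ 2 + (b : ℂ) ^ 2 = ((a ^ 2 + b ^ 2 : ℝ) : ℂ) by push_cast; ring,
        Complex.norm_of_nonneg (by positivity)]
    have n2 : ‖(c : ℂ) ^ 2 + (d : ℂ) ^ 2‖ = c ^ 2 + d ^ 2 := by
      rw [show (c : ℂ) ^ 2 + (d : ℂ) ^ 2 = ((c ^ 2 + d ^ 2 : ℝ) : ℂ) by push_cast; ring,
        Complex.norm_of_nonneg (by positivity)]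
    simp only [Matrix.of_apply, Matrix.cons_val_zero, Matrix.cons_val_one, Matrix.cons_val',
      Matrix.cons_val_fin_one] at h1 h2
    rw [n1] at h1
    rw [n2] at h2
    set D := ‖(!![(a : ℂ), b; c, d] : M2).det‖
    have hD : 0 ≤ D := norm_nonneg _
    have hS' := norm_nonneg S
    have m1 : ‖S‖ * (a ^ 2 + b ^ 2) ≤ D * N := by rw [← h1, mul_comm]; gcongr
    have m2 : ‖S‖ * (c ^ 2 + d ^ 2) ≤ D * N := by rw [← h2, mul_comm]; gcongr
    intro i j
    fin_cases i <;> fin_cases j <;> simp <;> nlinarith [sq_nonneg a, sq_nonneg b,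
      sq_nonneg c, sq_nonneg d, mul_nonneg hS' (sq_nonneg a), mul_nonneg hS' (sq_nonneg b),
      mul_nonneg hS' (sq_nonneg c), mul_nonneg hS' (sq_nonneg d)]
  have hpos : 0 < ‖S‖ := norm_pos_iff.2 hS0
  have hR : 0 ≤ ‖V.det‖ * N / ‖S‖ := by positivity
  have hV' : ‖V‖ ≤ √(‖V.det‖ * N / ‖S‖) := by
    refine M2.norm_le (Real.sqrt_nonneg _) fun i j => Real.le_sqrt_of_sq_le ?_
    rw [le_div_iff₀ hpos, mul_comm]
    exact key i j
  have := pow_le_pow_left₀ (norm_nonneg _) hV' 2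
  rw [Real.sq_sqrt hR, le_div_iff₀ hpos] at this
  linarith

lemma sum_rotMul_rootMul_pow_inv {σ : ℝ} {q : ℕ} {t : ℂ} {j : ℕ} (hj0 : j ≠ 0) (hj : j < q) :
    ∑ l ∈ Finset.range q, rotMul (rootMul σ q l t ^ j)⁻¹ = 0 := by
  have h1 := sum_rootMul_zpow (σ := σ) (t := t) (q := q) (k := j) (by omega) (by simpa using hj)
  have h2 := sum_rootMul_zpow (σ := σ) (t := t) (q := q) (k := -j) (by omega) (by simpa using hj)
  simp only [zpow_neg, zpow_natCast] at h1 h2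
  ext i k
  rw [Matrix.sum_apply]
  fin_cases i <;> fin_cases k <;>
    simp [rotMul, ← Finset.sum_div, Finset.sum_add_distrib, Finset.sum_sub_distrib, h1, h2]

lemma sum_eigenSum {ω : ℝ} {q : ℕ} (hq : 0 < q) {A : ℂ → M2} {σ : ℝ} (z : ℂ) :
    ∑ l ∈ Finset.range q, eigenSum ω q A σ l z
      = (q : ℂ) • (cocycleIter ω A q z - rotMul (multiplier σ (cocycleIter ω A q z).trace)⁻¹) := by
  simp only [eigenSum]
  rw [Finset.sum_comm]
  simp only [← Finset.mul_sum]
  rw [Finset.sum_eq_single 0]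
  · rw [Nat.cast_smul_eq_nsmul, nsmul_eq_mul']
    simp [cocycleIter, rotMul_one]
  · intro j hj hj0
    rw [sum_rotMul_rootMul_pow_inv hj0 (Finset.mem_range.1 hj), mul_zero]
  · intro h; simp at h; omega

lemma adjugate_mul_of_mul_eq {A V W R : M2} (h : A * V = W * R) (hdet : W.det = V.det)
    (h0 : V.det ≠ 0) : W.adjugate * A = R * V.adjugate := by
  have h1 : W.adjugate * A * (V * V.adjugate) = W.adjugate * W * R * V.adjugate := by
    rw [← Matrix.mul_assoc, Matrix.mul_assoc W.adjugate, h]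
    simp only [Matrix.mul_assoc]
  rw [Matrix.mul_adjugate, Matrix.adjugate_mul, hdet] at h1
  simp only [Matrix.mul_smul, Matrix.mul_one, Matrix.smul_mul, Matrix.one_mul] at h1
  exact smul_right_injective M2 h0 h1

lemma norm_sub_half_trace_le (T : M2) : ‖T - (T.trace / 2) • (1 : M2)‖ ≤ 2 * ‖T‖ := by
  refine (norm_sub_le _ _).trans ?_
  rw [norm_smul, M2.norm_one, norm_div, Complex.norm_ofNat]
  linarith [M2.norm_trace_le T]

namespace IsElliptic

variable {H Y s : ℝ} {p : ℤ} {q : ℕ} {A : ℂ → M2}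

lemma norm_multiplier_coeff (hE : IsElliptic H Y s p q A) {σ : ℝ} (hσ : σ ^ 2 = 1) (x : ℝ) :
    ‖(σ : ℂ) * sqrtDisc (cocycleIter (p / q) A q x).trace‖
      = √(1 - (cocycleIter (p / q) A q x).trace.re ^ 2 / 4) := by
  rw [norm_mul, sqrtDisc_ofReal (hE.trace_real x) (hE.disc_nonneg x), Complex.norm_real,
    Complex.norm_real, Real.norm_of_nonneg (Real.sqrt_nonneg _), Real.norm_eq_abs,
    (pow_eq_one_iff_of_nonneg (abs_nonneg σ) two_ne_zero).1 (by rwa [sq_abs]),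
    one_mul]

lemma le_sqrt_disc (hE : IsElliptic H Y s p q A) (x : ℝ) :
    s ≤ √(1 - (cocycleIter (p / q) A q x).trace.re ^ 2 / 4) := by
  have h := hE.disc_ge x
  refine Real.le_sqrt_of_sq_le ?_
  nlinarith [hE.pos_s, sq_nonneg (cocycleIter (p / q) A q x).trace.re]

lemma norm_eigenSum_real_le (hE : IsElliptic H Y s p q A) {σ : ℝ} (hσ : σ ^ 2 = 1) (l : ℕ)
    (x : ℝ) : √(1 - (cocycleIter (p / q) A q x).trace.re ^ 2 / 4) *
      ‖eigenSum (p / q) q A σ l x‖ ^ 2 ≤ ‖(eigenSum (p / q) q A σ l x).det‖ *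
        ‖cocycleIter (p / q) A q x - ((cocycleIter (p / q) A q x).trace / 2) • (1 : M2)‖ := by
  have hn := hE.norm_multiplier_coeff hσ x
  have hpos := hE.pos_s.trans_le (hE.le_sqrt_disc x)
  have h := hE.monodromy_mul_eigenSum hσ l (real_mem_strip hE.pos_H x)
  rw [rotMul_multiplier hσ] at h
  have := norm_sq_le_of_isReal_of_eigen (by rw [← norm_ne_zero_iff, hn]; exact hpos.ne') h
    (hE.isReal_eigenSum hσ l x)
  rwa [hn] at this

/-- The orientation `σ` and the branch `l` can be chosen so that the eigenvector matrix has
positive determinant at the origin. -/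
lemma exists_det_eigenSum_ge (hE : IsElliptic H Y s p q A) : ∃ σ : ℝ, ∃ l : ℕ, σ ^ 2 = 1 ∧
    s ^ 2 / (2 * Y) ≤ (eigenSum (p / q) q A σ l 0).det.re := by
  have hY := hE.four_le
  have hs := hE.pos_s
  obtain ⟨a, b, c, d, hT⟩ := M2.IsReal.exists_eq ((hE.isSL2.cocycleIter (p / q) q).2.2.1 0)
  rw [Complex.ofReal_zero] at hT
  have hdet := (hE.isSL2.cocycleIter (p / q) q).2.2.2 0 hE.zero_mem
  have hd := hE.disc_ge_zero
  have hr := hE.le_sqrt_disc 0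
  have htre : (cocycleIter (p / q) A q 0).trace.re = a + d := by
    simp [hT, Matrix.trace_fin_two]
  rw [Complex.ofReal_zero, htre] at hr
  rw [htre] at hd
  have hdet' : a * d - b * c = 1 := by
    rw [hT, Matrix.det_fin_two] at hdet
    simp only [Matrix.of_apply, Matrix.cons_val_zero, Matrix.cons_val_one, Matrix.cons_val',
      Matrix.cons_val_fin_one] at hdet
    exact_mod_cast hdet
  have hb : b ≠ 0 := by
    rintro rfl
    nlinarith [sq_nonneg (a - d)]
  obtain ⟨σ, hσ, hσb⟩ : ∃ σ : ℝ, σ ^ 2 = 1 ∧ σ * b = |b| := by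
    rcases lt_or_gt_of_ne hb with h | h
    · exact ⟨-1, by norm_num, by rw [abs_of_neg h]; ring⟩
    · exact ⟨1, by norm_num, by rw [abs_of_pos h]; ring⟩
  set r := √(1 - (a + d) ^ 2 / 4) with hrdef
  have hsq : r ^ 2 = 1 - (a + d) ^ 2 / 4 := Real.sq_sqrt (hs.le.trans hd)
  have hS : sqrtDisc (cocycleIter (p / q) A q 0).trace = (r : ℂ) := by
    rw [sqrtDisc_ofReal hE.trace_real_zero (by rw [htre]; linarith), htre]
  have hr0 : 0 < r := hs.trans_le hr
  obtain ⟨l, hl⟩ : ∃ l, r ≤ ‖eigenSum (p / q) q A σ l 0‖ := by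
    by_contra! hcon
    have h1 := congrFun (congrFun (sum_eigenSum (ω := p / q) hE.pos_q (A := A) (σ := σ) 0) 0) 1
    have h2 : (cocycleIter (p / q) A q 0 -
        rotMul (multiplier σ (cocycleIter (p / q) A q 0).trace)⁻¹) 0 1 = ((b + σ * r : ℝ) : ℂ) := by
      rw [Matrix.sub_apply, rotMul, inv_inv, multiplier_inv hσ, multiplier, hS, hT]
      simp only [Matrix.of_apply, Matrix.cons_val_zero, Matrix.cons_val_one, Matrix.cons_val',
        Matrix.cons_val_fin_one]
      push_cast
      field_simp
      ring
    rw [Matrix.smul_apply, h2] at h1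
    have h3 : (q : ℝ) * r ≤ ‖∑ l ∈ Finset.range q, eigenSum (p / q) q A σ l 0‖ := by
      refine le_trans ?_ (M2.entry_le _ 0 1)
      rw [h1, smul_eq_mul, norm_mul, Complex.norm_natCast, Complex.norm_real, Real.norm_eq_abs]
      refine mul_le_mul_of_nonneg_left ?_ (Nat.cast_nonneg q)
      refine abs_le_of_sq_le_sq' ?_ (abs_nonneg _) |>.2
      rw [sq_abs]
      have h3 : (b + σ * r) ^ 2 = b ^ 2 + 2 * (σ * b) * r + σ ^ 2 * r ^ 2 := by ring
      rw [h3, hσb, hσ]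
      nlinarith [sq_nonneg b, mul_nonneg (abs_nonneg b) hr0.le]
    have h4 : ‖∑ l ∈ Finset.range q, eigenSum (p / q) q A σ l 0‖ < q * r := by
      refine (norm_sum_le _ _).trans_lt ?_
      refine (Finset.sum_lt_sum_of_nonempty (by simpa using hE.pos_q.ne')
        fun l _ => hcon l).trans_eq ?_
      simp
    linarith
  refine ⟨σ, l, hσ, ?_⟩
  obtain ⟨v, w, v', w', hV⟩ := M2.IsReal.exists_eq (hE.isReal_eigenSum hσ l 0)
  have hnorm := hE.norm_eigenSum_real_le hσ l 0
  rw [Complex.ofReal_zero] at hV hnorm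
  rw [htre, ← hrdef] at hnorm
  have hdV : (eigenSum (p / q) q A σ l 0).det = ((v * w' - w * v' : ℝ) : ℂ) := by
    rw [hV, Matrix.det_fin_two]; simp
  have heq := hE.monodromy_mul_eigenSum hσ l hE.zero_mem
  rw [rotMul_multiplier hσ] at heq
  have hpos := (det_mul_of_eigen (by
    rw [hS, ← Complex.ofReal_mul]
    exact_mod_cast mul_ne_zero (fun h => by simp [h] at hσ) hr0.ne') heq).1
  rw [hdV, hS, hT, hV] at hpos
  set D := v * w' - w * v'
  have hpos' : b * D = σ * r * (v ^ 2 + w ^ 2) := by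
    simp only [Matrix.of_apply, Matrix.cons_val_zero, Matrix.cons_val_one, Matrix.cons_val',
      Matrix.cons_val_fin_one] at hpos
    exact_mod_cast hpos
  have hD0 : 0 ≤ D := by
    have : |b| * D = r * (v ^ 2 + w ^ 2) := by
      rw [← hσb, mul_assoc, hpos', ← mul_assoc, ← mul_assoc, ← pow_two, hσ, one_mul]
    by_contra! hneg
    have := mul_neg_of_pos_of_neg (abs_pos.2 hb) hneg
    nlinarith [sq_nonneg v, sq_nonneg w, mul_nonneg hr0.le (add_nonneg (sq_nonneg v) (sq_nonneg w))]
  rw [hdV, Complex.norm_real, Real.norm_of_nonneg hD0] at hnorm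
  rw [hdV, Complex.ofReal_re, div_le_iff₀ (by positivity)]
  have hN := (norm_sub_half_trace_le (cocycleIter (p / q) A q 0)).trans
    (mul_le_mul_of_nonneg_left (hE.norm_iter_le q le_rfl 0 hE.zero_mem) zero_le_two)
  have h5 : r ^ 2 ≤ ‖eigenSum (p / q) q A σ l 0‖ ^ 2 := by gcongr
  calc s ^ 2 = s * s := by ring
    _ ≤ r * r ^ 2 := by gcongr; rw [hsq]; exact hd
    _ ≤ r * ‖eigenSum (p / q) q A σ l 0‖ ^ 2 := by gcongr
    _ ≤ _ := hnorm
    _ ≤ D * (2 * Y) := by gcongr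

/-- A uniformly elliptic cocycle over a rational rotation is conjugate to a cocycle of nearly
constant rotations. -/
theorem exists_conj (hE : IsElliptic H Y s p q A) (hpq : IsCoprime p q) (hqH : 9 ≤ H * q) {κ : ℝ}
    (hκ : 3 * q * (1 + H) * Real.exp (-(H * q / 9)) ≤ κ)
    (hκs : 8 * Y * (32 * Y ^ 2 * q) ^ 2 * κ ≤ s ^ 2) :
    ∃ B : ℂ → M2, ∃ μ : ℂ → ℂ, IsSL2Strip (H / 2) B ∧
      (∀ z ∈ Strip (H / 2), ‖B z‖ ^ 2 ≤ (32 * Y ^ 2 * q) ^ 2 * (4 * Y / s ^ 2)) ∧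
      (∀ x : ℝ, ‖B x‖ ^ 2 * √(1 - (cocycleIter (p / q) A q x).trace.re ^ 2 / 4) ≤
        ‖cocycleIter (p / q) A q x - ((cocycleIter (p / q) A q x).trace / 2) • (1 : M2)‖) ∧
      (∀ z ∈ Strip (H / 2), B (z + ((p / q : ℝ) : ℂ)) * A z = rotMul (μ z) * B z) ∧
      (∀ x : ℝ, ‖μ x‖ = 1) ∧ ∀ x : ℝ, ‖μ x - μ 0‖ ≤ 4 * κ := by
  obtain ⟨σ, l, hσ, hd0⟩ := hE.exists_det_eigenSum_ge
  have hY := hE.four_le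
  have hs := hE.pos_s
  have hH := hE.pos_H
  have hsub : Strip (H / 2) ⊆ Strip H := strip_mono (by linarith)
  have hx : ∀ x : ℝ, (x : ℂ) ∈ Strip (H / 2) := real_mem_strip (by linarith)
  set V := eigenSum (p / q) q A σ l with hV
  have hVd : DifferentiableOn ℂ (fun z => (V z).det) (Strip H) :=
    M2.differentiableOn_det (hE.differentiableOn_eigenSum hσ l)
  have hVper : ∀ z, V (z + 1) = V z := eigenSum_periodic hE.isSL2.2.1 σ l
  have h0 : (0 : ℂ) ∈ Strip (H / 2) := by simpa using hx 0
  have hnear : ∀ z ∈ Strip (H / 2), ‖(V z).det - (V 0).det‖ ≤ s ^ 2 / (4 * Y) := fun z hz => by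
    refine (norm_sub_le_of_rational_period hpq hH hqH hκ hVd
      (fun z _ => by simp only [hVper]) (fun z hz => hE.det_eigenSum_periodic hσ l hz)
      (M := 2 * (32 * Y ^ 2 * q) ^ 2) (fun z hz => (M2.norm_det_le _).trans ?_) hz h0).trans ?_
    · have := hE.norm_eigenSum_le hσ l hz
      gcongr
    · rw [le_div_iff₀ (by positivity)]
      linarith
  have hre : ∀ z ∈ Strip (H / 2), s ^ 2 / (4 * Y) ≤ (V z).det.re := fun z hz => by
    have h1 := (Complex.abs_re_le_norm _).trans (hnear z hz)
    rw [Complex.sub_re] at h1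
    have h2 : s ^ 2 / (2 * Y) = 2 * (s ^ 2 / (4 * Y)) := by field_simp; norm_num
    linarith [(abs_le.1 h1).1]
  have hpos : 0 < s ^ 2 / (4 * Y) := by positivity
  have hne : ∀ z ∈ Strip (H / 2), (V z).det ≠ 0 := fun z hz h => by
    have := hre z hz
    rw [h, Complex.zero_re] at this
    linarith
  set g : ℂ → ℂ := fun z => (V z).det ^ (1 / 2 : ℂ) with hg
  have hgsq : ∀ z, g z ^ 2 = (V z).det := fun z => by
    simp only [hg]
    rw [← Complex.cpow_nat_mul]
    norm_num
  have hg0 : ∀ z ∈ Strip (H / 2), g z ≠ 0 := fun z hz h => hne z hz (by rw [← hgsq, h]; ring)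
  have hgd : DifferentiableOn ℂ g (Strip (H / 2)) :=
    (hVd.mono hsub).cpow_const fun z hz => Or.inl (hpos.trans_le (hre z hz))
  have hBn : ∀ z, ‖(g z)⁻¹ • (V z).adjugate‖ ^ 2 = ‖V z‖ ^ 2 / ‖(V z).det‖ := fun z => by
    rw [norm_smul, M2.norm_adjugate, mul_pow, norm_inv, inv_pow, ← norm_pow, hgsq]
    ring
  have hgper : ∀ z ∈ Strip (H / 2), g (z + ((p / q : ℝ) : ℂ)) = g z := fun z hz => by
    simp only [hg]
    rw [hE.det_eigenSum_periodic hσ l (hsub hz)]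
  have hμ1 : ∀ z, rootMul σ q l (cocycleIter (p / q) A q z).trace
      = rootMul σ q l (cocycleIter (p / q) A q z).trace ^ 1 := fun z => (pow_one _).symm
  refine ⟨fun z => (g z)⁻¹ • (V z).adjugate,
    fun z => rootMul σ q l (cocycleIter (p / q) A q z).trace,
    ⟨?_, fun z => ?_, fun x => ?_, fun z hz => ?_⟩, fun z hz => ?_, fun x => ?_, fun z hz => ?_,
    fun x => norm_rootMul_of_real hσ hE.pos_q l (hE.trace_real x) (hE.disc_nonneg x), fun x => ?_⟩
  · have hVd' := M2.differentiableOn.1 ((hE.differentiableOn_eigenSum hσ l).mono hsub)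
    rw [M2.differentiableOn]
    intro i j
    simp only [Matrix.smul_apply, Matrix.adjugate_fin_two]
    refine DifferentiableOn.smul (hgd.inv hg0) ?_
    fin_cases i <;> fin_cases j <;> simp
    · exact hVd' 1 1
    · exact hVd' 0 1
    · exact hVd' 1 0
    · exact hVd' 0 0
  · simp only [hg, hVper]
  · have hVr : (V x).IsReal := hE.isReal_eigenSum hσ l x
    have hdet : (V x).det = ((V x).det.re : ℂ) := by
      exact Complex.ext (by simp) (by simpa using M2.IsReal.det hVr)
    have hgr : (g x).im = 0 := by
      simp only [hg]
      rw [hdet, show (1 / 2 : ℂ) = ((1 / 2 : ℝ) : ℂ) by push_cast; rfl,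
        ← Complex.ofReal_cpow (hpos.le.trans (hre x (hx x))), Complex.ofReal_im]
    have hadj : M2.IsReal ((g x)⁻¹ • (V x).adjugate) := by
      intro i j
      rw [Matrix.adjugate_fin_two]
      fin_cases i <;> fin_cases j <;> simp [hgr, hVr _ _]
    exact hadj
  · have h := hne z hz
    rw [Matrix.det_smul, Matrix.det_adjugate]
    simp [hgsq, h]
  · rw [hBn, div_le_iff₀ (norm_pos_iff.2 (hne z hz))]
    have h1 := (hre z hz).trans (Complex.re_le_norm _)
    calc ‖V z‖ ^ 2 ≤ (32 * Y ^ 2 * q) ^ 2 := by gcongr; exact hE.norm_eigenSum_le hσ l (hsub hz)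
      _ = (32 * Y ^ 2 * q) ^ 2 * (4 * Y / s ^ 2) * (s ^ 2 / (4 * Y)) := by field_simp
      _ ≤ _ := by gcongr
  · rw [hBn, div_mul_eq_mul_div, div_le_iff₀ (norm_pos_iff.2 (hne x (hx x)))]
    linarith [hE.norm_eigenSum_real_le hσ l x]
  · simp only [hgper z hz, Matrix.smul_mul, Matrix.mul_smul]
    rw [adjugate_mul_of_mul_eq (hE.mul_eigenSum hσ l (hsub hz))
      (hE.det_eigenSum_periodic hσ l (hsub hz)) (hne z hz)]
  · refine norm_sub_le_of_rational_period hpq hH hqH hκ (hE.differentiableOn_rootMul hσ l).2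
      (fun z _ => by simp only [cocycleIter_periodic hE.isSL2.2.1])
      (fun z hz => by rw [hE.trace_periodic hz]) (fun z hz => ?_) (hx x) h0
    rw [hμ1]
    exact (norm_rootMul_pow_le hσ hE.pos_q l hs hE.trace_real_zero hE.disc_ge_zero
      (hE.trace_near_zero hz) hE.pos_q).1

end IsElliptic

/-! ### First-order expansion of the monodromy under a constant perturbation -/

lemma matProd_det {a : ℕ → M2} {n : ℕ} (h : ∀ j < n, (a j).det = 1) :
    (matProd a n).det = 1 := by
  induction n with
  | zero => simp [matProd]
  | succ n ih =>
    rw [matProd, Matrix.det_mul, h n n.lt_succ_self, ih fun j hj => h j (hj.trans n.lt_succ_self),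
      one_mul]

lemma norm_matProd_mul_sub_le {a : ℕ → M2} {W : M2} {n : ℕ} {K η : ℝ} (hη : 0 ≤ η)
    (hdet : ∀ j < n, (a j).det = 1)
    (hK : ∀ j k, j + k ≤ n → ‖matProd (fun i => a (j + i)) k‖ ≤ K)
    (hW : ∀ j < n, ‖a j * W‖ ≤ η) (hs : 8 * K * η * n ≤ 1) :
    ‖matProd (fun j => a j * (1 + W)) n - matProd a n - matProd a n *
      ∑ j ∈ Finset.range n, (matProd a j).adjugate * W * matProd a j‖
      ≤ 32 * K ^ 3 * η ^ 2 * n ^ 2 := by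
  have hsub : ∀ j, a j * (1 + W) - a j = a j * W := fun j => by
    rw [Matrix.mul_add, Matrix.mul_one, add_sub_cancel_left]
  have h := norm_matProd_sub_first_order_le (b := fun j => a j * (1 + W)) hη hK
    (fun j hj => by rw [hsub]; exact hW j hj) hs
  convert h using 3
  rw [Finset.mul_sum]
  refine Finset.sum_congr rfl fun j hj => ?_
  have hj' := Finset.mem_range.1 hj
  have h1 : matProd a n
      = matProd (fun i => a (j + 1 + i)) (n - 1 - j) * a j * matProd a j := by
    rw [Matrix.mul_assoc]
    change _ = _ * matProd a (j + 1)
    rw [← matProd_add]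
    congr 1
    omega
  have h2 : matProd a j * (matProd a j).adjugate = 1 := by
    rw [Matrix.mul_adjugate, matProd_det fun i hi => hdet i (hi.trans hj'), one_smul]
  rw [hsub, h1]
  simp only [Matrix.mul_assoc]
  rw [← Matrix.mul_assoc (matProd a j) (Matrix.adjugate _), h2, Matrix.one_mul]

/-- The constant matrix `!![1 - θ ^ 2, -θ; θ, 1]` of determinant one. -/
def tilt (θ : ℝ) : M2 := !![1 - (θ : ℂ) ^ 2, -θ; θ, 1]

lemma tilt_det (θ : ℝ) : (tilt θ).det = 1 := by
  rw [tilt, Matrix.det_fin_two]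
  simp only [Matrix.of_apply, Matrix.cons_val_zero, Matrix.cons_val_one, Matrix.cons_val',
    Matrix.cons_val_fin_one]
  ring

lemma tilt_zero : tilt 0 = 1 := by
  ext i j
  fin_cases i <;> fin_cases j <;> simp [tilt]

lemma isReal_tilt (θ : ℝ) : (tilt θ).IsReal := by
  intro i j
  fin_cases i <;> fin_cases j <;> simp [tilt, ← Complex.ofReal_pow]

/-- The infinitesimal rotation. -/
def infRot : M2 := !![0, -1; 1, 0]

lemma tilt_sub_one (θ : ℝ) :
    tilt θ - 1 = (θ : ℂ) • infRot + ((θ : ℂ) ^ 2) • (!![-1, 0; 0, 0] : M2) := by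
  ext i j
  fin_cases i <;> fin_cases j <;> simp [tilt, infRot]

lemma norm_tilt_sub_one_le {θ : ℝ} (hθ : |θ| ≤ 1) : ‖tilt θ - 1‖ ≤ |θ| := by
  refine M2.norm_le (abs_nonneg _) fun i j => ?_
  have h2 : θ ^ 2 ≤ |θ| := by rw [← sq_abs]; nlinarith [abs_nonneg θ]
  fin_cases i <;> fin_cases j <;> simp [tilt, h2]

/-- The averaged infinitesimal rotation along a product. -/
def infSum (a : ℕ → M2) (n : ℕ) : M2 :=
  ∑ j ∈ Finset.range n, (matProd a j).adjugate * infRot * matProd a j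

lemma norm_matProd_tilt_sub_le {a : ℕ → M2} {n : ℕ} {K θ : ℝ} (hK0 : 1 ≤ K) (hn : (n : ℝ) ≤ K)
    (hdet : ∀ j < n, (a j).det = 1)
    (hK : ∀ j k, j + k ≤ n → ‖matProd (fun i => a (j + i)) k‖ ≤ K)
    (hθ : 16 * K ^ 3 * |θ| ≤ 1) :
    ‖matProd (fun j => a j * tilt θ) n - matProd a n - (θ : ℂ) • (matProd a n * infSum a n)‖
      ≤ 136 * K ^ 7 * θ ^ 2 := by
  have hθ1 : |θ| ≤ 1 := by
    have : 1 ≤ K ^ 3 := one_le_pow₀ hK0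
    nlinarith [abs_nonneg θ]
  have ha : ∀ j < n, ‖a j‖ ≤ K := fun j hj => by
    simpa [matProd] using hK j 1 (by omega)
  have hm : ∀ j ≤ n, ‖matProd a j‖ ≤ K := fun j hj => by simpa using hK 0 j (by omega)
  have hη : ∀ j < n, ‖a j * (tilt θ - 1)‖ ≤ 2 * K * |θ| := fun j hj =>
    M2.norm_mul_of_le (ha j hj) (norm_tilt_sub_one_le hθ1)
  have h := norm_matProd_mul_sub_le (W := tilt θ - 1) (by positivity) hdet hK hη (by
    calc 8 * K * (2 * K * |θ|) * n ≤ 8 * K * (2 * K * |θ|) * K := by gcongr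
      _ = 16 * K ^ 3 * |θ| := by ring
      _ ≤ 1 := hθ)
  rw [add_sub_cancel] at h
  have hsum : ∑ j ∈ Finset.range n, (matProd a j).adjugate * (tilt θ - 1) * matProd a j
      = (θ : ℂ) • infSum a n + ((θ : ℂ) ^ 2) • ∑ j ∈ Finset.range n,
        (matProd a j).adjugate * (!![-1, 0; 0, 0] : M2) * matProd a j := by
    rw [infSum, Finset.smul_sum, Finset.smul_sum, ← Finset.sum_add_distrib]
    refine Finset.sum_congr rfl fun j _ => ?_
    rw [tilt_sub_one, Matrix.mul_add, Matrix.add_mul]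
    simp only [Matrix.mul_smul, Matrix.smul_mul]
  have hE : ‖(!![-1, 0; 0, 0] : M2)‖ ≤ 1 := by
    refine M2.norm_le zero_le_one fun i j => ?_
    fin_cases i <;> fin_cases j <;> simp
  have hR : ‖∑ j ∈ Finset.range n, (matProd a j).adjugate * (!![-1, 0; 0, 0] : M2) * matProd a j‖
      ≤ n * (4 * K * 1 * K) := by
    refine (norm_sum_le_of_le _ fun j hj => M2.norm_mul₃_of_le (x := K) ?_ hE
      (hm j (Finset.mem_range.1 hj).le)).trans ?_
    · rw [M2.norm_adjugate]; exact hm j (Finset.mem_range.1 hj).le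
    · simp
  have hR' := M2.norm_mul_of_le (hm n le_rfl) hR
  rw [hsum, Matrix.mul_add, Matrix.mul_smul, Matrix.mul_smul, ← sub_sub] at h
  have h3 := norm_le_norm_add_norm_sub' (matProd (fun j => a j * tilt θ) n - matProd a n -
    (θ : ℂ) • (matProd a n * infSum a n)) (((θ : ℂ) ^ 2) • (matProd a n * ∑ j ∈ Finset.range n,
        (matProd a j).adjugate * (!![-1, 0; 0, 0] : M2) * matProd a j))
  rw [norm_smul, norm_pow, Complex.norm_real, Real.norm_eq_abs, sq_abs] at h3
  refine h3.trans ((add_le_add (mul_le_mul_of_nonneg_left hR' (sq_nonneg θ)) h).trans ?_)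
  have e1 : θ ^ 2 * (2 * K * (n * (4 * K * 1 * K))) ≤ 8 * K ^ 7 * θ ^ 2 := by
    calc θ ^ 2 * (2 * K * (n * (4 * K * 1 * K))) ≤ θ ^ 2 * (2 * K * (K * (4 * K * 1 * K))) := by
          gcongr
      _ = 8 * K ^ 4 * θ ^ 2 := by ring
      _ ≤ 8 * K ^ 7 * θ ^ 2 := by (gcongr; norm_num)
  have e2 : 32 * K ^ 3 * (2 * K * |θ|) ^ 2 * (n : ℝ) ^ 2 ≤ 128 * K ^ 7 * θ ^ 2 := by
    calc 32 * K ^ 3 * (2 * K * |θ|) ^ 2 * (n : ℝ) ^ 2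
        ≤ 32 * K ^ 3 * (2 * K * |θ|) ^ 2 * K ^ 2 := by gcongr
      _ = 128 * K ^ 7 * θ ^ 2 := by rw [mul_pow, sq_abs]; ring
  linarith

/-- For real unimodular products, the averaged infinitesimal rotation is the infinitesimal
rotation times a positive definite symmetric matrix bounded below by the identity. -/
lemma exists_infSum_eq {a : ℕ → M2} {n : ℕ} {K : ℝ} (hn0 : 0 < n) (hK0 : 1 ≤ K)
    (hn : (n : ℝ) ≤ K) (hreal : ∀ j < n, (matProd a j).IsReal)
    (hm : ∀ j < n, ‖matProd a j‖ ≤ K) :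
    ∃ u v w : ℝ, infSum a n = !![-(v : ℂ), -w; u, v] ∧
      (∀ x y : ℝ, x ^ 2 + y ^ 2 ≤ u * x ^ 2 + 2 * v * x * y + w * y ^ 2) ∧
      |u| ≤ 2 * K ^ 3 ∧ |v| ≤ 2 * K ^ 3 ∧ |w| ≤ 2 * K ^ 3 := by
  have h : ∀ j, ∃ a₁ b₁ c₁ d₁ : ℝ, j < n → matProd a j = !![(a₁ : ℂ), b₁; c₁, d₁] := fun j => by
    by_cases hj : j < n
    · obtain ⟨a₁, b₁, c₁, d₁, h⟩ := (hreal j hj).exists_eq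
      exact ⟨a₁, b₁, c₁, d₁, fun _ => h⟩
    · exact ⟨0, 0, 0, 0, fun h => absurd h hj⟩
  choose α β γ δ hm' using h
  have hent : ∀ j < n, |α j| ≤ K ∧ |β j| ≤ K ∧ |γ j| ≤ K ∧ |δ j| ≤ K := fun j hj => by
    have h1 := fun i k => (M2.entry_le (matProd a j) i k).trans (hm j hj)
    rw [hm' j hj] at h1
    refine ⟨?_, ?_, ?_, ?_⟩
    · simpa using h1 0 0
    · simpa using h1 0 1
    · simpa using h1 1 0
    · simpa using h1 1 1
  have hbound : ∀ f g f' g' : ℕ → ℝ, (∀ j < n, |f j| ≤ K ∧ |g j| ≤ K ∧ |f' j| ≤ K ∧ |g' j| ≤ K) →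
      |∑ j ∈ Finset.range n, (f j * g j + f' j * g' j)| ≤ 2 * K ^ 3 := fun f g f' g' hf => by
    refine (Finset.abs_sum_le_sum_abs _ _).trans ?_
    refine (Finset.sum_le_card_nsmul _ _ (2 * K ^ 2) fun j hj => ?_).trans ?_
    · obtain ⟨h1, h2, h3, h4⟩ := hf j (Finset.mem_range.1 hj)
      refine (abs_add_le _ _).trans ?_
      rw [abs_mul, abs_mul]
      have := mul_le_mul h1 h2 (abs_nonneg _) (by linarith)
      have := mul_le_mul h3 h4 (abs_nonneg _) (by linarith)
      linarith
    · rw [Finset.card_range, nsmul_eq_mul]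
      calc (n : ℝ) * (2 * K ^ 2) ≤ K * (2 * K ^ 2) := by gcongr
        _ = 2 * K ^ 3 := by ring
  refine ⟨∑ j ∈ Finset.range n, (α j * α j + γ j * γ j), ∑ j ∈ Finset.range n,
    (α j * β j + γ j * δ j), ∑ j ∈ Finset.range n, (β j * β j + δ j * δ j), ?_, fun x y => ?_,
    hbound _ _ _ _ fun j hj => ?_, hbound _ _ _ _ fun j hj => ?_, hbound _ _ _ _ fun j hj => ?_⟩
  · have hterm : ∀ j ∈ Finset.range n, (matProd a j).adjugate * infRot * matProd a j =
        !![-((α j * β j + γ j * δ j : ℝ) : ℂ), -((β j * β j + δ j * δ j : ℝ) : ℂ);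
          ((α j * α j + γ j * γ j : ℝ) : ℂ), ((α j * β j + γ j * δ j : ℝ) : ℂ)] := fun j hj => by
      rw [hm' j (Finset.mem_range.1 hj), infRot, Matrix.adjugate_fin_two_of]
      ext i k
      fin_cases i <;> fin_cases k <;> simp [Matrix.mul_apply, Fin.sum_univ_two] <;> ring
    rw [infSum, Finset.sum_congr rfl hterm]
    ext i k
    rw [Matrix.sum_apply]
    fin_cases i <;> fin_cases k <;> simp
    all_goals
      rw [← Finset.sum_neg_distrib]
      exact Finset.sum_congr rfl fun _ _ => by ring
  · have h0 := hm' 0 hn0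
    have e00 := congrFun (congrFun h0 0) 0
    have e01 := congrFun (congrFun h0 0) 1
    have e10 := congrFun (congrFun h0 1) 0
    have e11 := congrFun (congrFun h0 1) 1
    simp [matProd] at e00 e01 e10 e11
    have e : x ^ 2 + y ^ 2 = (α 0 * x + β 0 * y) ^ 2 + (γ 0 * x + δ 0 * y) ^ 2 := by
      have f00 : α 0 = 1 := by exact_mod_cast e00.symm
      have f01 : β 0 = 0 := by exact_mod_cast e01.symm
      have f10 : γ 0 = 0 := by exact_mod_cast e10.symm
      have f11 : δ 0 = 1 := by exact_mod_cast e11.symm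
      simp [f00, f01, f10, f11]
    have h1 := Finset.single_le_sum (f := fun j => (α j * x + β j * y) ^ 2 +
      (γ j * x + δ j * y) ^ 2) (fun j _ => by positivity) (Finset.mem_range.2 hn0)
    rw [e]
    refine h1.trans (le_of_eq ?_)
    simp only [Finset.sum_mul, Finset.mul_sum, ← Finset.sum_add_distrib]
    exact Finset.sum_congr rfl fun j _ => by ring
  · exact ⟨(hent j hj).1, (hent j hj).1, (hent j hj).2.2.1, (hent j hj).2.2.1⟩
  · exact ⟨(hent j hj).1, (hent j hj).2.1, (hent j hj).2.2.1, (hent j hj).2.2.2⟩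
  · exact ⟨(hent j hj).2.1, (hent j hj).2.1, (hent j hj).2.2.2, (hent j hj).2.2.2⟩

/-! ### Perturbing to an elliptic cocycle -/

/-- A cocycle over `p / q` whose iterates up to time `q` are bounded by `X`, and whose monodromy
has trace nearly constant and not much larger than `2`. -/
structure IsApproximant (h X : ℝ) (p : ℤ) (q : ℕ) (A : ℂ → M2) : Prop where
  pos_q : 0 < q
  coprime : IsCoprime p q
  pos_h : 0 < h
  large : 10 ^ 4 ≤ X
  q_le : (q : ℝ) ≤ X
  isSL2 : IsSL2Strip h A
  norm_iter_le : ∀ k ≤ q, ∀ z ∈ Strip h, ‖cocycleIter (p / q) A k z‖ ≤ X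
  le_mul : 18 ≤ h * q
  small : 3 * q * (1 + h) * Real.exp (-(h * q / 18)) ≤ X⁻¹ ^ 200
  trace_le : ∃ x : ℝ, ‖(cocycleIter (p / q) A q x).trace‖ ≤ 2 + X⁻¹ ^ 51

lemma half_abs_le_of_form {a b c u v w : ℝ}
    (hP : ∀ x y : ℝ, x ^ 2 + y ^ 2 ≤ u * x ^ 2 + 2 * v * x * y + w * y ^ 2)
    (h : |a ^ 2 + b * c| * |w| ≤ b ^ 2 / 2) : |b| / 2 ≤ |b * u - 2 * a * v - c * w| := by
  rcases eq_or_ne b 0 with rfl | hb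
  · simp
  have h1 := hP b (-a)
  have h2 := neg_abs_le ((a ^ 2 + b * c) * w)
  have h3 := le_abs_self ((a ^ 2 + b * c) * w)
  rw [abs_mul] at h2 h3
  have h4 : b ^ 2 / 2 ≤ b * (b * u - 2 * a * v - c * w) := by nlinarith [sq_nonneg a]
  have h5 := h4.trans (le_abs_self _)
  rw [abs_mul, ← sq_abs] at h5
  have hb' := abs_pos.2 hb
  by_contra! hcon
  nlinarith

lemma one_le_det_of_form {u v w : ℝ}
    (hP : ∀ x y : ℝ, x ^ 2 + y ^ 2 ≤ u * x ^ 2 + 2 * v * x * y + w * y ^ 2) :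
    1 ≤ u * w - v ^ 2 := by
  have h1 := hP 1 0
  have h2 := hP v (-u)
  have hu : 1 ≤ u := by linarith
  have h3 : u * u ≤ u * (u * w - v ^ 2) := by nlinarith [sq_nonneg v]
  exact hu.trans (le_of_mul_le_mul_left h3 (by linarith))

lemma disc_ge_of_abs_le {t r : ℝ} (hr : 0 ≤ r) (h : |t| ≤ 2 - r) : r / 2 ≤ 1 - t ^ 2 / 4 := by
  rw [← sq_abs]
  nlinarith [abs_nonneg t]

lemma M2.norm_det_add_sub_le (M R : M2) :
    ‖(M + R).det - M.det‖ ≤ 4 * ‖M‖ * ‖R‖ + 2 * ‖R‖ ^ 2 := by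
  have e : (M + R).det - M.det = M 0 0 * R 1 1 + R 0 0 * M 1 1 - (M 0 1 * R 1 0 + R 0 1 * M 1 0)
      + R.det := by
    simp only [Matrix.det_fin_two, Matrix.add_apply]
    ring
  have hp : ∀ i j k l, ‖M i j * R k l‖ ≤ ‖M‖ * ‖R‖ ∧ ‖R k l * M i j‖ ≤ ‖M‖ * ‖R‖ :=
    fun i j k l => by
      have := mul_le_mul (M2.entry_le M i j) (M2.entry_le R k l) (norm_nonneg _) (norm_nonneg _)
      rw [_root_.norm_mul, _root_.norm_mul, mul_comm ‖R k l‖]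
      exact ⟨this, this⟩
  rw [e]
  have h1 := norm_add_le (M 0 0 * R 1 1) (R 0 0 * M 1 1)
  have h2 := norm_add_le (M 0 1 * R 1 0) (R 0 1 * M 1 0)
  have h3 := norm_sub_le (M 0 0 * R 1 1 + R 0 0 * M 1 1) (M 0 1 * R 1 0 + R 0 1 * M 1 0)
  have h4 := norm_add_le (M 0 0 * R 1 1 + R 0 0 * M 1 1 - (M 0 1 * R 1 0 + R 0 1 * M 1 0)) R.det
  linarith [M2.norm_det_le R, (hp 0 0 1 1).1, (hp 1 1 0 0).2, (hp 0 1 1 0).1, (hp 1 0 0 1).2]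

lemma norm_sub_half_trace_le_sub_smul (T : M2) (c : ℂ) :
    ‖T - (T.trace / 2) • (1 : M2)‖ ≤ 2 * ‖T - c • (1 : M2)‖ := by
  have h := norm_sub_half_trace_le (T - c • (1 : M2))
  convert h using 2
  rw [Matrix.trace_sub, Matrix.trace_smul, Matrix.trace_one, Fintype.card_fin]
  ext i j
  fin_cases i <;> fin_cases j <;> simp
  all_goals ring

namespace IsApproximant

variable {h X : ℝ} {p : ℤ} {q : ℕ} {A : ℂ → M2}

lemma pos_X (hA : IsApproximant h X p q A) : 0 < X := by linarith [hA.large]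

lemma mul_inv (hA : IsApproximant h X p q A) : X * X⁻¹ = 1 := mul_inv_cancel₀ hA.pos_X.ne'

lemma pos_inv (hA : IsApproximant h X p q A) : 0 < X⁻¹ := inv_pos.2 hA.pos_X

lemma inv_le (hA : IsApproximant h X p q A) : X⁻¹ ≤ 1 / 10 ^ 4 := by
  rw [inv_le_comm₀ hA.pos_X (by positivity)]
  simpa using hA.large

lemma pow_le (hA : IsApproximant h X p q A) {m n : ℕ} (hmn : n < m) :
    10 ^ 4 * X⁻¹ ^ m ≤ X⁻¹ ^ n := by
  have h1 := hA.pos_inv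
  have h2 := hA.inv_le
  have h3 : X⁻¹ ^ m ≤ X⁻¹ ^ (n + 1) :=
    pow_le_pow_of_le_one h1.le (h2.trans (by norm_num)) hmn
  rw [pow_succ] at h3
  have h4 : X⁻¹ ^ n * X⁻¹ ≤ X⁻¹ ^ n * (1 / 10 ^ 4) := by gcongr
  linarith

lemma pow_pos' (hA : IsApproximant h X p q A) (n : ℕ) : 0 < X⁻¹ ^ n := pow_pos hA.pos_inv n

lemma pow_mul_pow (hA : IsApproximant h X p q A) (m n : ℕ) : X ^ m * X⁻¹ ^ (m + n) = X⁻¹ ^ n := by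
  rw [pow_add, ← mul_assoc, ← mul_pow, hA.mul_inv, one_pow, one_mul]

lemma trace_sub_le (hA : IsApproximant h X p q A) {A' : ℂ → M2} (hA' : IsSL2Strip h A') {Y : ℝ}
    (hY : ∀ z ∈ Strip h, ‖cocycleIter (p / q) A' q z‖ ≤ Y) {z w : ℂ} (hz : z ∈ Strip (h / 2))
    (hw : w ∈ Strip (h / 2)) :
    ‖(cocycleIter (p / q) A' q z).trace - (cocycleIter (p / q) A' q w).trace‖
      ≤ 2 * Y * X⁻¹ ^ 200 := by
  have hh := hA.pos_h
  have hle := hA.le_mul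
  refine norm_sub_le_of_rational_period hA.coprime hh (by linarith) ?_
    (M2.differentiableOn_trace (hA'.cocycleIter _ q).1)
    (fun z _ => by simp only [cocycleIter_periodic hA'.2.1])
    (fun z hz => trace_monodromy_periodic hA.pos_q hA'.2.1 (hA'.2.2.2 z hz))
    (fun z hz => (M2.norm_trace_le _).trans (mul_le_mul_of_nonneg_left (hY z hz) zero_le_two))
    hz hw
  refine le_trans ?_ hA.small
  gcongr
  norm_num

/-- The properties of the perturbed cocycle that follow from smallness of the perturbation. -/
lemma tilt_spec (hA : IsApproximant h X p q A) {θ : ℝ} (hθ : |θ| ≤ X⁻¹ ^ 13) :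
    IsSL2Strip h (fun z => A z * tilt θ) ∧
    (∀ k ≤ q, ∀ z ∈ Strip h, ‖cocycleIter (p / q) (fun z => A z * tilt θ) k z‖ ≤ 2 * X) ∧
    (∀ z ∈ Strip h, ‖cocycleIter (p / q) (fun z => A z * tilt θ) q z
      - cocycleIter (p / q) A q z‖ ≤ 16 * X⁻¹ ^ 9) ∧
    ∀ z ∈ Strip h, ‖A z * tilt θ - A z‖ ≤ 2 * X * |θ| := by
  have hX := hA.pos_X
  have hq := hA.q_le
  have hX1 : 1 ≤ X := by linarith [hA.large]
  have hθ1 : |θ| ≤ 1 := by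
    have := hA.pow_le (m := 13) (n := 0) (by norm_num)
    rw [pow_zero] at this
    linarith [hA.pow_pos' 13]
  have hAn : ∀ z ∈ Strip h, ‖A z‖ ≤ X := fun z hz => by
    simpa [cocycleIter_one] using hA.norm_iter_le 1 hA.pos_q z hz
  have hclose : ∀ z ∈ Strip h, ‖A z * tilt θ - A z‖ ≤ 2 * X * |θ| := fun z hz => by
    have := M2.norm_mul_of_le (hAn z hz) (norm_tilt_sub_one_le hθ1)
    rwa [Matrix.mul_sub, Matrix.mul_one] at this
  have hs : 8 * X * (2 * X * |θ|) * q ≤ 1 := by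
    calc 8 * X * (2 * X * |θ|) * q ≤ 8 * X * (2 * X * X⁻¹ ^ 13) * X := by gcongr
      _ = 16 * (X ^ 3 * X⁻¹ ^ 13) := by ring
      _ = 16 * X⁻¹ ^ 10 := by rw [hA.pow_mul_pow 3 10]
      _ ≤ 1 := by
        have := hA.pow_le (m := 10) (n := 0) (by norm_num)
        rw [pow_zero] at this
        linarith
  have hK : ∀ z ∈ Strip h, ∀ j k, j + k ≤ q →
      ‖matProd (fun i => A (z + ((j + i : ℕ) : ℂ) * ((p / q : ℝ) : ℂ))) k‖ ≤ X :=
    fun z hz j k hjk => by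
      rw [matProd_shift_eq_cocycleIter]
      exact hA.norm_iter_le k (by omega) _ (mem_strip_add_mul_real hz j _)
  refine ⟨hA.isSL2.mul ⟨differentiableOn_const _, fun _ => rfl, fun _ => isReal_tilt θ,
    fun _ _ => tilt_det θ⟩, fun k hk z hz => ?_, fun z hz => ?_, hclose⟩
  · rw [cocycleIter_eq_matProd]
    exact norm_matProd_le_of_close
      (a := fun j => A (z + (j : ℂ) * ((p / q : ℝ) : ℂ))) (by positivity)
      (hK z hz) (fun j _ => hclose _ (mem_strip_add_mul_real hz j _)) hs k hk
  · rw [cocycleIter_eq_matProd, cocycleIter_eq_matProd]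
    refine (norm_matProd_sub_le_of_close
      (a := fun j => A (z + (j : ℂ) * ((p / q : ℝ) : ℂ))) (by positivity)
      (hK z hz) (fun j _ => hclose _ (mem_strip_add_mul_real hz j _)) hs q le_rfl).trans ?_
    calc 8 * X ^ 2 * (2 * X * |θ|) * q ≤ 8 * X ^ 2 * (2 * X * X⁻¹ ^ 13) * X := by gcongr
      _ = 16 * (X ^ 4 * X⁻¹ ^ (4 + 9)) := by ring
      _ = 16 * X⁻¹ ^ 9 := by rw [hA.pow_mul_pow]

/-- First-order expansion of the perturbed monodromy on the real line. -/
lemma exists_expansion (hA : IsApproximant h X p q A) (x : ℝ) : ∃ G : M2, ∃ u v w : ℝ,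
    G = !![-(v : ℂ), -w; u, v] ∧
    (∀ x y : ℝ, x ^ 2 + y ^ 2 ≤ u * x ^ 2 + 2 * v * x * y + w * y ^ 2) ∧
    |u| ≤ 2 * X ^ 3 ∧ |v| ≤ 2 * X ^ 3 ∧ |w| ≤ 2 * X ^ 3 ∧ ∀ θ : ℝ, |θ| ≤ X⁻¹ ^ 13 →
      ‖cocycleIter (p / q) (fun z => A z * tilt θ) q x - cocycleIter (p / q) A q x
        - (θ : ℂ) • (cocycleIter (p / q) A q x * G)‖ ≤ 136 * X ^ 7 * θ ^ 2 := by
  have hx := real_mem_strip hA.pos_h x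
  have hX1 : 1 ≤ X := by linarith [hA.large]
  set a : ℕ → M2 := fun j => A (x + (j : ℂ) * ((p / q : ℝ) : ℂ)) with ha
  have hprod : ∀ k, matProd a k = cocycleIter (p / q) A k x := fun k =>
    (cocycleIter_eq_matProd _ _ _ _).symm
  have hK : ∀ j k, j + k ≤ q → ‖matProd (fun i => a (j + i)) k‖ ≤ X := fun j k hjk => by
    simp only [ha]
    rw [matProd_shift_eq_cocycleIter]
    exact hA.norm_iter_le k (by omega) _ (mem_strip_add_mul_real hx j _)
  obtain ⟨u, v, w, hG, hP, hu, hv, hw⟩ := exists_infSum_eq (a := a) hA.pos_q hX1 hA.q_le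
    (fun j _ => by rw [hprod]; exact (hA.isSL2.cocycleIter _ j).2.2.1 x)
    (fun j hj => by simpa using hK 0 j (by omega))
  refine ⟨infSum a q, u, v, w, hG, hP, hu, hv, hw, fun θ hθ => ?_⟩
  have := norm_matProd_tilt_sub_le (θ := θ) hX1 hA.q_le
    (fun j _ => hA.isSL2.2.2.2 _ (mem_strip_add_mul_real hx j _)) hK ?_
  · rwa [hprod, ← cocycleIter_eq_matProd (A := fun z => A z * tilt θ)] at this
  · calc 16 * X ^ 3 * |θ| ≤ 16 * X ^ 3 * X⁻¹ ^ (3 + 10) := by gcongr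
      _ = 16 * X⁻¹ ^ 10 := by rw [mul_assoc, hA.pow_mul_pow]
      _ ≤ 1 := by
        have := hA.pow_le (m := 10) (n := 0) (by norm_num)
        rw [pow_zero] at this
        linarith

end IsApproximant

/-- The parameter `θ` makes the perturbed cocycle elliptic, with the perturbation being small
compared to the degree of ellipticity. -/
structure IsTilt (h X : ℝ) (p : ℤ) (q : ℕ) (A : ℂ → M2) (θ : ℝ) : Prop where
  abs_le : |θ| ≤ X⁻¹ ^ 13
  elliptic : IsElliptic (h / 2) (2 * X) (X⁻¹ ^ 51) p q (fun z => A z * tilt θ)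
  norm_mul_le : ∀ x : ℝ, ‖cocycleIter (p / q) (fun z => A z * tilt θ) q x
      - ((cocycleIter (p / q) (fun z => A z * tilt θ) q x).trace / 2) • (1 : M2)‖ * (2 * X * |θ|)
    ≤ X⁻¹ * √(1 - (cocycleIter (p / q) (fun z => A z * tilt θ) q x).trace.re ^ 2 / 4)

namespace IsApproximant

variable {h X : ℝ} {p : ℤ} {q : ℕ} {A : ℂ → M2}

lemma isTilt (hA : IsApproximant h X p q A) {θ e : ℝ} (hθ : |θ| ≤ X⁻¹ ^ 13)
    (he : X⁻¹ ^ 51 ≤ e ^ 2)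
    (hd : ∀ x : ℝ,
      e ^ 2 ≤ 1 - (cocycleIter (p / q) (fun z => A z * tilt θ) q x).trace.re ^ 2 / 4)
    (hN : ∀ x : ℝ, ‖cocycleIter (p / q) (fun z => A z * tilt θ) q x
      - ((cocycleIter (p / q) (fun z => A z * tilt θ) q x).trace / 2) • (1 : M2)‖ * (2 * X * |θ|)
        ≤ X⁻¹ * e) : IsTilt h X p q A θ := by
  obtain ⟨h1, h2, -, -⟩ := hA.tilt_spec hθ
  have hh := hA.pos_h
  have hX := hA.large
  have hsub : Strip (h / 2) ⊆ Strip h := strip_mono (by linarith)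
  refine ⟨hθ, ⟨hA.pos_q, by linarith, hA.pow_pos' 51, by linarith, h1.mono (by linarith),
    fun k hk z hz => h2 k hk z (hsub hz), fun z hz w hw => ?_, fun x => he.trans (hd x)⟩,
    fun x => (hN x).trans ?_⟩
  · refine (hA.trace_sub_le h1 (h2 q le_rfl) hz hw).trans ?_
    have e1 := hA.pow_mul_pow 1 199
    rw [pow_one] at e1
    have := hA.pow_le (m := 199) (n := 51) (by norm_num)
    have := hA.pow_pos' 199
    calc 2 * (2 * X) * X⁻¹ ^ 200 = 4 * (X * X⁻¹ ^ (1 + 199)) := by ring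
      _ ≤ X⁻¹ ^ 51 / 4 := by rw [e1]; linarith
  · exact mul_le_mul_of_nonneg_left (Real.le_sqrt_of_sq_le (hd x)) hA.pos_inv.le

lemma trace_re_sub_le (hA : IsApproximant h X p q A) {θ : ℝ} (hθ : |θ| ≤ X⁻¹ ^ 13) (x y : ℝ) :
    |(cocycleIter (p / q) (fun z => A z * tilt θ) q x).trace.re
      - (cocycleIter (p / q) (fun z => A z * tilt θ) q y).trace.re| ≤ 4 * X⁻¹ ^ 199 := by
  obtain ⟨h1, h2, -, -⟩ := hA.tilt_spec hθ
  have hh : 0 < h / 2 := by linarith [hA.pos_h]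
  have e1 := hA.pow_mul_pow 1 199
  rw [pow_one] at e1
  rw [← Complex.sub_re]
  calc _ ≤ _ := Complex.abs_re_le_norm _
    _ ≤ _ := hA.trace_sub_le h1 (h2 q le_rfl) (real_mem_strip hh x) (real_mem_strip hh y)
    _ = 4 * (X * X⁻¹ ^ (1 + 199)) := by ring
    _ = 4 * X⁻¹ ^ 199 := by rw [e1]

lemma cocycleIter_real (hA : IsApproximant h X p q A) (x : ℝ) :
    ∃ a b c d : ℝ, cocycleIter (p / q) A q x = !![(a : ℂ), b; c, d] ∧ a * d - b * c = 1 := by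
  have h1 := hA.isSL2.cocycleIter (p / q) q
  obtain ⟨a, b, c, d, hT⟩ := M2.IsReal.exists_eq (h1.2.2.1 x)
  refine ⟨a, b, c, d, hT, ?_⟩
  have h2 := h1.2.2.2 x (real_mem_strip hA.pos_h x)
  rw [hT, Matrix.det_fin_two_of] at h2
  exact_mod_cast h2

/-- If the trace is bounded away from `±2`, no perturbation is needed. -/
lemma isTilt_zero (hA : IsApproximant h X p q A)
    (h0 : |(cocycleIter (p / q) A q (0 : ℝ)).trace.re| ≤ 2 - X⁻¹ ^ 50) :
    IsTilt h X p q A 0 := by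
  have hfun : (fun z => A z * tilt 0) = A := by
    funext z
    rw [tilt_zero, Matrix.mul_one]
  have hθ : |(0 : ℝ)| ≤ X⁻¹ ^ 13 := by simpa using (hA.pow_pos' 13).le
  refine hA.isTilt (e := X⁻¹ ^ 25 / 2) hθ ?_ (fun x => ?_)
    fun x => ?_
  · have := hA.pow_le (m := 51) (n := 50) (by norm_num)
    have := hA.pow_pos' 51
    calc X⁻¹ ^ 51 ≤ X⁻¹ ^ 50 / 4 := by linarith
      _ = (X⁻¹ ^ 25 / 2) ^ 2 := by ring
  · have h1 := hA.trace_re_sub_le hθ x 0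
    rw [hfun] at h1 ⊢
    have h2 := abs_add_le ((cocycleIter (p / q) A q x).trace.re
      - (cocycleIter (p / q) A q (0 : ℝ)).trace.re) (cocycleIter (p / q) A q (0 : ℝ)).trace.re
    rw [sub_add_cancel] at h2
    have h3 := hA.pow_le (m := 199) (n := 50) (by norm_num)
    have h4 := hA.pow_pos' 50
    have := hA.pow_pos' 199
    have := disc_ge_of_abs_le (t := (cocycleIter (p / q) A q x).trace.re) (r := X⁻¹ ^ 50 / 2)
      (by linarith) (by linarith)
    calc (X⁻¹ ^ 25 / 2) ^ 2 = X⁻¹ ^ 50 / 2 / 2 := by ring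
      _ ≤ _ := this
  · have := hA.pos_inv
    rw [abs_zero, mul_zero, mul_zero]
    positivity

/-- If some monodromy matrix is not too close to `±1`, a tiny perturbation suffices. -/
lemma exists_isTilt_of_entry (hA : IsApproximant h X p q A) {σ : ℝ} (hσ : σ = 1 ∨ σ = -1)
    (hnear : ∀ x : ℝ, 2 - 2 * X⁻¹ ^ 50 ≤ σ * (cocycleIter (p / q) A q x).trace.re ∧
      σ * (cocycleIter (p / q) A q x).trace.re ≤ 2 + X⁻¹ ^ 50) {x : ℝ}
    (hx : X⁻¹ ^ 18 ≤ ‖cocycleIter (p / q) A q x 0 1‖ ∨ X⁻¹ ^ 18 ≤ ‖cocycleIter (p / q) A q x 1 0‖) :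
    ∃ θ, IsTilt h X p q A θ := by
  have hX := hA.pos_X
  have hσ1 : |σ| = 1 := by rcases hσ with rfl | rfl <;> simp
  have hσ2 : σ ^ 2 = 1 := by rw [← sq_abs, hσ1, one_pow]
  obtain ⟨a, b, c, d, hT, hdet⟩ := hA.cocycleIter_real x
  obtain ⟨G, u, v, w, hG, hP, hu, -, hw, hexp⟩ := hA.exists_expansion x
  have htr : (cocycleIter (p / q) A q x).trace.re = a + d := by rw [hT]; simp [Matrix.trace_fin_two]
  have p18 := hA.pow_pos' 18
  have p45 := hA.pow_pos' 45
  have p50 := hA.pow_pos' 50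
  have hdisc : |((a - d) / 2) ^ 2 + b * c| ≤ 3 * X⁻¹ ^ 50 := by
    have h1 := hnear x
    rw [htr] at h1
    have h2 : ((a - d) / 2) ^ 2 + b * c = (σ * (a + d) - 2) * (σ * (a + d) + 2) / 4 := by
      linear_combination (- (a + d) ^ 2 / 4) * hσ2 - hdet
    have h3 := hA.pow_le (m := 50) (n := 0) (by norm_num)
    rw [pow_zero] at h3
    rw [h2, abs_div, abs_mul, abs_of_pos (show (0 : ℝ) < 4 by norm_num), div_le_iff₀ (by norm_num)]
    have h4 : |σ * (a + d) - 2| ≤ 2 * X⁻¹ ^ 50 := abs_le.2 ⟨by linarith, by linarith⟩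
    have h5 : |σ * (a + d) + 2| ≤ 5 := abs_le.2 ⟨by linarith, by linarith⟩
    calc _ ≤ 2 * X⁻¹ ^ 50 * 5 := by gcongr
      _ ≤ _ := by linarith
  have hform : ∀ b' w' : ℝ, X⁻¹ ^ 18 ≤ |b'| → |w'| ≤ 2 * X ^ 3 →
      |((a - d) / 2) ^ 2 + b * c| * |w'| ≤ b' ^ 2 / 2 := fun b' w' hb' hw' => by
    have h1 := hA.pow_le (m := 47) (n := 36) (by norm_num)
    have := hA.pow_pos' 47
    calc _ ≤ 3 * X⁻¹ ^ 50 * (2 * X ^ 3) := by gcongr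
      _ = 6 * (X ^ 3 * X⁻¹ ^ (3 + 47)) := by ring
      _ ≤ X⁻¹ ^ 36 / 2 := by rw [hA.pow_mul_pow]; linarith
      _ = (X⁻¹ ^ 18) ^ 2 / 2 := by ring
      _ ≤ |b'| ^ 2 / 2 := by gcongr
      _ = _ := by rw [sq_abs]
  set g := b * u - (a - d) * v - c * w with hg
  have hgle : X⁻¹ ^ 18 / 2 ≤ |g| := by
    rcases hx with hx | hx
    · have hb : X⁻¹ ^ 18 ≤ |b| := by rw [hT] at hx; simpa using hx
      have := half_abs_le_of_form hP (hform b w hb hw)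
      rw [show b * u - 2 * ((a - d) / 2) * v - c * w = g by rw [hg]; ring] at this
      linarith
    · have hc : X⁻¹ ^ 18 ≤ |c| := by rw [hT] at hx; simpa using hx
      have := half_abs_le_of_form (a := -((a - d) / 2)) (b := c) (c := b) (u := w) (v := v)
        (w := u) (fun x y => by linarith [hP y x])
        (by rw [neg_sq, mul_comm c b]; exact hform c u hc hu)
      rw [show c * w - 2 * -((a - d) / 2) * v - b * u = -g by rw [hg]; ring, abs_neg] at this
      linarith
  obtain ⟨θ, hθabs, hθg⟩ : ∃ θ : ℝ, |θ| = X⁻¹ ^ 27 ∧ σ * (θ * g) = -(X⁻¹ ^ 27 * |g|) := by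
    have p27 := abs_of_pos (hA.pow_pos' 27)
    have hsg : σ * g = |g| ∨ σ * g = -|g| := by
      have : |σ * g| = |g| := by rw [abs_mul, hσ1, one_mul]
      rw [← this]
      rcases abs_choice (σ * g) with h | h <;> [left; right] <;> linarith
    rcases hsg with h | h
    · exact ⟨-X⁻¹ ^ 27, by rw [abs_neg, p27], by linear_combination (-X⁻¹ ^ 27) * h⟩
    · exact ⟨X⁻¹ ^ 27, p27, by linear_combination (X⁻¹ ^ 27) * h⟩
  have hθ : |θ| ≤ X⁻¹ ^ 13 := by
    rw [hθabs]
    linarith [hA.pow_le (m := 27) (n := 13) (by norm_num), hA.pow_pos' 27]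
  obtain ⟨-, hiter, hdiff, -⟩ := hA.tilt_spec hθ
  set T' := fun y : ℝ => cocycleIter (p / q) (fun z => A z * tilt θ) q y with hT'
  have hstar : σ * (T' x).trace.re ≤ 2 - X⁻¹ ^ 45 / 4 := by
    have h1 := hexp θ hθ
    set R := T' x - cocycleIter (p / q) A q x - (θ : ℂ) • (cocycleIter (p / q) A q x * G) with hR
    have h2 : T' x = cocycleIter (p / q) A q x + (θ : ℂ) • (cocycleIter (p / q) A q x * G) + R := by
      rw [hR]; abel
    have h3 : (T' x).trace.re = (a + d) + θ * g + R.trace.re := by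
      rw [h2, Matrix.trace_add, Matrix.trace_add, Complex.add_re, Complex.add_re, htr,
        Matrix.trace_smul, hT, hG, Matrix.mul_fin_two, Matrix.trace_fin_two_of]
      rw [show (θ : ℂ) • ((a : ℂ) * -v + b * u + (c * -w + d * v)) = ((θ * g : ℝ) : ℂ) by
        rw [hg]; push_cast; rw [smul_eq_mul]; ring, Complex.ofReal_re]
    have h4 : σ * R.trace.re ≤ 272 * X⁻¹ ^ 47 := by
      calc _ ≤ |σ * R.trace.re| := le_abs_self _
        _ = |R.trace.re| := by rw [abs_mul, hσ1, one_mul]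
        _ ≤ 2 * ‖R‖ := (Complex.abs_re_le_norm _).trans (M2.norm_trace_le R)
        _ ≤ 2 * (136 * X ^ 7 * θ ^ 2) := by gcongr
        _ = 272 * (X ^ 7 * X⁻¹ ^ (7 + 47)) := by rw [← sq_abs θ, hθabs]; ring
        _ = _ := by rw [hA.pow_mul_pow]
    have h5 : X⁻¹ ^ 27 * (X⁻¹ ^ 18 / 2) ≤ X⁻¹ ^ 27 * |g| :=
      mul_le_mul_of_nonneg_left hgle (hA.pow_pos' 27).le
    have h6 : X⁻¹ ^ 27 * (X⁻¹ ^ 18 / 2) = X⁻¹ ^ 45 / 2 := by ring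
    have h7 := (hnear x).2
    rw [htr] at h7
    rw [h3]
    have := hA.pow_le (m := 47) (n := 45) (by norm_num)
    have := hA.pow_le (m := 50) (n := 45) (by norm_num)
    linarith
  have hall : ∀ y : ℝ, |(T' y).trace.re| ≤ 2 - X⁻¹ ^ 45 / 8 := fun y => by
    have h1 : |σ * ((T' y).trace.re - (T' x).trace.re)| ≤ 4 * X⁻¹ ^ 199 := by
      rw [abs_mul, hσ1, one_mul]
      exact hA.trace_re_sub_le hθ y x
    have h2 : |σ * ((T' y).trace.re - (cocycleIter (p / q) A q y).trace.re)| ≤ 32 * X⁻¹ ^ 9 := by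
      rw [abs_mul, hσ1, one_mul, ← Complex.sub_re, ← Matrix.trace_sub]
      calc _ ≤ _ := (Complex.abs_re_le_norm _).trans (M2.norm_trace_le _)
        _ ≤ 2 * (16 * X⁻¹ ^ 9) := by gcongr; exact hdiff y (real_mem_strip hA.pos_h y)
        _ = _ := by ring
    rw [mul_sub] at h1 h2
    have h3 := (hnear y).1
    have h4 := hA.pow_le (m := 199) (n := 45) (by norm_num)
    have h5 := hA.pow_le (m := 9) (n := 0) (by norm_num)
    have h6 := hA.pow_le (m := 50) (n := 0) (by norm_num)
    have := hA.pow_pos' 199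
    rw [pow_zero] at h5 h6
    rw [abs_le] at h1 h2
    rw [← one_mul |(T' y).trace.re|, ← hσ1, ← abs_mul, abs_of_nonneg (by linarith)]
    linarith
  refine ⟨θ, hA.isTilt (e := X⁻¹ ^ 23) hθ ?_ (fun y => ?_) fun y => ?_⟩
  · calc X⁻¹ ^ 51 ≤ X⁻¹ ^ 46 := by
          linarith [hA.pow_le (m := 51) (n := 46) (by norm_num), hA.pow_pos' 51]
      _ = (X⁻¹ ^ 23) ^ 2 := by ring
  · calc (X⁻¹ ^ 23) ^ 2 = X⁻¹ ^ 46 := by ring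
      _ ≤ X⁻¹ ^ 45 / 8 / 2 := by
        linarith [hA.pow_le (m := 46) (n := 45) (by norm_num), hA.pow_pos' 46]
      _ ≤ _ := disc_ge_of_abs_le (by linarith) (hall y)
  · calc _ ≤ 2 * (2 * X) * (2 * X * |θ|) := by
          gcongr
          exact (norm_sub_half_trace_le _).trans
            (by gcongr; exact hiter q le_rfl y (real_mem_strip hA.pos_h y))
      _ = 8 * (X ^ 2 * X⁻¹ ^ (2 + 25)) := by rw [hθabs]; ring
      _ = 8 * X⁻¹ ^ 25 := by rw [hA.pow_mul_pow]
      _ ≤ X⁻¹ ^ 24 := by linarith [hA.pow_le (m := 25) (n := 24) (by norm_num), hA.pow_pos' 25]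
      _ = X⁻¹ * X⁻¹ ^ 23 := by ring

/-- If all monodromy matrices are very close to `±1`, we rotate them. -/
lemma isTilt_of_near_one (hA : IsApproximant h X p q A) {σ : ℝ} (hσ : σ = 1 ∨ σ = -1)
    (hnear : ∀ x : ℝ, 2 - 2 * X⁻¹ ^ 50 ≤ σ * (cocycleIter (p / q) A q x).trace.re ∧
      σ * (cocycleIter (p / q) A q x).trace.re ≤ 2 + X⁻¹ ^ 50)
    (hone : ∀ x : ℝ, ‖cocycleIter (p / q) A q x - (σ : ℂ) • (1 : M2)‖ ≤ 3 * X⁻¹ ^ 18) :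
    IsTilt h X p q A (X⁻¹ ^ 13) := by
  have hX := hA.pos_X
  have p13 := hA.pow_pos' 13
  have hσ1 : |σ| = 1 := by rcases hσ with rfl | rfl <;> simp
  have hσ2 : σ ^ 2 = 1 := by rw [← sq_abs, hσ1, one_pow]
  have hσ2' : (σ : ℂ) ^ 2 = 1 := by exact_mod_cast hσ2
  set θ := X⁻¹ ^ 13 with hθdef
  have hθabs : |θ| = X⁻¹ ^ 13 := abs_of_pos p13
  have hθ : |θ| ≤ X⁻¹ ^ 13 := hθabs.le
  obtain ⟨hSL, -, hdiff, -⟩ := hA.tilt_spec hθ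
  set T' := fun y : ℝ => cocycleIter (p / q) (fun z => A z * tilt θ) q y with hT'
  have key : ∀ x : ℝ, ‖T' x - (σ : ℂ) • (1 : M2)‖ ≤ 3 * X⁻¹ ^ 10 ∧
      X⁻¹ ^ 26 / 2 ≤ 2 - σ * (T' x).trace.re := fun x => by
    obtain ⟨G, u, v, w, hG, hP, hu, hv, hw, hexp⟩ := hA.exists_expansion x
    set T := cocycleIter (p / q) A q x with hT
    have hGn : ‖G‖ ≤ 2 * X ^ 3 := by
      refine M2.norm_le (by positivity) fun i j => ?_
      rw [hG]
      fin_cases i <;> fin_cases j <;> simpa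
    set M := ((θ * σ : ℝ) : ℂ) • G with hM
    set R := (T' x - T - (θ : ℂ) • (T * G)) + (T - (σ : ℂ) • (1 : M2))
      + (θ : ℂ) • ((T - (σ : ℂ) • (1 : M2)) * G) with hR
    have hsum : T' x - (σ : ℂ) • (1 : M2) = M + R := by
      rw [hR, hM, Matrix.sub_mul, smul_sub, Matrix.smul_mul, Matrix.one_mul, smul_smul]
      push_cast
      abel
    have hMn : ‖M‖ ≤ 2 * X⁻¹ ^ 10 := by
      rw [hM, norm_smul, Complex.norm_real, Real.norm_eq_abs, abs_mul, hσ1, hθabs, mul_one]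
      calc _ ≤ X⁻¹ ^ 13 * (2 * X ^ 3) := by gcongr
        _ = 2 * (X ^ 3 * X⁻¹ ^ (3 + 10)) := by ring
        _ = _ := by rw [hA.pow_mul_pow]
    have hRn : ‖R‖ ≤ 4 * X⁻¹ ^ 18 := by
      have h1 : ‖T' x - T - (θ : ℂ) • (T * G)‖ ≤ 136 * X⁻¹ ^ 19 := by
        refine (hexp θ hθ).trans (le_of_eq ?_)
        calc _ = 136 * (X ^ 7 * X⁻¹ ^ (7 + 19)) := by rw [hθdef]; ring
          _ = _ := by rw [hA.pow_mul_pow]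
      have h2 : ‖(θ : ℂ) • ((T - (σ : ℂ) • (1 : M2)) * G)‖ ≤ 12 * X⁻¹ ^ 28 := by
        rw [norm_smul, Complex.norm_real, Real.norm_eq_abs, hθabs]
        calc _ ≤ X⁻¹ ^ 13 * (2 * (3 * X⁻¹ ^ 18) * (2 * X ^ 3)) := by
              gcongr
              exact M2.norm_mul_of_le (hone x) hGn
          _ = 12 * (X ^ 3 * X⁻¹ ^ (3 + 28)) := by ring
          _ = _ := by rw [hA.pow_mul_pow]
      refine (norm_add₃_le).trans ?_
      have := hone x
      have := hA.pow_le (m := 19) (n := 18) (by norm_num)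
      have := hA.pow_le (m := 28) (n := 18) (by norm_num)
      have := hA.pow_pos' 18
      linarith
    refine ⟨?_, ?_⟩
    · rw [hsum]
      have := hA.pow_le (m := 18) (n := 10) (by norm_num)
      have := hA.pow_pos' 18
      linarith [norm_add_le M R]
    · have hdet := M2.norm_det_add_sub_le M R
      have hdet' : 4 * ‖M‖ * ‖R‖ + 2 * ‖R‖ ^ 2 ≤ 64 * X⁻¹ ^ 28 := by
        calc _ ≤ 4 * (2 * X⁻¹ ^ 10) * (4 * X⁻¹ ^ 18) + 2 * (4 * X⁻¹ ^ 18) ^ 2 := by gcongr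
          _ = 32 * X⁻¹ ^ 28 + 32 * X⁻¹ ^ 36 := by ring
          _ ≤ _ := by
            linarith [hA.pow_le (m := 36) (n := 28) (by norm_num), hA.pow_pos' 36]
      have hd1 : (M + R).det = 2 - σ * (T' x).trace := by
        have h1 : (T' x).det = 1 := (hSL.cocycleIter _ q).2.2.2 x (real_mem_strip hA.pos_h x)
        rw [← hsum, Matrix.trace_fin_two]
        rw [Matrix.det_fin_two] at h1 ⊢
        simp
        linear_combination h1 + hσ2'
      have hd2 : M.det = ((X⁻¹ ^ 26 * (u * w - v ^ 2) : ℝ) : ℂ) := by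
        rw [hM, hG, Matrix.det_fin_two, hθdef]
        simp
        linear_combination ((X : ℂ)⁻¹ ^ 26 * (u * w - v ^ 2)) * hσ2'
      rw [hd1, hd2] at hdet
      have h3 := (Complex.abs_re_le_norm _).trans (hdet.trans hdet')
      rw [Complex.sub_re, Complex.ofReal_re, Complex.sub_re, Complex.re_ofReal_mul,
        Complex.re_ofNat] at h3
      have h4 := (abs_le.1 h3).1
      have h5 := mul_le_mul_of_nonneg_left (one_le_det_of_form hP) (hA.pow_pos' 26).le
      have := hA.pow_le (m := 28) (n := 26) (by norm_num)
      have := hA.pow_pos' 28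
      linarith
  refine hA.isTilt (e := X⁻¹ ^ 13 / 2) hθ ?_ (fun y => ?_) fun y => ?_
  · calc X⁻¹ ^ 51 ≤ X⁻¹ ^ 26 / 4 := by
          linarith [hA.pow_le (m := 51) (n := 26) (by norm_num), hA.pow_pos' 51]
      _ = (X⁻¹ ^ 13 / 2) ^ 2 := by ring
  · have h2 : |σ * ((T' y).trace.re - (cocycleIter (p / q) A q y).trace.re)| ≤ 32 * X⁻¹ ^ 9 := by
      rw [abs_mul, hσ1, one_mul, ← Complex.sub_re, ← Matrix.trace_sub]
      calc _ ≤ _ := (Complex.abs_re_le_norm _).trans (M2.norm_trace_le _)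
        _ ≤ 2 * (16 * X⁻¹ ^ 9) := by gcongr; exact hdiff y (real_mem_strip hA.pos_h y)
        _ = _ := by ring
    rw [mul_sub, abs_le] at h2
    have h3 := (hnear y).1
    have h5 := hA.pow_le (m := 9) (n := 0) (by norm_num)
    have h6 := hA.pow_le (m := 50) (n := 0) (by norm_num)
    rw [pow_zero] at h5 h6
    calc (X⁻¹ ^ 13 / 2) ^ 2 = X⁻¹ ^ 26 / 2 / 2 := by ring
      _ ≤ _ := disc_ge_of_abs_le (by linarith [hA.pow_pos' 26]) ?_
    rw [← one_mul |_|, ← hσ1, ← abs_mul, abs_of_nonneg (by linarith)]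
    linarith [(key y).2]
  · calc _ ≤ 2 * (3 * X⁻¹ ^ 10) * (2 * X * |θ|) := by
          gcongr
          exact (norm_sub_half_trace_le_sub_smul _ _).trans (by gcongr; exact (key y).1)
      _ = 12 * (X ^ 1 * X⁻¹ ^ (1 + 22)) := by rw [hθabs]; ring
      _ = 12 * X⁻¹ ^ 22 := by rw [hA.pow_mul_pow]
      _ ≤ X⁻¹ ^ 14 / 2 := by
        linarith [hA.pow_le (m := 22) (n := 14) (by norm_num), hA.pow_pos' 22]
      _ = X⁻¹ * (X⁻¹ ^ 13 / 2) := by ring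

/-- Every approximant can be made elliptic. -/
theorem exists_isTilt (hA : IsApproximant h X p q A) : ∃ θ, IsTilt h X p q A θ := by
  have p50 := hA.pow_pos' 50
  by_cases h0 : |(cocycleIter (p / q) A q (0 : ℝ)).trace.re| ≤ 2 - X⁻¹ ^ 50
  · exact ⟨0, hA.isTilt_zero h0⟩
  rw [not_le] at h0
  have hvar : ∀ x y : ℝ, |(cocycleIter (p / q) A q x).trace.re
      - (cocycleIter (p / q) A q y).trace.re| ≤ 4 * X⁻¹ ^ 199 := fun x y => by
    have := hA.trace_re_sub_le (θ := 0) (by simpa using (hA.pow_pos' 13).le) x y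
    simpa only [tilt_zero, Matrix.mul_one] using this
  have e199 := hA.pow_le (m := 199) (n := 51) (by norm_num)
  have e51 := hA.pow_le (m := 51) (n := 50) (by norm_num)
  have e50 := hA.pow_le (m := 50) (n := 0) (by norm_num)
  rw [pow_zero] at e50
  have p51 := hA.pow_pos' 51
  have p199 := hA.pow_pos' 199
  obtain ⟨σ, hσ, hσ0⟩ : ∃ σ : ℝ, (σ = 1 ∨ σ = -1) ∧
      2 - X⁻¹ ^ 50 < σ * (cocycleIter (p / q) A q (0 : ℝ)).trace.re := by
    rcases lt_abs.1 h0 with h | h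
    · exact ⟨1, Or.inl rfl, by rwa [one_mul]⟩
    · exact ⟨-1, Or.inr rfl, by rwa [neg_one_mul]⟩
  have hσ1 : |σ| = 1 := by rcases hσ with rfl | rfl <;> simp
  have hσ2 : σ ^ 2 = 1 := by rw [← sq_abs, hσ1, one_pow]
  have hvar' : ∀ x y : ℝ, |σ * (cocycleIter (p / q) A q x).trace.re
      - σ * (cocycleIter (p / q) A q y).trace.re| ≤ 4 * X⁻¹ ^ 199 := fun x y => by
    rw [← mul_sub, abs_mul, hσ1, one_mul]
    exact hvar x y
  obtain ⟨x₀, hx₀⟩ := hA.trace_le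
  have hx₀' : σ * (cocycleIter (p / q) A q x₀).trace.re ≤ 2 + X⁻¹ ^ 51 := by
    refine (le_abs_self _).trans ?_
    rw [abs_mul, hσ1, one_mul]
    exact (Complex.abs_re_le_norm _).trans hx₀
  have hnear : ∀ x : ℝ, 2 - 2 * X⁻¹ ^ 50 ≤ σ * (cocycleIter (p / q) A q x).trace.re ∧
      σ * (cocycleIter (p / q) A q x).trace.re ≤ 2 + X⁻¹ ^ 50 := fun x => by
    have h1 := abs_le.1 (hvar' x 0)
    have h2 := abs_le.1 (hvar' x x₀)
    constructor <;> linarith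
  by_cases hent : ∃ x : ℝ, X⁻¹ ^ 18 ≤ ‖cocycleIter (p / q) A q x 0 1‖ ∨
      X⁻¹ ^ 18 ≤ ‖cocycleIter (p / q) A q x 1 0‖
  · obtain ⟨x, hx⟩ := hent
    exact hA.exists_isTilt_of_entry hσ hnear hx
  push Not at hent
  refine ⟨_, hA.isTilt_of_near_one hσ hnear fun x => ?_⟩
  obtain ⟨a, b, c, d, hT, hdet⟩ := hA.cocycleIter_real x
  have htr : (cocycleIter (p / q) A q x).trace.re = a + d := by rw [hT]; simp [Matrix.trace_fin_two]
  obtain ⟨hn1, hn2⟩ := hnear x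
  obtain ⟨hb, hc⟩ := hent x
  rw [htr] at hn1 hn2
  rw [hT] at hb hc ⊢
  replace hb : |b| < X⁻¹ ^ 18 := by simpa using hb
  replace hc : |c| < X⁻¹ ^ 18 := by simpa using hc
  have p18 := hA.pow_pos' 18
  have e18 := hA.pow_le (m := 50) (n := 18) (by norm_num)
  have had : |(a - d) / 2| ≤ 2 * X⁻¹ ^ 18 := by
    refine abs_le_of_sq_le_sq ?_ (by positivity)
    have h1 : ((a - d) / 2) ^ 2 = (σ * (a + d) - 2) * (σ * (a + d) + 2) / 4 - b * c := by
      linear_combination (- (a + d) ^ 2 / 4) * hσ2 - hdet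
    have h2 : |b * c| ≤ X⁻¹ ^ 36 := by
      rw [abs_mul]
      calc _ ≤ X⁻¹ ^ 18 * X⁻¹ ^ 18 := by gcongr
        _ = _ := by ring
    have h3 : (σ * (a + d) - 2) * (σ * (a + d) + 2) ≤ X⁻¹ ^ 50 * 5 :=
      mul_le_mul (by linarith) (by linarith) (by linarith) p50.le
    have e36 := hA.pow_le (m := 50) (n := 36) (by norm_num)
    have p36 := hA.pow_pos' 36
    rw [h1]
    calc _ ≤ 4 * X⁻¹ ^ 36 := by linarith [neg_abs_le (b * c)]
      _ = _ := by ring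
  have hm : |(a + d) / 2 - σ| ≤ X⁻¹ ^ 50 := by
    rw [← one_mul |_|, ← hσ1, ← abs_mul, abs_le]
    constructor <;> linarith
  rw [abs_le] at had hm
  refine M2.norm_le (by positivity) fun i j => ?_
  have r1 : |a - σ| ≤ 3 * X⁻¹ ^ 18 := by rw [abs_le]; constructor <;> linarith
  have r2 : |d - σ| ≤ 3 * X⁻¹ ^ 18 := by rw [abs_le]; constructor <;> linarith
  have r3 : |b| ≤ 3 * X⁻¹ ^ 18 := by linarith
  have r4 : |c| ≤ 3 * X⁻¹ ^ 18 := by linarith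
  have cast : ∀ r : ℝ, |r| ≤ 3 * X⁻¹ ^ 18 → ‖(r : ℂ)‖ ≤ 3 * X⁻¹ ^ 18 := fun r hr => by
    rwa [Complex.norm_real, Real.norm_eq_abs]
  have c1 := cast _ r1
  have c2 := cast _ r2
  rw [Complex.ofReal_sub] at c1 c2
  fin_cases i <;> fin_cases j
  · simpa using c1
  · simpa using r3
  · simpa using r4
  · simpa using c2

end IsApproximant

/-! ### Conjugating close to a rotation -/

lemma M2.norm_sub_le_of_strip {H H' M : ℝ} {f : ℂ → M2} (hf : DifferentiableOn ℂ f (Strip H))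
    (hM : ∀ z ∈ Strip H, ‖f z‖ ≤ M) (hH : H' < H) {z w : ℂ} (hz : z ∈ Strip H')
    (hw : w ∈ Strip H') : ‖f z - f w‖ ≤ 2 * M / (H - H') * ‖z - w‖ := by
  have hz' : z ∈ Strip H := strip_mono hH.le hz
  have hM0 : 0 ≤ M := (norm_nonneg _).trans (hM z hz')
  have hHH : 0 < H - H' := sub_pos.2 hH
  refine M2.norm_le (by positivity) fun i j => ?_
  rw [Matrix.sub_apply]
  exact _root_.norm_sub_le_of_strip (M2.differentiableOn.1 hf i j)
    (fun z hz => (M2.entry_le _ i j).trans (hM z hz)) hH hz hw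

lemma M2.differentiableOn_adjugate {X : ℂ → M2} {s : Set ℂ} (hX : DifferentiableOn ℂ X s) :
    DifferentiableOn ℂ (fun z => (X z).adjugate) s := by
  rw [M2.differentiableOn] at *
  intro i j
  simp only [Matrix.adjugate_fin_two]
  fin_cases i <;> fin_cases j
  · simpa using hX 1 1
  · simpa using (hX 0 1).neg
  · simpa using (hX 1 0).neg
  · simpa using hX 0 0

lemma interpolate_le {X t : ℝ} (hX : 1 ≤ X) (ht : 0 ≤ t) (ht' : t ≤ 1 / 300) :
    (6 * X⁻¹) ^ (1 - t) * (X ^ 114) ^ t ≤ 6 * X ^ (-(1 / 2) : ℝ) := by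
  have hX0 : 0 < X := by linarith
  rw [Real.mul_rpow (by norm_num) (inv_nonneg.2 hX0.le), Real.inv_rpow hX0.le,
    ← Real.rpow_neg hX0.le, ← Real.rpow_natCast X 114, ← Real.rpow_mul hX0.le, mul_assoc,
    ← Real.rpow_add hX0]
  refine mul_le_mul ?_ (Real.rpow_le_rpow_of_exponent_le hX ?_) (by positivity) (by norm_num)
  · calc (6 : ℝ) ^ (1 - t) ≤ 6 ^ (1 : ℝ) :=
        Real.rpow_le_rpow_of_exponent_le (by norm_num) (by linarith)
      _ = 6 := Real.rpow_one 6
  · push_cast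
    linarith

namespace IsApproximant

variable {h X : ℝ} {p : ℤ} {q : ℕ} {A : ℂ → M2}

/-- A polynomially bounded map conjugating a small perturbation of the cocycle, over `p / q`,
nearly to a rotation. -/
lemma exists_conj_rational (hA : IsApproximant h X p q A) :
    ∃ B : ℂ → M2, ∃ μ : ℂ, IsSL2Strip (h / 4) B ∧ ‖μ‖ = 1 ∧
      (∀ z ∈ Strip (h / 4), ‖B z‖ ≤ X ^ 56) ∧
      ∀ x : ℝ, ‖B (x + ((p / q : ℝ) : ℂ)) * A x * (B x).adjugate - rotMul μ‖ ≤ 5 * X⁻¹ := by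
  obtain ⟨θ, hθ⟩ := hA.exists_isTilt
  obtain ⟨-, -, -, hclose⟩ := hA.tilt_spec hθ.abs_le
  have hX := hA.pos_X
  have hL := hA.large
  have hh := hA.pos_h
  have hq : (0 : ℝ) < q := by exact_mod_cast hA.pos_q
  obtain ⟨B, μ, hB, hBn, hBr, hconj, hμ, hμ0⟩ := hθ.elliptic.exists_conj hA.coprime
    (by linarith [hA.le_mul]) (κ := X⁻¹ ^ 200) (by
      refine le_trans ?_ hA.small
      rw [show h / 2 * q / 9 = h * q / 18 by ring]
      gcongr
      linarith) (by
      have := hA.pow_le (m := 193) (n := 103) (by norm_num)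
      have := hA.pow_le (m := 103) (n := 102) (by norm_num)
      have := hA.pow_pos' 103
      have := hA.pow_pos' 193
      calc 8 * (2 * X) * (32 * (2 * X) ^ 2 * q) ^ 2 * X⁻¹ ^ 200
          ≤ 8 * (2 * X) * (32 * (2 * X) ^ 2 * X) ^ 2 * X⁻¹ ^ 200 := by gcongr; exact hA.q_le
        _ = 262144 * (X ^ 7 * X⁻¹ ^ (7 + 193)) := by ring
        _ ≤ X⁻¹ ^ 102 := by rw [hA.pow_mul_pow]; linarith
        _ = (X⁻¹ ^ 51) ^ 2 := by ring)
  rw [show h / 2 / 2 = h / 4 by ring] at hB hBn hconj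
  have hx : ∀ x : ℝ, (x : ℂ) ∈ Strip (h / 4) := real_mem_strip (by linarith)
  refine ⟨B, μ 0, hB, by simpa using hμ 0, fun z hz => ?_, fun x => ?_⟩
  · refine le_of_sq_le_sq ((hBn z hz).trans ?_) (by positivity)
    calc (32 * (2 * X) ^ 2 * q) ^ 2 * (4 * (2 * X) / (X⁻¹ ^ 51) ^ 2)
        ≤ (32 * (2 * X) ^ 2 * X) ^ 2 * (4 * (2 * X) / (X⁻¹ ^ 51) ^ 2) := by
          gcongr; exact hA.q_le
      _ = 131072 * X ^ 109 := by field_simp; ring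
      _ ≤ X ^ 3 * X ^ 109 := by
          gcongr
          calc (131072 : ℝ) ≤ (10 ^ 4) ^ 3 := by norm_num
            _ ≤ X ^ 3 := by gcongr
      _ = (X ^ 56) ^ 2 := by ring
  · set ω : ℝ := p / q with hω
    have hnorm : ∀ y : ℝ, ‖B y‖ ^ 2 * (2 * X * |θ|) ≤ X⁻¹ := fun y => by
      have hd : 0 < √(1 - (cocycleIter ω (fun z => A z * tilt θ) q y).trace.re ^ 2 / 4) :=
        Real.sqrt_pos.2 ((hA.pow_pos' 51).trans_le (hθ.elliptic.disc_ge y))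
      refine le_of_mul_le_mul_right ?_ hd
      calc _ = ‖B y‖ ^ 2 * √(1 - (cocycleIter ω (fun z => A z * tilt θ) q y).trace.re ^ 2 / 4)
              * (2 * X * |θ|) := by ring
        _ ≤ _ := (mul_le_mul_of_nonneg_right (hBr y) (by positivity)).trans (hθ.norm_mul_le y)
    have hdet : (B x).det = 1 := hB.2.2.2 x (hx x)
    have hinv : B x * (B x).adjugate = 1 := by rw [Matrix.mul_adjugate, hdet, one_smul]
    have e : B (x + (ω : ℂ)) * A x * (B x).adjugate - rotMul (μ 0)
        = -(B (x + (ω : ℂ)) * (A x * tilt θ - A x) * (B x).adjugate)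
          + (rotMul (μ x) - rotMul (μ 0)) := by
      rw [Matrix.mul_sub, Matrix.sub_mul, hconj x (hx x), Matrix.mul_assoc (rotMul (μ x)), hinv,
        Matrix.mul_one]
      abel
    have h1 : ‖B (x + (ω : ℂ)) * (A x * tilt θ - A x) * (B x).adjugate‖ ≤ 4 * X⁻¹ := by
      refine (M2.norm_mul₃_of_le le_rfl (hclose x (real_mem_strip hh x))
        (M2.norm_adjugate _).le).trans ?_
      have h2 := hnorm x
      have h3 := hnorm (x + ω)
      rw [Complex.ofReal_add] at h3
      have h4 : 0 ≤ 2 * X * |θ| := by positivity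
      nlinarith [mul_nonneg (sq_nonneg (‖B (x + (ω : ℂ))‖ - ‖B x‖)) h4]
    have h2 : ‖rotMul (μ x) - rotMul (μ 0)‖ ≤ 4 * X⁻¹ ^ 200 :=
      (norm_rotMul_sub_le_of_unimodular (hμ x) (by simpa using hμ 0)).trans (hμ0 x)
    rw [e]
    refine (norm_add_le _ _).trans ?_
    rw [norm_neg]
    have h3 := hA.pow_le (m := 200) (n := 1) (by norm_num)
    have := hA.pow_pos' 200
    rw [pow_one] at h3
    linarith

/-- A cocycle over a frequency very close to `p / q` is conjugated close to a rotation on a strip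
of definite width. -/
theorem exists_near_rotation (hA : IsApproximant h X p q A) {α : ℝ}
    (hα : |α - p / q| ≤ X⁻¹ ^ 120) :
    ∃ B : ℂ → M2, ∃ μ : ℂ, IsSL2Strip (h / 2400) B ∧ ‖μ‖ = 1 ∧
      ∀ z ∈ Strip (h / 2400),
        ‖B (z + α) * A z * (B z)⁻¹ - rotMul μ‖ ≤ 6 * X ^ (-(1 / 2) : ℝ) := by
  obtain ⟨B, μ, hB, hμ, hBn, hconj⟩ := hA.exists_conj_rational
  have hX := hA.pos_X
  have hL := hA.large
  have hh := hA.pos_h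
  have hAn : ∀ z ∈ Strip h, ‖A z‖ ≤ X := fun z hz => by
    simpa [cocycleIter_one] using hA.norm_iter_le 1 hA.pos_q z hz
  have hsub : Strip (h / 4) ⊆ Strip h := strip_mono (by linarith)
  have hx : ∀ x : ℝ, (x : ℂ) ∈ Strip (h / 8) := real_mem_strip (by linarith)
  have hx' : ∀ x : ℝ, (x : ℂ) ∈ Strip (h / 4) := real_mem_strip (by linarith)
  have hF : DifferentiableOn ℂ (fun z => B (z + α) * A z * (B z).adjugate - rotMul μ)
      (Strip (h / 4)) :=
    (M2.differentiableOn_mul (M2.differentiableOn_mul (hB.shift α).1 (hA.isSL2.1.mono hsub))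
      (M2.differentiableOn_adjugate hB.1)).sub_const _
  have hreal : ∀ x : ℝ, ‖B (x + α) * A x * (B x).adjugate - rotMul μ‖ ≤ 6 * X⁻¹ := fun x => by
    have e : B (x + α) * A x * (B x).adjugate - rotMul μ
        = (B (x + α) - B (x + ((p / q : ℝ) : ℂ))) * A x * (B x).adjugate
          + (B (x + ((p / q : ℝ) : ℂ)) * A x * (B x).adjugate - rotMul μ) := by
      rw [Matrix.sub_mul, Matrix.sub_mul]
      abel
    have h1 : ‖B (x + α) - B (x + ((p / q : ℝ) : ℂ))‖ ≤ X⁻¹ ^ 62 := by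
      have h2 := M2.norm_sub_le_of_strip hB.1 hBn (show h / 8 < h / 4 by linarith)
        (mem_strip_add_real (hx x) α) (mem_strip_add_real (hx x) (p / q))
      rw [add_sub_add_left_eq_sub, ← Complex.ofReal_sub, Complex.norm_real, Real.norm_eq_abs] at h2
      have h3 : 1 / h ≤ X := by
        have := hA.le_mul
        have : h * q ≤ h * X := mul_le_mul_of_nonneg_left hA.q_le hh.le
        rw [div_le_iff₀ hh]
        linarith
      calc _ ≤ _ := h2
        _ = 16 * X ^ 56 * (1 / h) * |α - p / q| := by field_simp; ring
        _ ≤ 16 * X ^ 56 * X * X⁻¹ ^ 120 := by gcongr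
        _ = 16 * (X ^ 57 * X⁻¹ ^ (57 + 63)) := by ring
        _ ≤ X⁻¹ ^ 62 := by
          rw [hA.pow_mul_pow]
          linarith [hA.pow_le (m := 63) (n := 62) (by norm_num), hA.pow_pos' 63]
    have h4 : ‖(B (x + α) - B (x + ((p / q : ℝ) : ℂ))) * A x * (B x).adjugate‖ ≤ X⁻¹ := by
      refine (M2.norm_mul₃_of_le h1 (hAn x (hsub (hx' x)))
        ((M2.norm_adjugate _).trans_le (hBn x (hx' x)))).trans ?_
      have := hA.pow_le (m := 5) (n := 1) (by norm_num)
      calc _ = 4 * (X ^ 57 * X⁻¹ ^ (57 + 5)) := by ring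
        _ ≤ X⁻¹ := by
          rw [hA.pow_mul_pow]
          rw [pow_one] at this
          linarith [hA.pow_pos' 5]
    rw [e]
    exact (norm_add_le _ _).trans (by linarith [hconj x])
  have hstrip : ∀ z ∈ Strip (h / 4), ‖B (z + α) * A z * (B z).adjugate - rotMul μ‖ ≤ X ^ 114 :=
    fun z hz => by
      have h1 := M2.norm_mul₃_of_le (hBn _ (mem_strip_add_real hz α)) (hAn z (hsub hz))
        ((M2.norm_adjugate _).trans_le (hBn z hz))
      have h2 : ‖rotMul μ‖ ≤ 1 := norm_rotMul_le hμ.le (by rw [norm_inv, hμ, inv_one])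
      have h3 : 1 ≤ X ^ 113 := one_le_pow₀ (by linarith)
      have h4 : 10 ^ 4 * X ^ 113 ≤ X * X ^ 113 := by gcongr
      calc _ ≤ _ := norm_sub_le _ _
        _ ≤ 4 * X ^ 56 * X * X ^ 56 + 1 := add_le_add h1 h2
        _ = 4 * X ^ 113 + 1 := by ring
        _ ≤ X * X ^ 113 := by linarith
        _ = X ^ 114 := by ring
  refine ⟨B, μ, hB.mono (by linarith), hμ, fun z hz => ?_⟩
  have hz4 : z ∈ Strip (h / 4) := strip_mono (by linarith) hz
  have hz8 : z ∈ Strip (h / 4 / 2) := strip_mono (by linarith) hz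
  rw [M2.inv_eq_adjugate (hB.2.2.2 z hz4)]
  have hz' : |z.im| < h / 2400 := hz
  refine (norm_le_of_three_lines (by linarith) hF hreal hstrip hz8).trans
    (interpolate_le (by linarith) (by positivity) ?_)
  rw [div_le_iff₀ (by positivity)]
  linarith

end IsApproximant

/-! ### Existence of approximants -/

lemma eventually_mul_pow_mul_exp_le (C : ℝ) (n : ℕ) {c : ℝ} (hc : 0 < c) :
    ∀ᶠ q : ℕ in atTop, C * (q : ℝ) ^ n * Real.exp (-(c * q)) ≤ 1 := by
  have h1 := (Real.tendsto_pow_mul_exp_neg_atTop_nhds_zero n).comp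
    (tendsto_natCast_atTop_atTop.const_mul_atTop hc)
  have h2 := h1.const_mul (C / c ^ n)
  rw [mul_zero] at h2
  filter_upwards [h2.eventually (eventually_le_nhds one_pos)] with q hq
  refine le_trans (le_of_eq ?_) hq
  simp only [Function.comp_apply, mul_pow]
  field_simp

lemma exists_norm_cocycleIter_le {α ε δ M : ℝ} {A : ℂ → M2} (hδ : 0 < δ) (hM : 1 ≤ M)
    (hbdd : ∀ z ∈ Strip ε, ‖A z‖ ≤ M)
    (hsub : ∃ N : ℕ, ∀ n : ℕ, N ≤ n → ∀ z ∈ Strip ε, ‖cocycleIter α A n z‖ ≤ Real.exp (δ * n)) :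
    ∀ᶠ q : ℕ in atTop, ∀ k ≤ q, ∀ z ∈ Strip ε, ‖cocycleIter α A k z‖ ≤ Real.exp (δ * q) := by
  obtain ⟨N, hN⟩ := hsub
  have hsmall : ∀ k, ∀ z ∈ Strip ε, ‖cocycleIter α A k z‖ ≤ (2 * M) ^ k := fun k z hz => by
    induction k with
    | zero => simp [cocycleIter]
    | succ k ih =>
      refine (M2.norm_mul_of_le (hbdd _ (mem_strip_add_mul_real hz k α)) ih).trans (le_of_eq ?_)
      ring
  filter_upwards [eventually_mul_pow_mul_exp_le ((2 * M) ^ N) 0 hδ] with q hq k hk z hz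
  rcases le_total N k with h | h
  · refine (hN k h z hz).trans (Real.exp_le_exp.2 ?_)
    gcongr
  · refine (hsmall k z hz).trans ((pow_le_pow_right₀ (by linarith) h).trans ?_)
    rwa [pow_zero, mul_one, Real.exp_neg, ← div_eq_mul_inv, div_le_one (Real.exp_pos _)] at hq

/-- Passing from frequency `α` to a nearby rational frequency. -/
lemma cocycleIter_close {α ω H K η Λ : ℝ} {q : ℕ} {A : ℂ → M2} (hΛ : 0 ≤ Λ) (hη : 0 ≤ η)
    (hK : ∀ k ≤ q, ∀ z ∈ Strip H, ‖cocycleIter α A k z‖ ≤ K)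
    (hLip : ∀ z ∈ Strip H, ∀ w ∈ Strip H, ‖A z - A w‖ ≤ Λ * ‖z - w‖) (hα : |α - ω| ≤ η)
    (hs : 8 * K * (Λ * (q * η)) * q ≤ 1) {k : ℕ} (hk : k ≤ q) {z : ℂ} (hz : z ∈ Strip H) :
    ‖cocycleIter ω A k z‖ ≤ 2 * K ∧
      ‖cocycleIter ω A k z - cocycleIter α A k z‖ ≤ 8 * K ^ 2 * (Λ * (q * η)) * q := by
  have hblock : ∀ j k, j + k ≤ q →
      ‖matProd (fun i => A (z + ((j + i : ℕ) : ℂ) * (α : ℂ))) k‖ ≤ K := fun j k hjk => by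
    rw [matProd_shift_eq_cocycleIter]
    exact hK k (by omega) _ (mem_strip_add_mul_real hz j _)
  have hclose : ∀ j < q, ‖A (z + (j : ℂ) * ω) - A (z + (j : ℂ) * α)‖ ≤ Λ * (q * η) :=
    fun j hj => by
      refine (hLip _ (mem_strip_add_mul_real hz j ω) _ (mem_strip_add_mul_real hz j α)).trans ?_
      rw [add_sub_add_left_eq_sub, ← mul_sub, _root_.norm_mul, Complex.norm_natCast,
        ← Complex.ofReal_sub, Complex.norm_real, Real.norm_eq_abs, abs_sub_comm]
      gcongr
  rw [cocycleIter_eq_matProd, cocycleIter_eq_matProd]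
  exact ⟨norm_matProd_le_of_close (a := fun j => A (z + (j : ℂ) * α)) (by positivity) hblock hclose
    hs k hk, norm_matProd_sub_le_of_close (a := fun j => A (z + (j : ℂ) * α)) (by positivity) hblock
    hclose hs k hk⟩

/-- Rational approximants of a subcritical cocycle over an exponentially Liouville frequency. -/
theorem exists_approximant {α ε M : ℝ} (hirr : Irrational α) (hliou : ExpLiouville α) (hε : 0 < ε)
    {A : ℂ → M2} (hA : IsSL2Strip ε A) (hM : 1 ≤ M) (hbdd : ∀ z ∈ Strip ε, ‖A z‖ ≤ M)
    (hsub : ∀ δ : ℝ, 0 < δ → ∃ N : ℕ, ∀ n : ℕ, N ≤ n → ∀ z ∈ Strip ε,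
      ‖cocycleIter α A n z‖ ≤ Real.exp (δ * n)) (X₀ : ℝ) :
    ∃ (X : ℝ) (p : ℤ) (q : ℕ), X₀ ≤ X ∧ IsApproximant (ε / 2) X p q A ∧
      |α - p / q| ≤ X⁻¹ ^ 120 := by
  obtain ⟨β, hβ, happrox⟩ := hliou.exists_approx hirr
  obtain ⟨δ, hδ, hδβ, hδε⟩ : ∃ δ : ℝ, 0 < δ ∧ 120 * δ ≤ β ∧ 14400 * δ ≤ ε :=
    ⟨min (β / 120) (ε / 14400), by positivity,
      by linarith [min_le_left (β / 120) (ε / 14400)],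
      by linarith [min_le_right (β / 120) (ε / 14400)]⟩
  set Λ := 4 * M / ε with hΛ
  have hΛ0 : 0 ≤ Λ := by positivity
  have hall := (exists_norm_cocycleIter_le (half_pos hδ) hM hbdd (hsub _ (half_pos hδ))).and
    ((eventually_mul_pow_mul_exp_le (10 ^ 4) 0 hδ).and
    ((eventually_mul_pow_mul_exp_le X₀ 0 hδ).and
    ((eventually_mul_pow_mul_exp_le 1 1 hδ).and
    ((eventually_mul_pow_mul_exp_le (32 * Λ + 64 / ε + 2) 2 hδ).and
    ((eventually_mul_pow_mul_exp_le (3 * (1 + ε / 2)) 1 hδ).and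
    (eventually_ge_atTop ⌈36 / ε⌉₊))))))
  obtain ⟨N, hN⟩ := eventually_atTop.1 hall
  obtain ⟨p, q, hNq, hq, hpq, hα⟩ := happrox N
  obtain ⟨hiter, e1, e2, e3, e4, e5, e6⟩ := hN q hNq
  have hq0 : (0 : ℝ) < q := by exact_mod_cast hq
  have hq1 : (1 : ℝ) ≤ q := by exact_mod_cast hq
  set X := Real.exp (δ * q) with hXdef
  set ξ := X⁻¹ with hξdef
  have hX : 0 < X := Real.exp_pos _
  have hξ : 0 < ξ := inv_pos.2 hX
  have hξX : X * ξ = 1 := mul_inv_cancel₀ hX.ne'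
  have hexp : Real.exp (-(δ * q)) = ξ := Real.exp_neg _
  rw [hexp, ← div_eq_mul_inv, div_le_one hX, pow_zero, mul_one] at e1 e2
  rw [hexp, pow_one, one_mul] at e3
  rw [hexp] at e4
  rw [hexp, pow_one] at e5
  have hX1 : 1 ≤ X := by linarith
  have hξ1 : ξ ≤ 1 / 10 ^ 4 := by
    rw [hξdef, inv_le_comm₀ hX (by positivity)]
    simpa using e1
  have hpow : ∀ n : ℕ, Real.exp (-(n * (δ * q))) = ξ ^ n := fun n => by
    rw [← hexp, ← Real.exp_nat_mul]
    ring_nf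
  have hα' : |α - p / q| ≤ ξ ^ 120 := by
    refine hα.trans ?_
    rw [← hpow]
    refine Real.exp_le_exp.2 (neg_le_neg ?_)
    push_cast
    nlinarith
  set K := Real.exp (δ / 2 * q) with hKdef
  have hK1 : 1 ≤ K := Real.one_le_exp (by positivity)
  have hKX : K ^ 2 = X := by
    rw [hKdef, hXdef, ← Real.exp_nat_mul]
    push_cast
    ring_nf
  have hKX' : K ≤ X := by nlinarith
  have h2KX : 2 * K ≤ X := by nlinarith
  have e118 : X * (ξ * ξ ^ 118) = ξ ^ 118 := by rw [← mul_assoc, hξX, one_mul]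
  have hE : ∀ c : ℝ, c ≤ 32 * Λ + 64 / ε + 2 → c * q ^ 2 * ξ ≤ 1 := fun c hc =>
    le_trans (by gcongr) e4
  have hεpos : 0 < 64 / ε := by positivity
  have hbig : ∀ c : ℝ, 0 ≤ c → c ≤ 32 * Λ + 64 / ε + 2 → c * q ^ 2 * X * ξ ^ 120 ≤ ξ ^ 118 :=
    fun c hc0 hc => by
      calc c * q ^ 2 * X * ξ ^ 120 = c * q ^ 2 * ξ * (X * (ξ * ξ ^ 118)) := by ring
        _ ≤ 1 * ξ ^ 118 := by rw [e118]; gcongr; exact hE c hc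
        _ = ξ ^ 118 := one_mul _
  have hξ118 : ξ ^ 118 ≤ 1 := pow_le_one₀ hξ.le (by linarith)
  have hhalf : Strip (ε / 2) ⊆ Strip ε := strip_mono (by linarith)
  have hLip : ∀ z ∈ Strip (ε / 2), ∀ w ∈ Strip (ε / 2), ‖A z - A w‖ ≤ Λ * ‖z - w‖ :=
    fun z hz w hw => by
      refine (M2.norm_sub_le_of_strip hA.1 hbdd (by linarith) hz hw).trans (le_of_eq ?_)
      rw [hΛ]
      field_simp
      ring
  have hcl : ∀ k ≤ q, ∀ z ∈ Strip (ε / 2), _ := fun k hk z hz =>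
    cocycleIter_close (ω := p / q) hΛ0 (by positivity) (fun k hk z hz => hiter k hk z (hhalf hz))
      hLip hα' (by
        calc 8 * K * (Λ * (q * ξ ^ 120)) * q = 8 * Λ * q ^ 2 * K * ξ ^ 120 := by ring
          _ ≤ 8 * Λ * q ^ 2 * X * ξ ^ 120 := by gcongr
          _ ≤ ξ ^ 118 := hbig _ (by positivity) (by linarith)
          _ ≤ 1 := hξ118) hk hz
  have hx : ∀ x : ℝ, (x : ℂ) ∈ Strip (ε / 2) := real_mem_strip (by linarith)
  have hceil : 36 ≤ ε * q := by
    have := (Nat.ceil_le.1 e6)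
    rw [div_le_iff₀ hε] at this
    linarith
  refine ⟨X, p, q, e2, ⟨hq, hpq, by linarith, e1, ?_, hA.mono (by linarith), fun k hk z hz => ?_,
    by linarith, ?_, ?_⟩, hα'⟩
  · rwa [← div_eq_mul_inv, div_le_one hX] at e3
  · exact (hcl k hk z hz).1.trans h2KX
  · have h1 : Real.exp (-(ε / 2 * q / 18)) ≤ ξ ^ 201 := by
      rw [← hpow]
      refine Real.exp_le_exp.2 (neg_le_neg ?_)
      push_cast
      nlinarith
    calc 3 * q * (1 + ε / 2) * Real.exp (-(ε / 2 * q / 18))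
        ≤ 3 * q * (1 + ε / 2) * ξ ^ 201 := by gcongr
      _ = 3 * (1 + ε / 2) * q * ξ * ξ ^ 200 := by ring
      _ ≤ 1 * ξ ^ 200 := by gcongr
      _ = ξ ^ 200 := one_mul _
  · obtain ⟨x, hxt⟩ := exists_trace_lt_of_subexponential (p := p) hq hε (pow_pos hξ 118) hA hsub
      fun x => by
        have h1 := M2.norm_sub_le_of_strip (hA.cocycleIter α q).1 (hiter q le_rfl)
          (show ε / 2 < ε by linarith) (hx (x + (q * α - p))) (hx x)
        rw [← Complex.ofReal_sub, Complex.norm_real, Real.norm_eq_abs, add_sub_cancel_left,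
          show (q : ℝ) * α - p = q * (α - p / q) by field_simp, abs_mul, abs_of_pos hq0] at h1
        calc _ ≤ 2 * (2 * K / (ε - ε / 2) * (q * |α - p / q|)) := by
              rw [show (q : ℝ) * α - p = q * (α - p / q) by field_simp]
              linarith
          _ ≤ 2 * (2 * X / (ε - ε / 2) * (q ^ 2 * ξ ^ 120)) := by
              have : (q : ℝ) ≤ q ^ 2 := by nlinarith
              have : 0 < ε - ε / 2 := by linarith
              gcongr
          _ = 8 / ε * q ^ 2 * X * ξ ^ 120 := by field_simp; ring
          _ ≤ ξ ^ 118 := hbig _ (by positivity) (by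
              have : 8 / ε ≤ 64 / ε := by gcongr; norm_num
              linarith)
    refine ⟨x, ?_⟩
    have h2 : ‖(cocycleIter (p / q) A q x).trace - (cocycleIter α A q x).trace‖ ≤ ξ ^ 118 := by
      rw [← Matrix.trace_sub]
      calc _ ≤ _ := M2.norm_trace_le _
        _ ≤ 2 * (8 * K ^ 2 * (Λ * (q * ξ ^ 120)) * q) := by gcongr; exact (hcl q le_rfl x (hx x)).2
        _ = 16 * Λ * q ^ 2 * X * ξ ^ 120 := by rw [hKX]; ring
        _ ≤ _ := hbig _ (by positivity) (by linarith)
    have h3 : ξ ^ 118 ≤ ξ ^ 52 := pow_le_pow_of_le_one hξ.le (by linarith) (by norm_num)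
    have h4 : ξ ^ 52 ≤ ξ ^ 51 * (1 / 10 ^ 4) := by
      rw [pow_succ]
      gcongr
    have h5 : 0 < ξ ^ 51 := pow_pos hξ 51
    have h6 := norm_le_insert' (cocycleIter (p / q) A q x).trace (cocycleIter α A q x).trace
    linarith

/-- **Theorem 1.** If `α` is an exponentially Liouville irrational, then every subcritical
analytic cocycle `(α, A)` is almost reducible. -/
theorem subcritical_almostReducible_of_expLiouville
    (α : ℝ) (hirr : Irrational α) (hliou : ExpLiouville α)
    (ε₀ : ℝ) (hε₀ : 0 < ε₀) (A : ℂ → M2) (hA : IsSL2Strip ε₀ A)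
    (hbdd : ∃ M : ℝ, ∀ z ∈ Strip ε₀, ‖A z‖ ≤ M)
    (hsub : ∀ δ : ℝ, 0 < δ → ∃ N : ℕ, ∀ n : ℕ, N ≤ n → ∀ z ∈ Strip ε₀,
      ‖cocycleIter α A n z‖ ≤ Real.exp (δ * n)) :
    AlmostReducible α ε₀ A := by
  obtain ⟨M, hM⟩ := hbdd
  have hM' : ∀ z ∈ Strip ε₀, ‖A z‖ ≤ max M 1 := fun z hz => (hM z hz).trans (le_max_left _ _)
  have hstep : ∀ n : ℕ, ∃ B : ℂ → M2, ∃ μ : ℂ, IsSL2Strip (ε₀ / 2 / 2400) B ∧ ‖μ‖ = 1 ∧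
      ∀ z ∈ Strip (ε₀ / 2 / 2400), ‖B (z + α) * A z * (B z)⁻¹ - rotMul μ‖ ≤ 1 / (n + 1) :=
    fun n => by
      obtain ⟨X, p, q, hX, happ, hα⟩ := exists_approximant hirr hliou hε₀ hA (le_max_right M 1)
        hM' hsub ((6 * (n + 1)) ^ 2)
      obtain ⟨B, μ, hB, hμ, hconj⟩ := happ.exists_near_rotation hα
      refine ⟨B, μ, hB, hμ, fun z hz => (hconj z hz).trans ?_⟩
      have hsqrt : 6 * (n + 1 : ℝ) ≤ √X := Real.le_sqrt_of_sq_le hX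
      rw [Real.rpow_neg happ.pos_X.le, ← Real.sqrt_eq_rpow, ← div_eq_mul_inv,
        div_le_div_iff₀ (Real.sqrt_pos.2 happ.pos_X) (by positivity)]
      linarith
  choose B μ hB hμ hconj using hstep
  obtain ⟨ν, hν, φ, hφ, hlim⟩ := (isCompact_sphere (0 : ℂ) 1).tendsto_subseq
    (fun n => mem_sphere_zero_iff_norm.2 (hμ n))
  rw [mem_sphere_zero_iff_norm] at hν
  refine ⟨ε₀ / 2 / 2400, by positivity, by linarith, fun n => B (φ n), fun n =>
    ⟨(hB _).1, ⟨1, Or.inl rfl, fun z => by simp only [(hB _).2.1, one_smul]⟩, (hB _).2.2⟩, rotMul ν,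
    fun δ hδ => ?_⟩
  obtain ⟨N₁, hN₁⟩ := Metric.tendsto_atTop.1 hlim (δ / 2) (half_pos hδ)
  obtain ⟨N₂, hN₂⟩ := exists_nat_one_div_lt (half_pos hδ)
  refine ⟨max N₁ N₂, fun n hn z hz => ?_⟩
  have h1 := hN₁ n ((le_max_left _ _).trans hn)
  rw [dist_eq_norm] at h1
  have h2 : (1 : ℝ) / (φ n + 1) ≤ 1 / (N₂ + 1) := by
    gcongr
    exact (le_max_right _ _).trans (hn.trans (hφ.id_le n))
  calc _ ≤ _ := norm_sub_le_norm_sub_add_norm_sub _ (rotMul (μ (φ n))) _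
    _ ≤ 1 / (φ n + 1) + δ / 2 := add_le_add (hconj _ z hz)
        ((norm_rotMul_sub_le_of_unimodular (hμ _) hν).trans h1.le)
    _ ≤ δ := by linarith
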